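/- arXiv:0901.1705 — 3 statements merged into one kernel-verified Lean document; each statement's English description precedes it below -/
import Mathlib

section
/- Corollary 1 (single-channel lossless private messages): If (W_1, …, W_t) — Y_t — Y_{t−1} — ⋯ — Y_1 forms a Markov chain under q and each δ_l is the per-letter error indicator, then R(0,0,…,0) = Σ_{l=1}^t H(W_l | W_1, W_2, …, W_{l−1}, Y_l), where H denotes base-2 conditional Shannon entropy. -/
open scoped BigOperators Classical

noncomputable section

/-- Probability that the random variable `A` takes the value `a` under the pmf `p`. -/
def pOf {Ω α : Type*} [Fintype Ω] (p : Ω → ℝ) (A : Ω → α) (a : α) : ℝ :=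
  ∑ ω, if A ω = a then p ω else 0

/-- Base-2 Shannon entropy of the random variable `A` under the pmf `p`. -/
def H2 {Ω α : Type*} [Fintype Ω] [Fintype α] (p : Ω → ℝ) (A : Ω → α) : ℝ :=
  -∑ a, pOf p A a * Real.logb 2 (pOf p A a)

/-- Conditional entropy `H(A | B)` (base 2). -/
def condH {Ω α β : Type*} [Fintype Ω] [Fintype α] [Fintype β]
    (p : Ω → ℝ) (A : Ω → α) (B : Ω → β) : ℝ :=
  H2 p (fun ω => (A ω, B ω)) - H2 p B

/-- Mutual information `I(A; B)` (base 2). -/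
def MI {Ω α β : Type*} [Fintype Ω] [Fintype α] [Fintype β]
    (p : Ω → ℝ) (A : Ω → α) (B : Ω → β) : ℝ :=
  H2 p A + H2 p B - H2 p (fun ω => (A ω, B ω))

/-- Conditional mutual information `I(A; B | C)` (base 2). -/
def CMI {Ω α β γ : Type*} [Fintype Ω] [Fintype α] [Fintype β] [Fintype γ]
    (p : Ω → ℝ) (A : Ω → α) (B : Ω → β) (C : Ω → γ) : ℝ :=
  H2 p (fun ω => (A ω, C ω)) + H2 p (fun ω => (B ω, C ω))
    - H2 p (fun ω => (A ω, B ω, C ω)) - H2 p C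

/-- `A` and `C` are conditionally independent given `B` under the pmf `p`,
    i.e. `A — B — C` is a Markov chain. -/
def CondIndep {Ω α β γ : Type*} [Fintype Ω] (p : Ω → ℝ)
    (A : Ω → α) (B : Ω → β) (C : Ω → γ) : Prop :=
  ∀ a b c,
    pOf p (fun ω => (A ω, B ω, C ω)) (a, b, c) * pOf p B b
      = pOf p (fun ω => (A ω, B ω)) (a, b) * pOf p (fun ω => (B ω, C ω)) (b, c)

/-- `p` is a probability mass function. -/
def IsPMF {Ω : Type*} [Fintype Ω] (p : Ω → ℝ) : Prop :=
  (∀ ω, 0 ≤ p ω) ∧ ∑ ω, p ω = 1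

/-- The iid extension of a pmf to sequences of length `n`. -/
def iidPMF {A : Type*} (q : A → ℝ) (n : ℕ) : (Fin n → A) → ℝ :=
  fun ω => ∏ i, q (ω i)

/-- A rate tuple `r` is `d`-admissible for the `t`-stage successive-refinement problem
with source pmf `q` and per-letter distortion measures `δ`: for every `ε > 0` there are
a blocklength `n`, finite message sets (of sizes `M l`), an encoder `f`, and decoders
`g l` (decoder `l` sees the messages of channels `1,…,l` and its side-information
sequence) such that every channel rate is at most `r l + ε` and every expected average
distortion is at most `d l + ε`. -/
def Admissible {t : ℕ} {X : Type*} [Fintype X] {Y : Fin t → Type*} [∀ l, Fintype (Y l)]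
    {Xh : Fin t → Type*}
    (q : X × (∀ l, Y l) → ℝ) (δ : ∀ l, X → Xh l → ℝ) (d r : Fin t → ℝ) : Prop :=
  (∀ l, 0 ≤ r l) ∧
  ∀ ε : ℝ, 0 < ε →
    ∃ (n : ℕ) (_ : 0 < n) (M : Fin t → ℕ) (_ : ∀ l, 1 ≤ M l)
      (f : (Fin n → X) → ∀ l, Fin (M l))
      (g : ∀ l : Fin t, (∀ k : Fin t, k ≤ l → Fin (M k)) → (Fin n → Y l) → Fin n → Xh l),
      (∀ l, Real.logb 2 (M l) / n ≤ r l + ε) ∧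
      (∀ l, (∑ ω : Fin n → X × (∀ l', Y l'),
          iidPMF q n ω *
            ((n : ℝ)⁻¹ * ∑ i, δ l (ω i).1
              (g l (fun k _ => f (fun i' => (ω i').1) k) (fun i' => (ω i').2 l) i)))
        ≤ d l + ε)

/-- The rate-distortion function for lossy source coding with side-information at `t`
decoders: the least single-channel rate `r` such that `(r, 0, …, 0)` is `d`-admissible. -/
def RdFun {t : ℕ} {X : Type*} [Fintype X] {Y : Fin t → Type*} [∀ l, Fintype (Y l)]
    {Xh : Fin t → Type*}
    (q : X × (∀ l, Y l) → ℝ) (δ : ∀ l, X → Xh l → ℝ) (ht : 0 < t)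
    (d : Fin t → ℝ) : ℝ :=
  sInf {r : ℝ | 0 ≤ r ∧
    Admissible q δ d (fun l => if l = (⟨0, ht⟩ : Fin t) then r else 0)}

lemma pOf_nonneg' {Ω α : Type*} [Fintype Ω] {p : Ω → ℝ} (hp : ∀ ω, 0 ≤ p ω) (A : Ω → α) (a : α) :
    0 ≤ pOf p A a := by
  unfold pOf
  refine Finset.sum_nonneg fun ω _ => ?_
  split_ifs
  · exact hp ω
  · exact le_rfl

lemma pOf_pos' {Ω α : Type*} [Fintype Ω] {p : Ω → ℝ} (hp : ∀ ω, 0 ≤ p ω) (A : Ω → α) {ω : Ω}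
    (h : 0 < p ω) : 0 < pOf p A (A ω) := by
  unfold pOf
  refine Finset.sum_pos' (fun ω' _ => ?_) ⟨ω, Finset.mem_univ _, by simpa using h⟩
  split_ifs
  · exact hp ω'
  · exact le_rfl

lemma sum_pOf_mul {Ω α : Type*} [Fintype Ω] [Fintype α] (p : Ω → ℝ) (A : Ω → α) (f : α → ℝ) :
    ∑ a, pOf p A a * f a = ∑ ω, p ω * f (A ω) := by
  unfold pOf
  simp_rw [Finset.sum_mul]
  rw [Finset.sum_comm]
  refine Finset.sum_congr rfl fun ω _ => ?_
  rw [Finset.sum_eq_single (A ω)]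
  · simp
  · intro b _ hb
    simp [Ne.symm hb]
  · simp

lemma H2_eq {Ω α : Type*} [Fintype Ω] [Fintype α] (p : Ω → ℝ) (A : Ω → α) :
    H2 p A = ∑ ω, p ω * (-Real.logb 2 (pOf p A (A ω))) := by
  unfold H2
  rw [← sum_pOf_mul p A (fun a => -Real.logb 2 (pOf p A a)), ← Finset.sum_neg_distrib]
  simp

lemma pOf_congr {Ω α β : Type*} [Fintype Ω] (p : Ω → ℝ) (A : Ω → α) (B : Ω → β) (a : α) (b : β)
    (h : ∀ ω, A ω = a ↔ B ω = b) : pOf p A a = pOf p B b := by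
  unfold pOf
  refine Finset.sum_congr rfl fun ω _ => ?_
  simp only [h]

lemma H2_congr {Ω α β : Type*} [Fintype Ω] [Fintype α] [Fintype β] (p : Ω → ℝ)
    (A : Ω → α) (B : Ω → β) (h : ∀ ω ω', A ω = A ω' ↔ B ω = B ω') : H2 p A = H2 p B := by
  rw [H2_eq, H2_eq]
  refine Finset.sum_congr rfl fun ω _ => ?_
  rw [pOf_congr p A B (A ω) (B ω) fun ω' => h ω' ω]

lemma condH_congr {Ω α β α' β' : Type*} [Fintype Ω] [Fintype α] [Fintype β] [Fintype α']
    [Fintype β'] (p : Ω → ℝ) (A : Ω → α) (B : Ω → β) (A' : Ω → α') (B' : Ω → β')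
    (hA : ∀ ω ω', A ω = A ω' ↔ A' ω = A' ω') (hB : ∀ ω ω', B ω = B ω' ↔ B' ω = B' ω') :
    condH p A B = condH p A' B' := by
  unfold condH
  rw [H2_congr p B B' hB, H2_congr p (fun ω => (A ω, B ω)) (fun ω => (A' ω, B' ω))]
  intro ω ω'
  simp only [Prod.mk.injEq, hA, hB]

lemma sum_pOf_fst {Ω α β : Type*} [Fintype Ω] [Fintype α] (p : Ω → ℝ) (A : Ω → α) (B : Ω → β)
    (b : β) : ∑ a, pOf p (fun ω => (A ω, B ω)) (a, b) = pOf p B b := by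
  unfold pOf
  rw [Finset.sum_comm]
  refine Finset.sum_congr rfl fun ω _ => ?_
  simp only [Prod.mk.injEq, ite_and]
  simp

lemma pOf_pair_le {Ω α β : Type*} [Fintype Ω] {p : Ω → ℝ} (hp : ∀ ω, 0 ≤ p ω) (A : Ω → α)
    (B : Ω → β) (a : α) (b : β) : pOf p (fun ω => (A ω, B ω)) (a, b) ≤ pOf p B b := by
  unfold pOf
  refine Finset.sum_le_sum fun ω _ => ?_
  have := hp ω
  by_cases h1 : A ω = a <;> by_cases h2 : B ω = b <;> simp [h1, h2, this]

lemma condH_eq {Ω α β : Type*} [Fintype Ω] [Fintype α] [Fintype β] {p : Ω → ℝ}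
    (hp : ∀ ω, 0 ≤ p ω) (A : Ω → α) (B : Ω → β) :
    condH p A B = ∑ ω, p ω * (-Real.logb 2
      (pOf p (fun ω => (A ω, B ω)) (A ω, B ω) / pOf p B (B ω))) := by
  unfold condH
  rw [H2_eq, H2_eq, ← Finset.sum_sub_distrib]
  refine Finset.sum_congr rfl fun ω _ => ?_
  rcases (hp ω).eq_or_lt with h | h
  · simp [← h]
  · have h1 := pOf_pos' hp (fun ω => (A ω, B ω)) h
    have h2 := pOf_pos' hp B h
    rw [Real.logb_div h1.ne' h2.ne']
    ring

lemma condH_nonneg {Ω α β : Type*} [Fintype Ω] [Fintype α] [Fintype β] {p : Ω → ℝ}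
    (hp : ∀ ω, 0 ≤ p ω) (A : Ω → α) (B : Ω → β) : 0 ≤ condH p A B := by
  rw [condH_eq hp]
  refine Finset.sum_nonneg fun ω _ => mul_nonneg (hp ω) ?_
  rw [neg_nonneg]
  refine Real.logb_nonpos one_lt_two (div_nonneg (pOf_nonneg' hp _ _) (pOf_nonneg' hp _ _)) ?_
  exact div_le_one_of_le₀ (pOf_pair_le hp A B _ _) (pOf_nonneg' hp _ _)

lemma gibbs {Ω α β : Type*} [Fintype Ω] [Fintype α] [Fintype β] {p : Ω → ℝ}
    (hp : IsPMF p) (A : Ω → α) (B : Ω → β) (Q : α → β → ℝ) (hQ0 : ∀ a b, 0 ≤ Q a b)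
    (hQ1 : ∀ b, ∑ a, Q a b ≤ 1) (hpos : ∀ ω, 0 < p ω → 0 < Q (A ω) (B ω)) :
    condH p A B ≤ ∑ ω, p ω * (-Real.logb 2 (Q (A ω) (B ω))) := by
  rw [condH_eq hp.1]
  have hl2 : 0 < Real.log 2 := Real.log_pos one_lt_two
  set PAB : α × β → ℝ := pOf p (fun ω => (A ω, B ω)) with hPAB
  set PB : β → ℝ := pOf p B with hPB
  have key : ∀ ω, p ω * (-Real.logb 2 (PAB (A ω, B ω) / PB (B ω)))
      - p ω * (-Real.logb 2 (Q (A ω) (B ω)))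
      ≤ (p ω * (Q (A ω) (B ω) * PB (B ω) / PAB (A ω, B ω)) - p ω) / Real.log 2 := by
    intro ω
    rcases (hp.1 ω).eq_or_lt with h | h
    · simp [← h]
    · have h1 : 0 < PAB (A ω, B ω) := pOf_pos' hp.1 (fun ω => (A ω, B ω)) h
      have h2 : 0 < PB (B ω) := pOf_pos' hp.1 B h
      have h3 := hpos ω h
      have h4 := Real.log_le_sub_one_of_pos (x := Q (A ω) (B ω) * PB (B ω) / PAB (A ω, B ω))
        (by positivity)
      rw [Real.log_div (by positivity) h1.ne', Real.log_mul h3.ne' h2.ne'] at h4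
      simp only [Real.logb, Real.log_div h1.ne' h2.ne']
      rw [le_div_iff₀ hl2]
      have : (p ω * -((Real.log (PAB (A ω, B ω)) - Real.log (PB (B ω))) / Real.log 2)
          - p ω * -(Real.log (Q (A ω) (B ω)) / Real.log 2)) * Real.log 2
          = p ω * (Real.log (Q (A ω) (B ω)) + Real.log (PB (B ω))
            - Real.log (PAB (A ω, B ω))) := by
        field_simp
        ring
      rw [this]
      nlinarith
  have hsum := Finset.sum_le_sum fun ω (_ : ω ∈ Finset.univ) => key ω
  rw [Finset.sum_sub_distrib, ← Finset.sum_div, Finset.sum_sub_distrib, hp.2] at hsum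
  have h5 : ∑ ω, p ω * (Q (A ω) (B ω) * PB (B ω) / PAB (A ω, B ω)) ≤ 1 := by
    rw [← sum_pOf_mul p (fun ω => (A ω, B ω)) (fun ab => Q ab.1 ab.2 * PB ab.2 / PAB ab)]
    calc ∑ ab, PAB ab * (Q ab.1 ab.2 * PB ab.2 / PAB ab)
        ≤ ∑ ab : α × β, Q ab.1 ab.2 * PB ab.2 := by
          refine Finset.sum_le_sum fun ab _ => ?_
          have hb : 0 ≤ Q ab.1 ab.2 * PB ab.2 := mul_nonneg (hQ0 _ _) (pOf_nonneg' hp.1 _ _)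
          by_cases h0 : PAB ab = 0
          · simp [h0, hb]
          · rw [mul_div_cancel₀ _ h0]
      _ = ∑ b, PB b * ∑ a, Q a b := by
          rw [Fintype.sum_prod_type_right]
          refine Finset.sum_congr rfl fun b _ => ?_
          rw [Finset.mul_sum]
          exact Finset.sum_congr rfl fun a _ => mul_comm _ _
      _ ≤ ∑ b, PB b * 1 := Finset.sum_le_sum fun b _ =>
          mul_le_mul_of_nonneg_left (hQ1 b) (pOf_nonneg' hp.1 _ _)
      _ = 1 := by
          rw [sum_pOf_mul p B (fun _ => 1)]
          simpa using hp.2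
  have h6 : (∑ ω, p ω * (Q (A ω) (B ω) * PB (B ω) / PAB (A ω, B ω)) - 1) / Real.log 2 ≤ 0 :=
    div_nonpos_of_nonpos_of_nonneg (by linarith) hl2.le
  linarith

lemma condH_mono {Ω α β γ : Type*} [Fintype Ω] [Fintype α] [Fintype β] [Fintype γ] {p : Ω → ℝ}
    (hp : IsPMF p) (A : Ω → α) (B : Ω → β) (C : Ω → γ) (f : β → γ) (hC : ∀ ω, C ω = f (B ω)) :
    condH p A B ≤ condH p A C := by
  rw [condH_eq hp.1 A C]
  have := gibbs hp A B (fun a b => pOf p (fun ω => (A ω, C ω)) (a, f b) / pOf p C (f b))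
    (fun a b => div_nonneg (pOf_nonneg' hp.1 _ _) (pOf_nonneg' hp.1 _ _))
    (fun b => by
      rw [← Finset.sum_div, sum_pOf_fst]
      exact div_self_le_one _)
    (fun ω h => by
      rw [← hC]
      exact div_pos (pOf_pos' hp.1 (fun ω => (A ω, C ω)) h) (pOf_pos' hp.1 C h))
  simpa only [← hC] using this

lemma condH_swap {Ω α β γ : Type*} [Fintype Ω] [Fintype α] [Fintype β] [Fintype γ] (p : Ω → ℝ)
    (A : Ω → α) (M : Ω → γ) (B : Ω → β) :
    condH p M B + condH p A (fun ω => (M ω, B ω))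
      = condH p A B + condH p M (fun ω => (A ω, B ω)) := by
  unfold condH
  rw [H2_congr p (fun ω => (A ω, M ω, B ω)) (fun ω => (M ω, A ω, B ω))
    (fun ω ω' => by simp only [Prod.mk.injEq]; tauto)]
  ring

/-- Data processing. -/
lemma condH_dp {Ω μ ν υ υ' γ : Type*} [Fintype Ω] [Fintype μ] [Fintype ν] [Fintype υ]
    [Fintype υ'] [Fintype γ] {p : Ω → ℝ} (hp : IsPMF p) (M : Ω → μ) (V : Ω → ν) (Y : Ω → υ)
    (Y' : Ω → υ') (C : Ω → γ) (f : γ → μ × ν) (hf : ∀ ω, (M ω, V ω) = f (C ω))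
    (hM : condH p Y Y' ≤ condH p Y (fun ω => (C ω, Y' ω))) :
    condH p M (fun ω => (V ω, Y' ω)) ≤ condH p M (fun ω => (V ω, Y ω)) := by
  have h1 : condH p M (fun ω => (Y ω, V ω, Y' ω)) ≤ condH p M (fun ω => (V ω, Y ω)) :=
    condH_mono hp M _ _ (fun b => (b.2.1, b.1)) (fun _ => rfl)
  have h2 := condH_swap p Y M (fun ω => (V ω, Y' ω))
  have h3 : condH p Y (fun ω => (V ω, Y' ω)) ≤ condH p Y Y' :=
    condH_mono hp Y _ _ (fun b => b.2) (fun _ => rfl)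
  have h4 : condH p Y (fun ω => (C ω, Y' ω)) ≤ condH p Y (fun ω => (M ω, V ω, Y' ω)) :=
    condH_mono hp Y _ _ (fun b => ((f b.1).1, (f b.1).2, b.2)) (fun ω => by simp [← hf])
  linarith

lemma condH_of_condIndep {Ω α β γ : Type*} [Fintype Ω] [Fintype α] [Fintype β] [Fintype γ]
    {p : Ω → ℝ} (hp : IsPMF p) (A : Ω → α) (B : Ω → β) (C : Ω → γ) (h : CondIndep p A B C) :
    condH p A B ≤ condH p A (fun ω => (C ω, B ω)) := by
  rw [condH_eq hp.1, condH_eq hp.1]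
  refine Finset.sum_le_sum fun ω _ => ?_
  rcases (hp.1 ω).eq_or_lt with h0 | h0
  · simp [← h0]
  refine le_of_eq ?_
  congr 3
  have h1 := pOf_pos' hp.1 (fun ω => (C ω, B ω)) h0
  have h2 := pOf_pos' hp.1 B h0
  have e := h (A ω) (B ω) (C ω)
  rw [pOf_congr p (fun ω => (A ω, B ω, C ω)) (fun ω => (A ω, C ω, B ω)) _ (A ω, C ω, B ω)
    (fun ω' => by simp only [Prod.mk.injEq]; tauto),
    pOf_congr p (fun ω => (B ω, C ω)) (fun ω => (C ω, B ω)) _ (C ω, B ω)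
    (fun ω' => by simp only [Prod.mk.injEq]; tauto)] at e
  rw [div_eq_div_iff h2.ne' h1.ne']
  exact e.symm

/-! ### iid extension -/

lemma sum_iid_prod {X : Type*} [Fintype X] (q : X → ℝ) (n : ℕ) (f : Fin n → X → ℝ) :
    ∑ ω : Fin n → X, iidPMF q n ω * ∏ i, f i (ω i) = ∏ i, ∑ x, q x * f i x := by
  unfold iidPMF
  rw [Finset.prod_univ_sum, Fintype.piFinset_univ]
  refine Finset.sum_congr rfl fun ω _ => ?_
  rw [Finset.prod_mul_distrib]

lemma iid_isPMF {X : Type*} [Fintype X] {q : X → ℝ} (hq : IsPMF q) (n : ℕ) :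
    IsPMF (iidPMF q n) := by
  refine ⟨fun ω => Finset.prod_nonneg fun i _ => hq.1 _, ?_⟩
  have := sum_iid_prod q n (fun _ _ => 1)
  simpa [hq.2] using this

lemma sum_iid_single {X : Type*} [Fintype X] {q : X → ℝ} (hq : IsPMF q) (n : ℕ) (F : X → ℝ)
    (i : Fin n) : ∑ ω : Fin n → X, iidPMF q n ω * F (ω i) = ∑ x, q x * F x := by
  have := sum_iid_prod q n (fun k x => if k = i then F x else 1)
  simp only [Finset.prod_ite_eq', Finset.mem_univ, if_true] at this
  rw [this, Finset.prod_eq_single i]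
  · simp
  · intro b _ hb
    simp [hb, hq.2]
  · simp

lemma sum_iid_sum {X : Type*} [Fintype X] {q : X → ℝ} (hq : IsPMF q) (n : ℕ) (F : X → ℝ) :
    ∑ ω : Fin n → X, iidPMF q n ω * ∑ i, F (ω i) = n * ∑ x, q x * F x := by
  simp_rw [Finset.mul_sum]
  rw [Finset.sum_comm]
  simp_rw [sum_iid_single hq]
  simp [Finset.mul_sum]

lemma pOf_iid {X α : Type*} [Fintype X] (q : X → ℝ) (n : ℕ) (A : X → α) (a : Fin n → α) :
    pOf (iidPMF q n) (fun ω i => A (ω i)) a = ∏ i, pOf q A (a i) := by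
  have := sum_iid_prod q n (fun i x => if A x = a i then 1 else 0)
  simp only [mul_ite, mul_one, mul_zero] at this
  unfold pOf
  rw [← this]
  refine Finset.sum_congr rfl fun ω _ => ?_
  by_cases h : (fun i => A (ω i)) = a
  · subst h
    simp
  · rw [if_neg h]
    obtain ⟨i, hi⟩ := Function.ne_iff.1 h
    rw [Finset.prod_eq_zero (Finset.mem_univ i) (by simp [hi]), mul_zero]

lemma iid_pos {X : Type*} {q : X → ℝ} (hq : ∀ x, 0 ≤ q x) {n : ℕ} {ω : Fin n → X}
    (h : 0 < iidPMF q n ω) (i : Fin n) : 0 < q (ω i) := by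
  refine lt_of_le_of_ne (hq _) fun h0 => ?_
  have : iidPMF q n ω = 0 := Finset.prod_eq_zero (Finset.mem_univ i) h0.symm
  exact h.ne' this

lemma H2_iid {X α : Type*} [Fintype X] [Fintype α] {q : X → ℝ} (hq : IsPMF q) (n : ℕ)
    (A : X → α) : H2 (iidPMF q n) (fun ω i => A (ω i)) = n * H2 q A := by
  rw [H2_eq, H2_eq, ← sum_iid_sum hq]
  refine Finset.sum_congr rfl fun ω _ => ?_
  rcases ((iid_isPMF hq n).1 ω).eq_or_lt with h | h
  · simp [← h]
  rw [pOf_iid, Real.logb_prod _ _ fun i _ => (pOf_pos' hq.1 A (iid_pos hq.1 h i)).ne',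
    Finset.sum_neg_distrib]

lemma condH_iid {X α β : Type*} [Fintype X] [Fintype α] [Fintype β] {q : X → ℝ} (hq : IsPMF q)
    (n : ℕ) (A : X → α) (B : X → β) :
    condH (iidPMF q n) (fun ω i => A (ω i)) (fun ω i => B (ω i)) = n * condH q A B := by
  unfold condH
  rw [mul_sub, ← H2_iid hq n B, ← H2_iid hq n (fun x => (A x, B x))]
  congr 1
  refine H2_congr _ _ _ fun ω ω' => ?_
  simp only [Prod.mk.injEq, funext_iff, forall_and]

/-- Fano-type remainder. -/
def fanoPhi (K ε : ℝ) : ℝ :=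
  -Real.logb 2 (1 - ε) + ε * Real.logb 2 K + (-(ε * Real.log ε)) / Real.log 2

lemma fanoPhi_tendsto (K : ℝ) :
    Filter.Tendsto (fanoPhi K) (nhdsWithin 0 (Set.Ioi 0)) (nhds 0) := by
  have h : ContinuousAt (fanoPhi K) 0 := by
    unfold fanoPhi
    have h1 : ContinuousAt (fun ε : ℝ => Real.logb 2 (1 - ε)) 0 := by
      unfold Real.logb
      refine ContinuousAt.div_const (ContinuousAt.log (by fun_prop) (by norm_num)) _
    have h2 : ContinuousAt (fun ε : ℝ => ε * Real.log ε) 0 := Real.continuous_mul_log.continuousAt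
    exact (h1.neg.add (by fun_prop)).add (h2.neg.div_const _)
  have h0 : fanoPhi K 0 = 0 := by simp [fanoPhi]
  have := h.tendsto
  rw [h0] at this
  exact this.mono_left nhdsWithin_le_nhds

lemma fano {Ω α β : Type*} [Fintype Ω] [Fintype α] [Fintype β] {p : Ω → ℝ} (hp : IsPMF p)
    {n : ℕ} (hn : 0 < n) (A : Ω → Fin n → α) (B : Ω → β) (g : β → Fin n → α) {ε : ℝ}
    (hε : 0 < ε) (hε1 : ε < 1) (hK : 0 < Fintype.card α)
    (hd : ∑ ω, p ω * ((n : ℝ)⁻¹ * ∑ i, if g (B ω) i = A ω i then (0 : ℝ) else 1) ≤ ε) :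
    condH p A B ≤ n * fanoPhi (Fintype.card α) ε := by
  set K : ℝ := ((Fintype.card α : ℕ) : ℝ) with hKdef
  have hK1 : (1 : ℝ) ≤ K := by rw [hKdef]; exact_mod_cast hK
  have hK0 : 0 < K := by linarith
  have hn0 : (0 : ℝ) < n := by exact_mod_cast hn
  set Q1 : α → α → ℝ := fun a b => if b = a then 1 - ε else ε / K with hQ1
  have hQpos : ∀ a b, 0 < Q1 a b := by
    intro a b
    simp only [hQ1]
    split_ifs
    · linarith
    · positivity
  have hQsum : ∀ b, ∑ a, Q1 a b ≤ 1 := by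
    intro b
    calc ∑ a, Q1 a b ≤ ∑ a, ((if b = a then 1 - ε else 0) + ε / K) := by
          refine Finset.sum_le_sum fun a _ => ?_
          simp only [hQ1]
          have : 0 < ε / K := by positivity
          split_ifs <;> linarith
      _ = 1 := by
          rw [Finset.sum_add_distrib]
          simp only [Finset.sum_ite_eq, Finset.mem_univ, if_true, Finset.sum_const,
            Finset.card_univ, nsmul_eq_mul, ← hKdef]
          field_simp
          ring
  have hG := gibbs hp A B (fun a b => ∏ i, Q1 (a i) (g b i))
    (fun a b => Finset.prod_nonneg fun i _ => (hQpos _ _).le)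
    (fun b => by
      have := Finset.prod_univ_sum (fun _ : Fin n => (Finset.univ : Finset α))
        (fun i a => Q1 a (g b i))
      rw [Fintype.piFinset_univ] at this
      rw [← this]
      exact Finset.prod_le_one (fun i _ => Finset.sum_nonneg fun a _ => (hQpos _ _).le)
        (fun i _ => hQsum _))
    (fun ω _ => Finset.prod_pos fun i _ => hQpos _ _)
  refine hG.trans ?_
  set c1 : ℝ := -Real.logb 2 (1 - ε) with hc1
  set c2 : ℝ := Real.logb 2 (K / ε) with hc2
  have hc1' : 0 ≤ c1 := by
    rw [hc1, neg_nonneg]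
    exact Real.logb_nonpos one_lt_two (by linarith) (by linarith)
  have hc2' : 0 ≤ c2 := Real.logb_nonneg one_lt_two (by rw [le_div_iff₀ hε]; linarith)
  have hbound : ∀ ω, p ω * (-Real.logb 2 (∏ i, Q1 (A ω i) (g (B ω) i)))
      ≤ p ω * (n * c1) + n * c2 * (p ω * ((n : ℝ)⁻¹ *
        ∑ i, if g (B ω) i = A ω i then (0 : ℝ) else 1)) := by
    intro ω
    rw [Real.logb_prod _ _ fun i _ => (hQpos _ _).ne', ← Finset.sum_neg_distrib]
    have : ∑ i, -Real.logb 2 (Q1 (A ω i) (g (B ω) i))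
        ≤ ∑ i, (c1 + c2 * if g (B ω) i = A ω i then (0 : ℝ) else 1) := by
      refine Finset.sum_le_sum fun i _ => ?_
      simp only [hQ1]
      split_ifs
      · simp [hc1]
      · rw [← Real.logb_inv, inv_div]
        linarith
    rw [Finset.sum_add_distrib, ← Finset.mul_sum] at this
    simp only [Finset.sum_const, Finset.card_univ, Fintype.card_fin, nsmul_eq_mul] at this
    refine (mul_le_mul_of_nonneg_left this (hp.1 ω)).trans (le_of_eq ?_)
    field_simp
  refine (Finset.sum_le_sum fun ω _ => hbound ω).trans ?_
  rw [Finset.sum_add_distrib, ← Finset.sum_mul, hp.2, ← Finset.mul_sum]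
  have h3 := mul_le_mul_of_nonneg_left hd (mul_nonneg hn0.le hc2')
  have h4 : (n : ℝ) * fanoPhi K ε = 1 * (n * c1) + n * c2 * ε := by
    rw [fanoPhi, hc1, hc2, Real.logb_div hK0.ne' hε.ne']
    simp only [Real.logb]
    ring
  linarith

/-- Degradedness, single-letter form. -/
lemma deg_single {t : ℕ} {W : Fin t → Type*} [∀ l, Fintype (W l)]
    {Y : Fin t → Type*} [∀ l, Fintype (Y l)]
    {q : (∀ l, W l) × (∀ l, Y l) → ℝ} (hq : IsPMF q)
    (hdeg : ∀ (j : Fin t) (h : j.val + 1 < t),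
      CondIndep q (fun ω => ω.2 j) (fun ω => ω.2 ⟨j.val + 1, h⟩)
        (fun ω => (ω.1, fun k : {k : Fin t // j.val + 1 < k.val} => ω.2 k.1)))
    (j : Fin t) (h : j.val + 1 < t) :
    condH q (fun ω => ω.2 j) (fun ω => ω.2 ⟨j.val + 1, h⟩)
      ≤ condH q (fun ω => ω.2 j) (fun ω => (ω.1, ω.2 ⟨j.val + 1, h⟩)) :=
  (condH_of_condIndep hq _ _ _ (hdeg j h)).trans
    (condH_mono hq _ _ _ (fun b => (b.1.1, b.2)) (fun _ => rfl))

lemma deg_iid {t : ℕ} {W : Fin t → Type*} [∀ l, Fintype (W l)]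
    {Y : Fin t → Type*} [∀ l, Fintype (Y l)]
    {q : (∀ l, W l) × (∀ l, Y l) → ℝ} (hq : IsPMF q)
    (hdeg : ∀ (j : Fin t) (h : j.val + 1 < t),
      CondIndep q (fun ω => ω.2 j) (fun ω => ω.2 ⟨j.val + 1, h⟩)
        (fun ω => (ω.1, fun k : {k : Fin t // j.val + 1 < k.val} => ω.2 k.1)))
    (n : ℕ) (j : Fin t) (h : j.val + 1 < t) :
    condH (iidPMF q n) (fun ω i => (ω i).2 j) (fun ω i => (ω i).2 ⟨j.val + 1, h⟩)
      ≤ condH (iidPMF q n) (fun ω i => (ω i).2 j)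
        (fun ω => ((fun i => (ω i).1), (fun i => (ω i).2 ⟨j.val + 1, h⟩))) := by
  have h1 := condH_iid hq n (fun ω => ω.2 j) (fun ω => ω.2 ⟨j.val + 1, h⟩)
  have h2 := condH_iid hq n (fun ω => ω.2 j) (fun ω => (ω.1, ω.2 ⟨j.val + 1, h⟩))
  have h3 := condH_congr (iidPMF q n) (fun ω i => (ω i).2 j)
    (fun ω i => ((ω i).1, (ω i).2 ⟨j.val + 1, h⟩)) (fun ω i => (ω i).2 j)
    (fun ω => ((fun i => (ω i).1), (fun i => (ω i).2 ⟨j.val + 1, h⟩))) (fun _ _ => Iff.rfl)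
    (fun ω ω' => by simp only [Prod.mk.injEq, funext_iff, forall_and])
  rw [← h3, h2, h1]
  exact mul_le_mul_of_nonneg_left (deg_single hq hdeg j h) (Nat.cast_nonneg n)

/-- The converse for a single code. -/
lemma converse_code {t : ℕ} (ht : 0 < t) {W : Fin t → Type*} [∀ l, Fintype (W l)]
    {Y : Fin t → Type*} [∀ l, Fintype (Y l)]
    {q : (∀ l, W l) × (∀ l, Y l) → ℝ} (hq : IsPMF q)
    (hdeg : ∀ (j : Fin t) (h : j.val + 1 < t),
      CondIndep q (fun ω => ω.2 j) (fun ω => ω.2 ⟨j.val + 1, h⟩)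
        (fun ω => (ω.1, fun k : {k : Fin t // j.val + 1 < k.val} => ω.2 k.1)))
    {n : ℕ} (hn : 0 < n) {M : Fin t → ℕ} (hM : ∀ l, 1 ≤ M l)
    (f : (Fin n → ∀ l, W l) → ∀ l, Fin (M l))
    (g : ∀ l : Fin t, (∀ k : Fin t, k ≤ l → Fin (M k)) → (Fin n → Y l) → Fin n → W l)
    {ε : ℝ} (hε : 0 < ε) (hε1 : ε < 1)
    (hd : ∀ l, (∑ ω : Fin n → (∀ l, W l) × (∀ l', Y l'),
          iidPMF q n ω *
            ((n : ℝ)⁻¹ * ∑ i, if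
              (g l (fun k _ => f (fun i' => (ω i').1) k) (fun i' => (ω i').2 l) i) = (ω i).1 l
              then (0 : ℝ) else 1)) ≤ ε) :
    n * ∑ l : Fin t, condH q (fun ω => ω.1 l)
            (fun ω => ((fun i : {i : Fin t // i < l} => ω.1 i.1), ω.2 l))
      ≤ (∑ l, Real.logb 2 (M l)) + n * ∑ l, fanoPhi (Fintype.card (W l)) ε := by
  set p := iidPMF q n with hpdef
  have hp : IsPMF p := iid_isPMF hq n
  obtain ⟨x0⟩ : Nonempty ((∀ l, W l) × (∀ l, Y l)) := by
    by_contra hne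
    rw [not_nonempty_iff] at hne
    have := hq.2
    simp at this
  let Msg : (Fin n → (∀ l, W l) × (∀ l', Y l')) → (∀ l, Fin (M l)) :=
    fun ω => f (fun i => (ω i).1)
  let V : (l : ℕ) → (Fin n → (∀ l, W l) × (∀ l', Y l')) →
      (Fin n → ∀ k : {k : Fin t // k.val < l}, W k.1) := fun l ω i k => (ω i).1 k.1
  let Yn : (l : Fin t) → (Fin n → (∀ l, W l) × (∀ l', Y l')) → (Fin n → Y l) :=
    fun l ω i => (ω i).2 l
  let a : ℕ → ℝ := fun l => if h : l < t then condH p Msg (fun ω => (V l ω, Yn ⟨l, h⟩ ω)) else 0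
  have hcard : a 0 ≤ ∑ l, Real.logb 2 (M l) := by
    simp only [a, dif_pos ht]
    have hMpos : ∀ l, (0 : ℝ) < M l := fun l => by exact_mod_cast hM l
    have hP : (0 : ℝ) < ∏ l, (M l : ℝ) := Finset.prod_pos fun l _ => hMpos l
    have := gibbs hp Msg (fun ω => (V 0 ω, Yn ⟨0, ht⟩ ω)) (fun _ _ => (∏ l, (M l : ℝ))⁻¹)
      (fun _ _ => (inv_pos.2 hP).le)
      (fun _ => by
        rw [Finset.sum_const, nsmul_eq_mul, Finset.card_univ, Fintype.card_pi]
        simp only [Fintype.card_fin, Nat.cast_prod]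
        rw [mul_inv_cancel₀ hP.ne'])
      (fun _ _ => inv_pos.2 hP)
    rw [← Finset.sum_mul, hp.2, Real.logb_inv, neg_neg, one_mul,
      Real.logb_prod _ _ fun l _ => (hMpos l).ne'] at this
    exact this
  have hstep : ∀ l : Fin t, n * condH q (fun ω => ω.1 l)
            (fun ω => ((fun i : {i : Fin t // i < l} => ω.1 i.1), ω.2 l))
      - n * fanoPhi (Fintype.card (W l)) ε ≤ a l.val - a (l.val + 1) := by
    intro l
    have e1 : a l.val = condH p Msg (fun ω => (V l ω, Yn l ω)) := by
      simp only [a, dif_pos l.2]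
    let An : (Fin n → (∀ l, W l) × (∀ l', Y l')) → (Fin n → W l) := fun ω i => (ω i).1 l
    have hsw := condH_swap p An Msg (fun ω => (V l ω, Yn l ω))
    have hfano : condH p An (fun ω => (Msg ω, V l ω, Yn l ω))
        ≤ n * fanoPhi (Fintype.card (W l)) ε :=
      fano hp hn An (fun ω => (Msg ω, V l ω, Yn l ω))
        (fun b => g l (fun k _ => b.1 k) b.2.2) hε hε1
        (Fintype.card_pos_iff.2 ⟨x0.1 l⟩) (hd l)
    have hiid := condH_iid hq n (fun ω => ω.1 l)
            (fun ω => ((fun i : {i : Fin t // i < l} => ω.1 i.1), ω.2 l))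
    have e2 := condH_congr p (fun ω i => (ω i).1 l)
      (fun ω i => ((fun k : {i : Fin t // i < l} => (ω i).1 k.1), (ω i).2 l))
      An (fun ω => (V l ω, Yn l ω)) (fun _ _ => Iff.rfl)
      (fun ω ω' => by
        simp only [V, Yn, Prod.mk.injEq, funext_iff, forall_and]
        exact Iff.rfl)
    have e3 := condH_congr p Msg (fun ω => (An ω, V l ω, Yn l ω)) Msg
      (fun ω => (V (l.val + 1) ω, Yn l ω)) (fun _ _ => Iff.rfl)
      (fun ω ω' => by
        simp only [V, Yn, An, Prod.mk.injEq, funext_iff]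
        constructor
        · rintro ⟨h1, h2, h3⟩
          refine ⟨fun i k => ?_, h3⟩
          rcases Nat.lt_succ_iff_lt_or_eq.1 k.2 with hk | hk
          · exact h2 i ⟨k.1, hk⟩
          · obtain ⟨k, hk'⟩ := k
            have : k = l := Fin.ext hk
            subst this
            exact h1 i
        · rintro ⟨h1, h3⟩
          exact ⟨fun i => h1 i ⟨l, Nat.lt_succ_self _⟩,
            fun i k => h1 i ⟨k.1, Nat.lt_succ_of_lt k.2⟩, h3⟩)
    have hnext : a (l.val + 1) ≤ condH p Msg (fun ω => (V (l.val + 1) ω, Yn l ω)) := by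
      by_cases h : l.val + 1 < t
      · simp only [a, dif_pos h]
        exact condH_dp hp Msg (V (l.val + 1)) (Yn l) (Yn ⟨l.val + 1, h⟩)
          (fun ω i => (ω i).1) (fun x => (f x, fun i k => x i k.1)) (fun ω => rfl)
          (deg_iid hq hdeg n l h)
      · simp only [a, dif_neg h]
        exact condH_nonneg hp.1 _ _
    rw [e1]
    rw [← hpdef, e2] at hiid
    linarith
  have hsum := Finset.sum_le_sum fun l (_ : l ∈ (Finset.univ : Finset (Fin t))) => hstep l
  rw [Fin.sum_univ_eq_sum_range (fun l => a l - a (l + 1)), Finset.sum_range_sub',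
    Finset.sum_sub_distrib, ← Finset.mul_sum, ← Finset.mul_sum] at hsum
  have : a t = 0 := by simp [a]
  linarith

lemma converse {t : ℕ} (ht : 0 < t) {W : Fin t → Type*} [∀ l, Fintype (W l)]
    {Y : Fin t → Type*} [∀ l, Fintype (Y l)]
    {q : (∀ l, W l) × (∀ l, Y l) → ℝ} (hq : IsPMF q)
    (hdeg : ∀ (j : Fin t) (h : j.val + 1 < t),
      CondIndep q (fun ω => ω.2 j) (fun ω => ω.2 ⟨j.val + 1, h⟩)
        (fun ω => (ω.1, fun k : {k : Fin t // j.val + 1 < k.val} => ω.2 k.1)))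
    {r : ℝ} (hr : Admissible q (fun l x (w : W l) => if w = x l then (0 : ℝ) else 1) (fun _ => 0)
      (fun l => if l = (⟨0, ht⟩ : Fin t) then r else 0)) :
    ∑ l : Fin t, condH q (fun ω => ω.1 l)
            (fun ω => ((fun i : {i : Fin t // i < l} => ω.1 i.1), ω.2 l)) ≤ r := by
  have hlim : Filter.Tendsto
      (fun ε : ℝ => (r + t * ε) + ∑ l, fanoPhi (Fintype.card (W l)) ε)
      (nhdsWithin 0 (Set.Ioi 0)) (nhds r) := by
    have h1 : Filter.Tendsto (fun ε : ℝ => r + t * ε) (nhdsWithin 0 (Set.Ioi 0))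
        (nhds (r + t * 0)) := by
      refine Filter.Tendsto.mono_left (Continuous.tendsto (by fun_prop) 0) nhdsWithin_le_nhds
    have h2 := tendsto_finsetSum (Finset.univ : Finset (Fin t))
      (fun l _ => fanoPhi_tendsto (Fintype.card (W l)))
    have := h1.add h2
    simpa using this
  refine ge_of_tendsto hlim ?_
  have hmem : Set.Ioo (0 : ℝ) 1 ∈ nhdsWithin (0 : ℝ) (Set.Ioi 0) :=
    Ioo_mem_nhdsGT one_pos
  filter_upwards [hmem] with ε hε
  obtain ⟨n, hn, M, hM, f, g, h1, h2⟩ := hr.2 ε hε.1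
  have hc := converse_code ht hq hdeg hn hM f g hε.1 hε.2
    (fun l => by have := h2 l; rw [zero_add] at this; exact this)
  have hn0 : (0 : ℝ) < n := by exact_mod_cast hn
  have h3 : ∑ l, Real.logb 2 (M l) ≤ n * (r + t * ε) := by
    have := Finset.sum_le_sum fun l (_ : l ∈ (Finset.univ : Finset (Fin t))) => h1 l
    rw [← Finset.sum_div, Finset.sum_add_distrib, div_le_iff₀ hn0] at this
    simp only [Finset.sum_ite_eq', Finset.mem_univ, if_true, Finset.sum_const, Finset.card_univ,
      Fintype.card_fin, nsmul_eq_mul] at this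
    linarith
  refine le_of_mul_le_mul_left ?_ hn0
  linarith

/-! ### Achievability -/

lemma chernoff_rate {X : Type*} [Fintype X] {q : X → ℝ} (hq : IsPMF q) (F : X → ℝ) (c : ℝ)
    (h : ∑ x, q x * F x < c) : ∃ s : ℝ, 0 < s ∧ ∑ x, q x * Real.exp (s * (F x - c)) < 1 := by
  have hd : HasDerivAt (fun s : ℝ => ∑ x, q x * Real.exp (s * (F x - c)))
      (∑ x, q x * (F x - c)) 0 := by
    have : ∀ x ∈ (Finset.univ : Finset X),
        HasDerivAt (fun s : ℝ => q x * Real.exp (s * (F x - c))) (q x * (F x - c)) 0 := by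
      intro x _
      have h1 : HasDerivAt (fun s : ℝ => s * (F x - c)) (F x - c) 0 := by
        simpa using (hasDerivAt_id (0 : ℝ)).mul_const (F x - c)
      have h2 := h1.exp.const_mul (q x)
      simpa using h2
    exact HasDerivAt.fun_sum this
  have hneg : ∑ x, q x * (F x - c) < 0 := by
    simp_rw [mul_sub]
    rw [Finset.sum_sub_distrib, ← Finset.sum_mul, hq.2]
    linarith
  have hslope := hd.tendsto_slope_zero_right
  have hev := hslope.eventually (gt_mem_nhds hneg)
  obtain ⟨s, hs1, hs2⟩ := (hev.and self_mem_nhdsWithin).exists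
  refine ⟨s, hs2, ?_⟩
  have hs0 : (0 : ℝ) < s := hs2
  simp only [zero_add, zero_mul, Real.exp_zero, mul_one, hq.2, smul_eq_mul] at hs1
  by_contra hcon
  have : 0 ≤ s⁻¹ * (∑ x, q x * Real.exp (s * (F x - c)) - 1) :=
    mul_nonneg (inv_pos.2 hs0).le (by linarith)
  linarith

lemma chernoff {X : Type*} [Fintype X] {q : X → ℝ} (hq : IsPMF q) (F : X → ℝ) (c : ℝ)
    (h : ∑ x, q x * F x < c) {η : ℝ} (hη : 0 < η) :
    ∀ᶠ n : ℕ in Filter.atTop,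
      ∑ ω : Fin n → X, iidPMF q n ω * (if n * c ≤ ∑ i, F (ω i) then (1 : ℝ) else 0) ≤ η := by
  obtain ⟨s, hs, hρ⟩ := chernoff_rate hq F c h
  set ρ := ∑ x, q x * Real.exp (s * (F x - c)) with hρdef
  have hρ0 : 0 ≤ ρ := Finset.sum_nonneg fun x _ => mul_nonneg (hq.1 x) (Real.exp_pos _).le
  have ht := tendsto_pow_atTop_nhds_zero_of_lt_one hρ0 hρ
  filter_upwards [ht.eventually (ge_mem_nhds hη)] with n hn
  refine le_trans ?_ hn
  have := sum_iid_prod q n (fun _ x => Real.exp (s * (F x - c)))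
  rw [← hρdef] at this
  simp only [Finset.prod_const, Finset.card_univ, Fintype.card_fin] at this
  rw [← this]
  refine Finset.sum_le_sum fun ω _ => mul_le_mul_of_nonneg_left ?_ ((iid_isPMF hq n).1 ω)
  rw [← Real.exp_sum, ← Finset.mul_sum, Finset.sum_sub_distrib]
  simp only [Finset.sum_const, Finset.card_univ, Fintype.card_fin, nsmul_eq_mul]
  split_ifs with h1
  · exact Real.one_le_exp (mul_nonneg hs.le (by linarith))
  · exact (Real.exp_pos _).le

/-- Conditional typicality. -/
def Typ {X α β : Type*} [Fintype X] (q : X → ℝ) (A : X → α) (B : X → β) (n : ℕ) (c : ℝ)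
    (a : Fin n → α) (b : Fin n → β) : Prop :=
  0 < ∏ i, pOf q B (b i) ∧
    (2 : ℝ) ^ (-(n * c)) * ∏ i, pOf q B (b i) ≤ ∏ i, pOf q (fun x => (A x, B x)) (a i, b i)

lemma aep {X α β : Type*} [Fintype X] [Fintype α] [Fintype β] {q : X → ℝ} (hq : IsPMF q)
    (A : X → α) (B : X → β) (c : ℝ) (h : condH q A B < c) {η : ℝ} (hη : 0 < η) :
    ∀ᶠ n : ℕ in Filter.atTop,
      ∑ ω : Fin n → X, iidPMF q n ω *
        (if Typ q A B n c (fun i => A (ω i)) (fun i => B (ω i)) then (0 : ℝ) else 1) ≤ η := by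
  rw [condH_eq hq.1] at h
  filter_upwards [chernoff hq _ c h hη] with n hn
  refine le_trans (Finset.sum_le_sum fun ω _ => ?_) hn
  rcases ((iid_isPMF hq n).1 ω).eq_or_lt with h0 | h0
  · simp [← h0]
  refine mul_le_mul_of_nonneg_left ?_ h0.le
  have hB : ∀ i, 0 < pOf q B (B (ω i)) := fun i => pOf_pos' hq.1 B (iid_pos hq.1 h0 i)
  have hAB : ∀ i, 0 < pOf q (fun x => (A x, B x)) (A (ω i), B (ω i)) :=
    fun i => pOf_pos' hq.1 (fun x => (A x, B x)) (iid_pos hq.1 h0 i)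
  by_cases hT : Typ q A B n c (fun i => A (ω i)) (fun i => B (ω i))
  · rw [if_pos hT]
    split_ifs <;> norm_num
  · rw [if_neg hT, if_pos]
    by_contra hlt
    push Not at hlt
    apply hT
    have hPB : 0 < ∏ i, pOf q B (B (ω i)) := Finset.prod_pos fun i _ => hB i
    refine ⟨hPB, ?_⟩
    rw [← le_div_iff₀ hPB, ← Finset.prod_div_distrib]
    rw [Finset.sum_neg_distrib, ← Real.logb_prod _ _ fun i _ => (div_pos (hAB i) (hB i)).ne'] at hlt
    rw [← Real.le_logb_iff_rpow_le one_lt_two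
      (Finset.prod_pos fun i _ => div_pos (hAB i) (hB i))]
    linarith

lemma typ_card {X α β : Type*} [Fintype X] [Fintype α] {q : X → ℝ} (hq : IsPMF q)
    (A : X → α) (B : X → β) (n : ℕ) (c : ℝ) (b : Fin n → β) :
    ((Finset.univ.filter fun a => Typ q A B n c a b).card : ℝ) ≤ (2 : ℝ) ^ (n * c) := by
  by_cases hPB : 0 < ∏ i, pOf q B (b i)
  · have h1 : ∑ a ∈ Finset.univ.filter (fun a => Typ q A B n c a b),
        (2 : ℝ) ^ (-(n * c)) * ∏ i, pOf q B (b i) ≤ ∏ i, pOf q B (b i) := by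
      calc _ ≤ ∑ a ∈ Finset.univ.filter (fun a => Typ q A B n c a b),
            ∏ i, pOf q (fun x => (A x, B x)) (a i, b i) :=
            Finset.sum_le_sum fun a ha => (Finset.mem_filter.1 ha).2.2
        _ ≤ ∑ a : Fin n → α, ∏ i, pOf q (fun x => (A x, B x)) (a i, b i) :=
            Finset.sum_le_sum_of_subset_of_nonneg (Finset.subset_univ _)
              (fun a _ _ => Finset.prod_nonneg fun i _ => pOf_nonneg' hq.1 _ _)
        _ = ∏ i, ∑ a, pOf q (fun x => (A x, B x)) (a, b i) := by
            rw [Finset.prod_univ_sum, Fintype.piFinset_univ]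
        _ = _ := by simp_rw [sum_pOf_fst]
    rw [Finset.sum_const, nsmul_eq_mul, ← mul_assoc] at h1
    have h2 := le_of_mul_le_mul_right (h1.trans_eq (one_mul _).symm) hPB
    rw [Real.rpow_neg (by norm_num), ← div_eq_mul_inv, div_le_one (by positivity)] at h2
    exact h2
  · rw [Finset.filter_false_of_mem fun a _ h => hPB h.1]
    simp only [Finset.card_empty, Nat.cast_zero]
    positivity

lemma hash_count {α : Type*} [Fintype α] {N : ℕ} (hN : 0 < N) {v a : α} (hva : v ≠ a) :
    (N : ℝ) * ∑ h : α → Fin N, (if h v = h a then (1 : ℝ) else 0)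
      = Fintype.card (α → Fin N) := by
  have : NeZero N := ⟨hN.ne'⟩
  have h1 : ∀ c : Fin N, ∑ h : α → Fin N, (if h v = h a then (1 : ℝ) else 0)
      = ∑ h : α → Fin N, (if h v + c = h a then (1 : ℝ) else 0) := by
    intro c
    rw [← Equiv.sum_comp (Equiv.addRight (Pi.single v c : α → Fin N))]
    refine Finset.sum_congr rfl fun h _ => ?_
    simp [hva.symm]
  have h2 : ∑ c : Fin N, ∑ h : α → Fin N, (if h v = h a then (1 : ℝ) else 0)
      = ∑ c : Fin N, ∑ h : α → Fin N, (if h v + c = h a then (1 : ℝ) else 0) :=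
    Finset.sum_congr rfl fun c _ => h1 c
  rw [Finset.sum_const, Finset.card_univ, Fintype.card_fin, nsmul_eq_mul] at h2
  rw [h2, Finset.sum_comm]
  have h3 : ∀ h : α → Fin N, ∑ c : Fin N, (if h v + c = h a then (1 : ℝ) else 0) = 1 := by
    intro h
    rw [Finset.sum_eq_single (h a - h v)]
    · simp
    · intro b _ hb
      rw [if_neg]
      intro hc
      exact hb (by rw [← hc]; simp)
    · simp
  simp_rw [h3]
  simp

/-- Indicator of a proposition. -/
def ind (P : Prop) : ℝ := if P then 1 else 0

lemma ind_pos {P : Prop} (h : P) : ind P = 1 := if_pos h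

lemma ind_neg {P : Prop} (h : ¬ P) : ind P = 0 := if_neg h

lemma ind_nonneg (P : Prop) : 0 ≤ ind P := by
  unfold ind
  split_ifs <;> norm_num

lemma binning {Ω α ι : Type*} [Fintype Ω] [Fintype α] [Fintype ι] {p : Ω → ℝ} (hp : IsPMF p)
    (A : Ω → α) (T : ι → Ω → α → Prop) (K : ℝ)
    (hT : ∀ i ω, ((Finset.univ.filter fun a => T i ω a).card : ℝ) ≤ K) {N : ℕ} (hN : 0 < N) :
    ∃ h : α → Fin N, ∑ i, ∑ ω, p ω *
      (ind (∃ v, v ≠ A ω ∧ h v = h (A ω) ∧ T i ω v))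
        ≤ Fintype.card ι * (K / N) := by
  have : NeZero N := ⟨hN.ne'⟩
  have hN0 : (0 : ℝ) < N := by exact_mod_cast hN
  have key : ∑ h : α → Fin N, ∑ i, ∑ ω, p ω *
      (ind (∃ v, v ≠ A ω ∧ h v = h (A ω) ∧ T i ω v))
        ≤ ∑ _h : α → Fin N, Fintype.card ι * (K / N) := by
    rw [Finset.sum_comm]
    have hi : ∀ i, ∑ h : α → Fin N, ∑ ω, p ω *
      (ind (∃ v, v ≠ A ω ∧ h v = h (A ω) ∧ T i ω v))
        ≤ Fintype.card (α → Fin N) * (K / N) := by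
      intro i
      rw [Finset.sum_comm]
      have hω : ∀ ω, ∑ h : α → Fin N, p ω *
          (ind (∃ v, v ≠ A ω ∧ h v = h (A ω) ∧ T i ω v))
            ≤ p ω * (Fintype.card (α → Fin N) * (K / N)) := by
        intro ω
        rw [← Finset.mul_sum]
        refine mul_le_mul_of_nonneg_left ?_ (hp.1 ω)
        calc ∑ h : α → Fin N,
              (ind (∃ v, v ≠ A ω ∧ h v = h (A ω) ∧ T i ω v))
            ≤ ∑ h : α → Fin N, ∑ v ∈ Finset.univ.filter (fun a => T i ω a),
                (if v ≠ A ω ∧ h v = h (A ω) then (1 : ℝ) else 0) := by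
              refine Finset.sum_le_sum fun h _ => ?_
              have hnn : ∀ v ∈ Finset.univ.filter (fun a => T i ω a),
                  (0 : ℝ) ≤ (if v ≠ A ω ∧ h v = h (A ω) then (1 : ℝ) else 0) := by
                intro v _
                split_ifs <;> norm_num
              by_cases hex : ∃ v, v ≠ A ω ∧ h v = h (A ω) ∧ T i ω v
              · rw [ind_pos hex]
                obtain ⟨v, h1, h2, h3⟩ := hex
                refine le_trans ?_ (Finset.single_le_sum hnn
                  (Finset.mem_filter.2 ⟨Finset.mem_univ v, h3⟩))
                rw [if_pos ⟨h1, h2⟩]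
              · rw [ind_neg hex]
                exact Finset.sum_nonneg hnn
          _ = ∑ v ∈ Finset.univ.filter (fun a => T i ω a), ∑ h : α → Fin N,
                (if v ≠ A ω ∧ h v = h (A ω) then (1 : ℝ) else 0) := Finset.sum_comm
          _ ≤ ∑ v ∈ Finset.univ.filter (fun a => T i ω a),
                (Fintype.card (α → Fin N) : ℝ) / N := by
              refine Finset.sum_le_sum fun v _ => ?_
              by_cases hv : v = A ω
              · simp only [hv, ne_eq, not_true_eq_false, false_and, if_false,
                  Finset.sum_const_zero]
                positivity
              · rw [← hash_count hN hv, mul_div_cancel_left₀ _ hN0.ne']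
                simp [hv]
          _ ≤ _ := by
              rw [Finset.sum_const, nsmul_eq_mul]
              have := mul_le_mul_of_nonneg_right (hT i ω)
                (by positivity : (0 : ℝ) ≤ (Fintype.card (α → Fin N) : ℝ) / N)
              refine this.trans (le_of_eq ?_)
              ring
      refine (Finset.sum_le_sum fun ω _ => hω ω).trans ?_
      rw [← Finset.sum_mul, hp.2, one_mul]
    refine (Finset.sum_le_sum fun i _ => hi i).trans (le_of_eq ?_)
    simp only [Finset.sum_const, Finset.card_univ, nsmul_eq_mul]
    ring
  obtain ⟨h, _, hh⟩ := Finset.exists_le_of_sum_le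
    (Finset.univ_nonempty : (Finset.univ : Finset (α → Fin N)).Nonempty) key
  exact ⟨h, hh⟩

lemma deg_mono {t : ℕ} {W : Fin t → Type*} [∀ l, Fintype (W l)]
    {Y : Fin t → Type*} [∀ l, Fintype (Y l)]
    {q : (∀ l, W l) × (∀ l, Y l) → ℝ} (hq : IsPMF q)
    (hdeg : ∀ (j : Fin t) (h : j.val + 1 < t),
      CondIndep q (fun ω => ω.2 j) (fun ω => ω.2 ⟨j.val + 1, h⟩)
        (fun ω => (ω.1, fun k : {k : Fin t // j.val + 1 < k.val} => ω.2 k.1)))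
    (k l : Fin t) (hkl : k ≤ l) :
    condH q (fun ω => ω.1 k)
        (fun ω => ((fun i : {i : Fin t // i < k} => ω.1 i.1), ω.2 l))
      ≤ condH q (fun ω => ω.1 k)
        (fun ω => ((fun i : {i : Fin t // i < k} => ω.1 i.1), ω.2 k)) := by
  have main : ∀ m : ℕ, ∀ h : k.val + m < t, condH q (fun ω => ω.1 k)
        (fun ω => ((fun i : {i : Fin t // i < k} => ω.1 i.1), ω.2 ⟨k.val + m, h⟩))
      ≤ condH q (fun ω => ω.1 k)
        (fun ω => ((fun i : {i : Fin t // i < k} => ω.1 i.1), ω.2 k)) := by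
    intro m
    induction m with
    | zero => intro h; exact le_rfl
    | succ m ih =>
      intro h
      have h' : k.val + m < t := by omega
      refine le_trans ?_ (ih h')
      exact condH_dp hq (fun ω => ω.1 k) (fun ω => (fun i : {i : Fin t // i < k} => ω.1 i.1))
        (fun ω => ω.2 ⟨k.val + m, h'⟩) (fun ω => ω.2 ⟨k.val + (m + 1), h⟩) (fun ω => ω.1)
        (fun x => (x k, fun i => x i.1)) (fun _ => rfl) (deg_single hq hdeg ⟨k.val + m, h'⟩ h)
  have e : l = ⟨k.val + (l.val - k.val), by have := l.2; have : k.val ≤ l.val := hkl; omega⟩ := by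
    apply Fin.ext
    have : k.val ≤ l.val := hkl
    simp only
    omega
  have := main (l.val - k.val) (by have := l.2; have : k.val ≤ l.val := hkl; omega)
  rw [← e] at this
  exact this

/-- Correctness of the decoder outside of the error events. -/
lemma ach_code {t : ℕ} (ht : 0 < t) {W : Fin t → Type*} [∀ l, Fintype (W l)]
    {Y : Fin t → Type*} [∀ l, Fintype (Y l)]
    {q : (∀ l, W l) × (∀ l, Y l) → ℝ} (hq : IsPMF q) {n : ℕ} (hn : 0 < n)
    (T : ∀ k l : Fin t, (Fin n → W k) → (Fin n → (∀ i : {i : Fin t // i < k}, W i.1) × Y l) → Prop)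
    (N : Fin t → ℕ) (hN : ∀ k, 1 ≤ N k) (hh : ∀ k, (Fin n → W k) → Fin (N k)) :
    ∃ (M : Fin t → ℕ) (_ : ∀ l, 1 ≤ M l)
      (f : (Fin n → ∀ l, W l) → ∀ l, Fin (M l))
      (g : ∀ l : Fin t, (∀ k : Fin t, k ≤ l → Fin (M k)) → (Fin n → Y l) → Fin n → W l),
      (∀ l, M l = if l = (⟨0, ht⟩ : Fin t) then ∏ k, N k else 1) ∧
      ∀ (l : Fin t) (ω : Fin n → (∀ l, W l) × (∀ l', Y l')),
        (n : ℝ)⁻¹ * ∑ i, (if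
              (g l (fun k _ => f (fun i' => (ω i').1) k) (fun i' => (ω i').2 l) i) = (ω i).1 l
              then (0 : ℝ) else 1)
          ≤ ∑ k, if k ≤ l then
            ((if T k l (fun i => (ω i).1 k) (fun i => ((fun j => (ω i).1 j.1), (ω i).2 l))
              then (0 : ℝ) else 1) +
            (ind (∃ v, v ≠ (fun i => (ω i).1 k) ∧ hh k v = hh k (fun i => (ω i).1 k) ∧
              T k l v (fun i => ((fun j => (ω i).1 j.1), (ω i).2 l)))))
            else 0 := by
  obtain ⟨x0⟩ : Nonempty ((∀ l, W l) × (∀ l, Y l)) := by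
    by_contra hne
    rw [not_nonempty_iff] at hne
    have := hq.2
    simp at this
  let e : (∀ k, Fin (N k)) ≃ Fin (∏ k, N k) := Fintype.equivFinOfCardEq (by simp)
  let enc : (Fin n → ∀ l, W l) → Fin (∏ k, N k) := fun x => e (fun k => hh k (fun i => x i k))
  have hle : ∀ l : Fin t, (⟨0, ht⟩ : Fin t) ≤ l := fun l => Nat.zero_le _
  let M : Fin t → ℕ := fun l => if l = (⟨0, ht⟩ : Fin t) then ∏ k, N k else 1
  have hM : ∀ l, 1 ≤ M l := by
    intro l
    simp only [M]
    split_ifs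
    · exact Finset.one_le_prod' fun k _ => hN k
    · exact le_rfl
  let f : (Fin n → ∀ l, W l) → ∀ l, Fin (M l) := fun x l =>
    ⟨if l = (⟨0, ht⟩ : Fin t) then (enc x).val else 0, by
      simp only [M]
      split_ifs
      · exact (enc x).2
      · exact one_pos⟩
  let P : ∀ l : Fin t, ℕ → (Fin n → Y l) → (Fin n → ∀ l, W l) → Prop := fun l m y x =>
    (enc x).val = m ∧
      ∀ k ≤ l, T k l (fun i => x i k) (fun i => ((fun j => x i j.1), y i))
  let g : ∀ l : Fin t, (∀ k : Fin t, k ≤ l → Fin (M k)) → (Fin n → Y l) → Fin n → W l :=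
    fun l m y i => if h : ∃ x, P l (m ⟨0, ht⟩ (hle l)).val y x then h.choose i l else x0.1 l
  refine ⟨M, hM, f, g, fun l => rfl, fun l ω => ?_⟩
  have hn0 : (0 : ℝ) < n := by exact_mod_cast hn
  have hnn : ∀ k ∈ (Finset.univ : Finset (Fin t)), (0 : ℝ) ≤ if k ≤ l then
            ((if T k l (fun i => (ω i).1 k) (fun i => ((fun j => (ω i).1 j.1), (ω i).2 l))
              then (0 : ℝ) else 1) +
            (ind (∃ v, v ≠ (fun i => (ω i).1 k) ∧ hh k v = hh k (fun i => (ω i).1 k) ∧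
              T k l v (fun i => ((fun j => (ω i).1 j.1), (ω i).2 l)))))
            else 0 := by
    intro k _
    split_ifs
    · rw [zero_add]
      exact ind_nonneg _
    · exact add_nonneg zero_le_one (ind_nonneg _)
    · exact le_rfl
  by_cases hgood : ∀ k ≤ l,
      T k l (fun i => (ω i).1 k) (fun i => ((fun j => (ω i).1 j.1), (ω i).2 l)) ∧
      ¬ ∃ v, v ≠ (fun i => (ω i).1 k) ∧ hh k v = hh k (fun i => (ω i).1 k) ∧
              T k l v (fun i => ((fun j => (ω i).1 j.1), (ω i).2 l))
  · refine le_trans (le_of_eq ?_) (Finset.sum_nonneg hnn)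
    rw [Finset.sum_eq_zero, mul_zero]
    intro i _
    rw [if_pos]
    have hex : ∃ x, P l (f (fun i' => (ω i').1) ⟨0, ht⟩).val (fun i' => (ω i').2 l) x :=
      ⟨fun i' => (ω i').1, by simp [f], fun k hk => (hgood k hk).1⟩
    have hg : g l (fun k _ => f (fun i' => (ω i').1) k) (fun i' => (ω i').2 l) i
        = hex.choose i l := dif_pos hex
    rw [hg]
    obtain ⟨hx1, hx2⟩ := hex.choose_spec
    set x := hex.choose with hxdef
    have henc : enc x = enc (fun i' => (ω i').1) := by
      apply Fin.ext
      rw [hx1]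
      simp [f]
    have hhash : ∀ k, hh k (fun i => x i k) = hh k (fun i => (ω i).1 k) := by
      intro k
      exact congrFun (e.injective henc) k
    have hall : ∀ m : ℕ, ∀ k : Fin t, k.val = m → k ≤ l → ∀ i, x i k = (ω i).1 k := by
      intro m
      induction m using Nat.strong_induction_on with
      | _ m ih =>
        intro k hkm hkl
        by_contra hne
        have hprev : (fun i => ((fun j : {j : Fin t // j < k} => x i j.1), (ω i).2 l))
            = (fun i => ((fun j : {j : Fin t // j < k} => (ω i).1 j.1), (ω i).2 l)) := by
          funext i
          congr 1
          funext j
          have hj : j.1.val < k.val := j.2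
          exact ih j.1.val (by omega) j.1 rfl (le_trans (le_of_lt j.2) hkl) i
        refine (hgood k hkl).2 ⟨fun i => x i k, fun h => hne fun i => congrFun h i, hhash k, ?_⟩
        rw [← hprev]
        exact hx2 k hkl
    exact hall l.val l rfl le_rfl i
  · push Not at hgood
    obtain ⟨k, hkl, hk⟩ := hgood
    have h1 : (n : ℝ)⁻¹ * ∑ i, (if
              (g l (fun k _ => f (fun i' => (ω i').1) k) (fun i' => (ω i').2 l) i) = (ω i).1 l
              then (0 : ℝ) else 1) ≤ 1 := by
      rw [inv_mul_le_iff₀ hn0, mul_one]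
      calc _ ≤ ∑ _i : Fin n, (1 : ℝ) := Finset.sum_le_sum fun i _ => by split_ifs <;> norm_num
        _ = n := by simp
    refine h1.trans (le_trans ?_ (Finset.single_le_sum hnn (Finset.mem_univ k)))
    rw [if_pos hkl]
    by_cases hTk : T k l (fun i => (ω i).1 k) (fun i => ((fun j => (ω i).1 j.1), (ω i).2 l))
    · rw [ind_pos (hk hTk), if_pos hTk, zero_add]
    · rw [if_neg hTk]
      have := ind_nonneg (∃ v, v ≠ (fun i => (ω i).1 k) ∧ hh k v = hh k (fun i => (ω i).1 k) ∧
              T k l v (fun i => ((fun j => (ω i).1 j.1), (ω i).2 l)))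
      linarith

set_option maxHeartbeats 400000 in
lemma achievability {t : ℕ} (ht : 0 < t) {W : Fin t → Type*} [∀ l, Fintype (W l)]
    {Y : Fin t → Type*} [∀ l, Fintype (Y l)]
    {q : (∀ l, W l) × (∀ l, Y l) → ℝ} (hq : IsPMF q)
    (hdeg : ∀ (j : Fin t) (h : j.val + 1 < t),
      CondIndep q (fun ω => ω.2 j) (fun ω => ω.2 ⟨j.val + 1, h⟩)
        (fun ω => (ω.1, fun k : {k : Fin t // j.val + 1 < k.val} => ω.2 k.1))) :
    Admissible q (fun l x (w : W l) => if w = x l then (0 : ℝ) else 1) (fun _ => 0)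
      (fun l => if l = (⟨0, ht⟩ : Fin t) then
        ∑ l : Fin t, condH q (fun ω => ω.1 l)
            (fun ω => ((fun i : {i : Fin t // i < l} => ω.1 i.1), ω.2 l)) else 0) := by
  set H : Fin t → ℝ := fun l => condH q (fun ω => ω.1 l)
            (fun ω => ((fun i : {i : Fin t // i < l} => ω.1 i.1), ω.2 l)) with hH
  have hH0 : ∀ l, 0 ≤ H l := fun l => condH_nonneg hq.1 _ _
  have hS0 : 0 ≤ ∑ l, H l := Finset.sum_nonneg fun l _ => hH0 l
  refine ⟨fun l => ?_, fun ε hε => ?_⟩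
  · dsimp only
    split_ifs
    · exact hS0
    · exact le_rfl
  have ht0 : (0 : ℝ) < t := by exact_mod_cast ht
  set δ : ℝ := ε / (4 * t) with hδ
  have hδ0 : 0 < δ := by positivity
  have ev1 : ∀ᶠ n : ℕ in Filter.atTop, ∀ k l : Fin t, k ≤ l →
      ∑ ω : Fin n → (∀ l, W l) × (∀ l, Y l), iidPMF q n ω *
        (if Typ q (fun ω => ω.1 k)
            (fun ω => ((fun i : {i : Fin t // i < k} => ω.1 i.1), ω.2 l)) n (H k + δ)
            (fun i => (ω i).1 k) (fun i => ((fun j => (ω i).1 j.1), (ω i).2 l))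
          then (0 : ℝ) else 1) ≤ ε / (2 * t) := by
    rw [Filter.eventually_all]
    intro k
    rw [Filter.eventually_all]
    intro l
    by_cases hkl : k ≤ l
    · have := aep hq (fun ω => ω.1 k)
        (fun ω => ((fun i : {i : Fin t // i < k} => ω.1 i.1), ω.2 l)) (H k + δ)
        (lt_of_le_of_lt (deg_mono hq hdeg k l hkl) (by simp only [hH]; linarith))
        (by positivity : (0 : ℝ) < ε / (2 * t))
      filter_upwards [this] with n hn _
      exact hn
    · exact Filter.Eventually.of_forall fun n h => absurd h hkl
  have ev2 : ∀ᶠ n : ℕ in Filter.atTop, ((2 : ℝ) ^ (-δ)) ^ n ≤ ε / (2 * t * t) :=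
    (tendsto_pow_atTop_nhds_zero_of_lt_one (by positivity)
      (Real.rpow_lt_one_of_one_lt_of_neg one_lt_two (by linarith))).eventually
      (ge_mem_nhds (by positivity))
  have ev3 : ∀ᶠ n : ℕ in Filter.atTop, 2 * t / ε ≤ (n : ℝ) :=
    tendsto_natCast_atTop_atTop.eventually_ge_atTop _
  obtain ⟨n, ⟨⟨h1, h2⟩, h3⟩, hn⟩ :=
    (((ev1.and ev2).and ev3).and (Filter.eventually_gt_atTop 0)).exists
  have hn0 : (0 : ℝ) < n := by exact_mod_cast hn
  let N : Fin t → ℕ := fun k => ⌈(2 : ℝ) ^ (n * (H k + 2 * δ))⌉₊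
  have hNge : ∀ k, (2 : ℝ) ^ (n * (H k + 2 * δ)) ≤ N k := fun k => Nat.le_ceil _
  have hN : ∀ k, 1 ≤ N k := fun k => Nat.ceil_pos.2 (by positivity)
  have hN0 : ∀ k, (0 : ℝ) < N k := fun k => by exact_mod_cast hN k
  have hNlog : ∀ k, Real.logb 2 (N k) ≤ 1 + n * (H k + 2 * δ) := by
    intro k
    have hx1 : (1 : ℝ) ≤ (2 : ℝ) ^ (n * (H k + 2 * δ)) :=
      Real.one_le_rpow one_le_two (mul_nonneg hn0.le (by have := hH0 k; linarith))
    rw [Real.logb_le_iff_le_rpow one_lt_two (hN0 k), Real.rpow_add (by norm_num), Real.rpow_one]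
    have := Nat.ceil_lt_add_one (zero_le_one.trans hx1)
    simp only [N]
    linarith
  let T : ∀ k l : Fin t, (Fin n → W k) →
      (Fin n → (∀ i : {i : Fin t // i < k}, W i.1) × Y l) → Prop := fun k l =>
    Typ q (fun ω => ω.1 k) (fun ω => ((fun i : {i : Fin t // i < k} => ω.1 i.1), ω.2 l)) n (H k + δ)
  have hp := iid_isPMF hq n
  have hbin : ∀ k : Fin t, ∃ h : (Fin n → W k) → Fin (N k), ∑ l : Fin t, ∑ ω : Fin n → (∀ l, W l) × (∀ l, Y l), iidPMF q n ω *
      (ind (∃ v, v ≠ (fun i => (ω i).1 k) ∧ h v = h (fun i => (ω i).1 k) ∧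
        T k l v (fun i => ((fun j => (ω i).1 j.1), (ω i).2 l))))
      ≤ Fintype.card (Fin t) * ((2 : ℝ) ^ (n * (H k + δ)) / N k) := by
    intro k
    have hb := binning (ι := Fin t) hp (fun ω i => (ω i).1 k)
      (fun l ω v => T k l v (fun i => ((fun j => (ω i).1 j.1), (ω i).2 l)))
      ((2 : ℝ) ^ (n * (H k + δ))) (fun l ω => typ_card hq (fun ω => ω.1 k)
        (fun ω => ((fun i : {i : Fin t // i < k} => ω.1 i.1), ω.2 l)) n (H k + δ)
        (fun i => ((fun j => (ω i).1 j.1), (ω i).2 l))) (hN k)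
    exact hb
  choose hh hhb using hbin
  have hcol : ∀ k l : Fin t, ∑ ω : Fin n → (∀ l, W l) × (∀ l, Y l), iidPMF q n ω *
      (ind (∃ v, v ≠ (fun i => (ω i).1 k) ∧ hh k v = hh k (fun i => (ω i).1 k) ∧
        T k l v (fun i => ((fun j => (ω i).1 j.1), (ω i).2 l))))
      ≤ ε / (2 * t) := by
    intro k l
    have hs := Finset.single_le_sum (f := fun l : Fin t => ∑ ω : Fin n → (∀ l, W l) × (∀ l, Y l), iidPMF q n ω *
      (ind (∃ v, v ≠ (fun i => (ω i).1 k) ∧ hh k v = hh k (fun i => (ω i).1 k) ∧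
        T k l v (fun i => ((fun j => (ω i).1 j.1), (ω i).2 l)))))
      (fun l _ => Finset.sum_nonneg fun ω _ => mul_nonneg (hp.1 ω) (ind_nonneg _))
      (Finset.mem_univ l)
    refine hs.trans ((hhb k).trans ?_)
    have hr : (2 : ℝ) ^ (n * (H k + δ)) / N k ≤ ε / (2 * t * t) := by
      refine le_trans ?_ h2
      rw [div_le_iff₀ (hN0 k), ← Real.rpow_natCast, ← Real.rpow_mul (by norm_num)]
      refine le_trans (le_of_eq ?_) (mul_le_mul_of_nonneg_left (hNge k) (by positivity))
      rw [← Real.rpow_add (by norm_num)]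
      congr 1
      ring
    rw [Fintype.card_fin]
    refine (mul_le_mul_of_nonneg_left hr ht0.le).trans (le_of_eq ?_)
    field_simp
  obtain ⟨M, hM, f, g, hMeq, hfg⟩ := ach_code ht hq hn T N hN hh
  refine ⟨n, hn, M, hM, f, g, fun l => ?_, fun l => ?_⟩
  · rw [hMeq l]
    by_cases hl : l = (⟨0, ht⟩ : Fin t)
    · simp only [if_pos hl]
      rw [div_le_iff₀ hn0]
      push_cast
      rw [Real.logb_prod _ _ fun k _ => (hN0 k).ne']
      refine (Finset.sum_le_sum fun k _ => hNlog k).trans ?_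
      rw [Finset.sum_add_distrib, ← Finset.mul_sum, Finset.sum_add_distrib]
      simp only [Finset.sum_const, Finset.card_univ, Fintype.card_fin, nsmul_eq_mul, mul_one]
      rw [div_le_iff₀ hε] at h3
      have : (t : ℝ) * (2 * δ) = ε / 2 := by
        rw [hδ]
        field_simp
        norm_num
      rw [this]
      linarith
    · simp only [if_neg hl]
      simp [hε.le]
  · rw [zero_add]
    refine (Finset.sum_le_sum fun ω _ =>
      mul_le_mul_of_nonneg_left (hfg l ω) (hp.1 ω)).trans ?_
    simp_rw [Finset.mul_sum]
    rw [Finset.sum_comm]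
    calc _ ≤ ∑ _k : Fin t, ε / t := by
          refine Finset.sum_le_sum fun k _ => ?_
          by_cases hkl : k ≤ l
          · simp only [if_pos hkl, mul_add]
            rw [Finset.sum_add_distrib]
            refine (add_le_add (h1 k l hkl) (hcol k l)).trans (le_of_eq ?_)
            field_simp
            norm_num
          · simp only [if_neg hkl, mul_zero, Finset.sum_const_zero]
            positivity
      _ = ε := by
          simp only [Finset.sum_const, Finset.card_univ, Fintype.card_fin, nsmul_eq_mul]
          field_simp

/-- **Single-channel lossless private messages (Corollary 1).**  Here
`X = (W_1,…,W_t)`, decoder `l` must reproduce `W_l`, and `δ_l` is the per-letter error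
indicator.  If `(W_1,…,W_t) — Y_t — ⋯ — Y_1` forms a Markov chain under `q`, then
`R(0,…,0) = Σ_{l=1}^t H(W_l | W_1,…,W_{l−1}, Y_l)`. -/
theorem lossless_private_messages_rate
    {t : ℕ} (ht : 0 < t) {W : Fin t → Type*} [∀ l, Fintype (W l)]
    {Y : Fin t → Type*} [∀ l, Fintype (Y l)]
    (q : (∀ l, W l) × (∀ l, Y l) → ℝ) (hq : IsPMF q)
    (hdeg : ∀ (j : Fin t) (h : j.val + 1 < t),
      CondIndep q (fun ω => ω.2 j) (fun ω => ω.2 ⟨j.val + 1, h⟩)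
        (fun ω => (ω.1, fun k : {k : Fin t // j.val + 1 < k.val} => ω.2 k.1))) :
    RdFun q (fun l x w => if w = x l then (0 : ℝ) else 1) ht (fun _ => 0)
      = ∑ l : Fin t,
          condH q (fun ω => ω.1 l)
            (fun ω => ((fun i : {i : Fin t // i < l} => ω.1 i.1), ω.2 l)) := by
  unfold RdFun
  refine IsLeast.csInf_eq ⟨⟨Finset.sum_nonneg fun l _ => condH_nonneg hq.1 _ _, ?_⟩, ?_⟩
  · exact achievability ht hq hdeg
  · rintro r ⟨_, hr⟩
    exact converse ht hq hdeg hr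

end
end

section
/- Proposition 6 (lossless reconstruction at every decoder): If for every l ∈ [t] the reconstruction alphabet is 𝒳̂_l = 𝒳 and the distortion measure satisfies δ_l(x,x) = 0 and δ_l(x,x̂) > 0 for all x̂ ≠ x, then R(0,0,…,0) = max_{l ∈ [t]} H(X | Y_l), where H denotes base-2 conditional Shannon entropy of the source pair (X, Y_l) ∼ q. -/
open scoped BigOperators Classical

noncomputable section

/-- Sum of a product function over sequences factorizes. -/
lemma sum_prod_seq {A : Type*} [Fintype A] {n : ℕ} (g : Fin n → A → ℝ) :
    ∑ z : Fin n → A, ∏ i, g i (z i) = ∏ i, ∑ a, g i a := by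
  rw [Finset.prod_univ_sum]
  simp

lemma iidPMF_nonneg {A : Type*} [Fintype A] {p : A → ℝ} (hp : IsPMF p) {n : ℕ}
    (z : Fin n → A) : 0 ≤ iidPMF p n z :=
  Finset.prod_nonneg (fun i _ => hp.1 _)

lemma iidPMF_sum {A : Type*} [Fintype A] {p : A → ℝ} (hp : IsPMF p) (n : ℕ) :
    ∑ z, iidPMF p n z = 1 := by
  unfold iidPMF
  rw [sum_prod_seq (fun _ a => p a)]
  simp [hp.2]

lemma iidPMF_push {S A : Type*} [Fintype S] [Fintype A] (q : S → ℝ) (φ : S → A) {n : ℕ}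
    (F : (Fin n → A) → ℝ) :
    ∑ ω, iidPMF q n ω * F (fun i => φ (ω i)) = ∑ z, iidPMF (pOf q φ) n z * F z := by
  have h : ∀ z : Fin n → A, iidPMF (pOf q φ) n z
      = ∑ ω : Fin n → S, if (fun i => φ (ω i)) = z then iidPMF q n ω else 0 := by
    intro z
    unfold iidPMF pOf
    rw [← sum_prod_seq (fun i s => if φ s = z i then q s else 0)]
    refine Finset.sum_congr rfl fun ω _ => ?_
    by_cases hz : (fun i => φ (ω i)) = z
    · rw [if_pos hz]
      refine Finset.prod_congr rfl fun i _ => ?_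
      rw [if_pos (congrFun hz i)]
    · rw [if_neg hz]
      have : ∃ i, φ (ω i) ≠ z i := by
        by_contra hcon
        push Not at hcon
        exact hz (funext hcon)
      obtain ⟨i, hi⟩ := this
      exact Finset.prod_eq_zero (Finset.mem_univ i) (if_neg hi)
  simp_rw [h, Finset.sum_mul]
  rw [Finset.sum_comm]
  refine Finset.sum_congr rfl fun ω _ => ?_
  rw [Finset.sum_eq_single (fun i => φ (ω i))]
  · simp
  · intro b _ hb
    rw [if_neg (Ne.symm hb), zero_mul]
  · simp

lemma pOf_isPMF {S A : Type*} [Fintype S] [Fintype A] {q : S → ℝ} (hq : IsPMF q) (φ : S → A) :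
    IsPMF (pOf q φ) := by
  refine ⟨fun a => Finset.sum_nonneg fun s _ => ?_, ?_⟩
  · split_ifs
    · exact hq.1 _
    · exact le_rfl
  · unfold pOf
    rw [Finset.sum_comm]
    simp [hq.2]

lemma iidPMF_marg {A : Type*} [Fintype A] {p : A → ℝ} (hp : IsPMF p) {n : ℕ} (j : Fin n)
    (V : A → ℝ) : ∑ z, iidPMF p n z * V (z j) = ∑ a, p a * V a := by
  have h : ∀ z : Fin n → A, iidPMF p n z * V (z j)
      = ∏ i, (if i = j then p (z i) * V (z i) else p (z i)) := by
    intro z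
    unfold iidPMF
    rw [← Finset.mul_prod_erase _ _ (Finset.mem_univ j),
      ← Finset.mul_prod_erase _ (fun i => if i = j then p (z i) * V (z i) else p (z i))
        (Finset.mem_univ j), if_pos rfl]
    rw [Finset.prod_congr rfl (g := fun i => p (z i))
      (fun i hi => if_neg (Finset.ne_of_mem_erase hi))]
    ring
  simp_rw [h]
  rw [sum_prod_seq (fun i a => if i = j then p a * V a else p a)]
  rw [← Finset.mul_prod_erase _ _ (Finset.mem_univ j)]
  rw [Finset.prod_eq_one]
  · simp
  · intro i hi
    simp [Finset.ne_of_mem_erase hi, hp.2]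

/-- second marginal -/
def margY {X Y : Type*} [Fintype X] (p : X × Y → ℝ) (y : Y) : ℝ := ∑ x, p (x, y)

/-- conditional information density (natural log) -/
def infoD {X Y : Type*} [Fintype X] (p : X × Y → ℝ) (z : X × Y) : ℝ :=
  Real.log (margY p z.2) - Real.log (p z)

/-- conditional entropy in nats -/
def natH {X Y : Type*} [Fintype X] [Fintype Y] (p : X × Y → ℝ) : ℝ :=
  ∑ z, p z * infoD p z

lemma margY_isPMF {X Y : Type*} [Fintype X] [Fintype Y] {p : X × Y → ℝ} (hp : IsPMF p) :
    IsPMF (margY p) := by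
  refine ⟨fun y => Finset.sum_nonneg fun x _ => hp.1 _, ?_⟩
  unfold margY
  rw [← hp.2, Fintype.sum_prod_type_right]

lemma le_margY {X Y : Type*} [Fintype X] [Fintype Y] {p : X × Y → ℝ} (hp : IsPMF p) (z : X × Y) :
    p z ≤ margY p z.2 :=
  Finset.single_le_sum (f := fun x => p (x, z.2)) (fun x _ => hp.1 _) (Finset.mem_univ z.1)

lemma natH_nonneg {X Y : Type*} [Fintype X] [Fintype Y] {p : X × Y → ℝ} (hp : IsPMF p) :
    0 ≤ natH p := by
  refine Finset.sum_nonneg fun z _ => ?_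
  rcases (hp.1 z).eq_or_lt with h | h
  · rw [← h, zero_mul]
  · exact mul_nonneg h.le (sub_nonneg.2 (Real.log_le_log h (le_margY hp z)))

lemma condH_eq_s5 {S X Y : Type*} [Fintype S] [Fintype X] [Fintype Y] (q : S → ℝ)
    (A : S → X) (B : S → Y) :
    condH q A B = natH (pOf q (fun s => (A s, B s))) / Real.log 2 := by
  have hm : ∀ y, margY (pOf q (fun s => (A s, B s))) y = pOf q B y := by
    intro y
    unfold margY pOf
    rw [Finset.sum_comm]
    refine Finset.sum_congr rfl fun s _ => ?_
    by_cases hB : B s = y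
    · simp [hB, Prod.ext_iff]
    · simp [hB, Prod.ext_iff]
  unfold condH H2 natH infoD
  simp_rw [mul_sub, Finset.sum_sub_distrib, hm, Real.logb, ← mul_div_assoc, ← Finset.sum_div]
  have : ∑ z : X × Y, pOf q (fun s => (A s, B s)) z * Real.log (pOf q B z.2)
      = ∑ y, pOf q B y * Real.log (pOf q B y) := by
    rw [Fintype.sum_prod_type_right]
    refine Finset.sum_congr rfl fun y _ => ?_
    simp only []
    rw [← Finset.sum_mul, ← hm]
    rfl
  rw [this]
  ring

/-- split of pair sequences -/
lemma sum_pair_seq {X Y : Type*} [Fintype X] [Fintype Y] {n : ℕ} (F : (Fin n → X × Y) → ℝ) :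
    ∑ z, F z = ∑ y : Fin n → Y, ∑ x : Fin n → X, F (fun i => (x i, y i)) := by
  rw [← Fintype.sum_prod_type_right (f := fun w : (Fin n → X) × (Fin n → Y) =>
    F (fun i => (w.1 i, w.2 i)))]
  exact Fintype.sum_equiv (Equiv.arrowProdEquivProdArrow (Fin n) (fun _ => X) (fun _ => Y)) _ _ (fun z => rfl)

lemma sum_x_seq {X Y : Type*} [Fintype X] [Fintype Y] {n : ℕ} (p : X × Y → ℝ)
    (y : Fin n → Y) :
    ∑ x : Fin n → X, iidPMF p n (fun i => (x i, y i)) = iidPMF (margY p) n y := by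
  unfold iidPMF margY
  exact sum_prod_seq (fun i x => p (x, y i))

lemma log_ratio {X Y : Type*} [Fintype X] [Fintype Y] {n : ℕ} {p : X × Y → ℝ} (hp : IsPMF p)
    {z : Fin n → X × Y} (hz : 0 < iidPMF p n z) :
    0 < iidPMF (margY p) n (fun i => (z i).2) ∧
    Real.log (iidPMF (margY p) n (fun i => (z i).2)) - Real.log (iidPMF p n z)
      = ∑ i, infoD p (z i) := by
  have h1 : ∀ i, 0 < p (z i) := by
    intro i
    refine lt_of_le_of_ne (hp.1 _) fun h => hz.ne' ?_
    exact Finset.prod_eq_zero (Finset.mem_univ i) h.symm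
  have h2 : ∀ i, 0 < margY p (z i).2 := fun i => (h1 i).trans_le (le_margY hp _)
  refine ⟨Finset.prod_pos fun i _ => h2 i, ?_⟩
  unfold iidPMF infoD
  rw [Real.log_prod (fun i _ => (h2 i).ne'), Real.log_prod (fun i _ => (h1 i).ne'),
    Finset.sum_sub_distrib]

/-- Converse at blocklength `n` for a single decoder. -/
lemma converse_n {X Y K : Type*} [Fintype X] [Fintype Y] [Fintype K] {n : ℕ}
    {p : X × Y → ℝ} (hp : IsPMF p) (enc : (Fin n → X) → K)
    (dec : K → (Fin n → Y) → Fin n → X) {η : ℝ} (h0 : 0 < η) (h1 : η < 1) :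
    n * natH p ≤ Real.log (Fintype.card K) - n * Real.log (1 - η)
      + Real.log (Fintype.card X / η) * ∑ z, iidPMF p n z *
        ∑ i, (if (z i).1 = dec (enc (fun i => (z i).1)) (fun i => (z i).2) i then (0 : ℝ) else 1) := by
  obtain ⟨s0⟩ : Nonempty (X × Y) := by
    by_contra h
    rw [not_nonempty_iff] at h
    have := hp.2
    simp at this
  have hXpos : (1 : ℝ) ≤ Fintype.card X := by
    have : 0 < Fintype.card X := Fintype.card_pos_iff.2 ⟨s0.1⟩
    exact_mod_cast this
  have hKpos : (0 : ℝ) < Fintype.card K := by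
    have : 0 < Fintype.card K := Fintype.card_pos_iff.2 ⟨enc fun _ => s0.1⟩
    exact_mod_cast this
  set W : X → X → ℝ := fun x xh => if x = xh then 1 - η else η / Fintype.card X with hW
  have hη' : 0 < η / Fintype.card X := by positivity
  have hWpos : ∀ x xh, 0 < W x xh := by
    intro x xh
    simp only [hW]
    split_ifs
    · linarith
    · exact hη'
  have hWsum : ∀ xh, ∑ x, W x xh ≤ 1 := by
    intro xh
    have : ∀ x, W x xh ≤ (if x = xh then 1 - η else 0) + η / Fintype.card X := by
      intro x
      simp only [hW]
      split_ifs <;> linarith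
    refine (Finset.sum_le_sum fun x _ => this x).trans ?_
    rw [Finset.sum_add_distrib]
    simp only [Finset.sum_ite_eq', Finset.mem_univ, if_true, Finset.sum_const, Finset.card_univ,
      nsmul_eq_mul]
    rw [mul_div_cancel₀ _ (by positivity)]
    linarith
  set Q : (Fin n → X × Y) → ℝ := fun z =>
    ∑ m : K, (Fintype.card K : ℝ)⁻¹ * ∏ i, W (z i).1 (dec m (fun i => (z i).2) i) with hQ
  have hQpos : ∀ z, 0 < Q z := by
    intro z
    refine Finset.sum_pos (fun m _ => mul_pos (by positivity) (Finset.prod_pos fun i _ => hWpos _ _)) ?_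
    exact ⟨enc fun _ => s0.1, Finset.mem_univ _⟩
  have hQsum : ∑ z, Q z * iidPMF (margY p) n (fun i => (z i).2) ≤ 1 := by
    rw [sum_pair_seq]
    refine le_trans ?_ (iidPMF_sum (margY_isPMF hp) n).le
    refine Finset.sum_le_sum fun y _ => ?_
    simp only []
    rw [← Finset.sum_mul]
    refine mul_le_of_le_one_left (iidPMF_nonneg (margY_isPMF hp) _) ?_
    simp only [hQ]
    rw [Finset.sum_comm]
    simp_rw [← Finset.mul_sum]
    have : ∀ m : K, ∑ x : Fin n → X, ∏ i, W (x i) (dec m y i) ≤ 1 := by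
      intro m
      rw [sum_prod_seq (fun i x => W x (dec m y i))]
      exact Finset.prod_le_one (fun i _ => Finset.sum_nonneg fun x _ => (hWpos _ _).le)
        (fun i _ => hWsum _)
    calc (Fintype.card K : ℝ)⁻¹ * ∑ m : K, ∑ x : Fin n → X, ∏ i, W (x i) (dec m y i)
        ≤ (Fintype.card K : ℝ)⁻¹ * ∑ m : K, 1 := by
          gcongr with m _
          exact this m
      _ = 1 := by
          simp [hKpos.ne']
  have hG : ∀ z, iidPMF p n z * (Real.log (Q z) + ∑ i, infoD p (z i))
      ≤ Q z * iidPMF (margY p) n (fun i => (z i).2) - iidPMF p n z := by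
    intro z
    rcases (iidPMF_nonneg hp z).eq_or_lt with h | h
    · rw [← h]
      simpa using mul_nonneg (hQpos z).le (iidPMF_nonneg (margY_isPMF hp) _)
    · obtain ⟨ha, hb⟩ := log_ratio hp h
      rw [← hb]
      have e : Real.log (Q z) + (Real.log (iidPMF (margY p) n fun i => (z i).2)
          - Real.log (iidPMF p n z))
          = Real.log (Q z * iidPMF (margY p) n (fun i => (z i).2) / iidPMF p n z) := by
        rw [Real.log_div (mul_pos (hQpos z) ha).ne' h.ne', Real.log_mul (hQpos z).ne' ha.ne']
        ring
      rw [e]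
      have := Real.log_le_sub_one_of_pos (div_pos (mul_pos (hQpos z) ha) h)
      calc _ ≤ iidPMF p n z * (Q z * iidPMF (margY p) n (fun i => (z i).2) / iidPMF p n z - 1) := by
            gcongr
        _ = _ := by field_simp
  have hlogη : Real.log (1 - η) ≤ 0 := Real.log_nonpos (by linarith) (by linarith)
  have hQlow : ∀ z, -Real.log (Fintype.card K) + n * Real.log (1 - η)
      - Real.log (Fintype.card X / η) * ∑ i, (if (z i).1 = dec (enc (fun i => (z i).1)) (fun i => (z i).2) i then (0 : ℝ) else 1) ≤ Real.log (Q z) := by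
    intro z
    have hle : (Fintype.card K : ℝ)⁻¹ * ∏ i, W (z i).1 (dec (enc (fun i => (z i).1)) (fun i => (z i).2) i) ≤ Q z :=
      Finset.single_le_sum (f := fun m => (Fintype.card K : ℝ)⁻¹ * ∏ i, W (z i).1 (dec m (fun i => (z i).2) i))
        (fun m _ => (mul_pos (by positivity) (Finset.prod_pos fun i _ => hWpos _ _)).le)
        (Finset.mem_univ _)
    have hpp := Finset.prod_pos (s := Finset.univ) (fun i _ => hWpos (z i).1 (dec (enc (fun i => (z i).1)) (fun i => (z i).2) i))
    have := Real.log_le_log (mul_pos (by positivity) hpp) hle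
    refine le_trans ?_ this
    rw [Real.log_mul (by positivity) hpp.ne', Real.log_inv, Real.log_prod (fun i _ => (hWpos _ _).ne')]
    have hc : (n : ℝ) * Real.log (1 - η) = ∑ i : Fin n, Real.log (1 - η) := by simp
    rw [add_sub_assoc, hc, Finset.mul_sum, ← Finset.sum_sub_distrib]
    gcongr with i _
    simp only [hW]
    split_ifs
    · simp
    · have : Real.log (η / Fintype.card X) = - Real.log (Fintype.card X / η) := by
        rw [← Real.log_inv, inv_div]
      rw [this]
      linarith
  have hsum := Finset.sum_le_sum (s := Finset.univ) (fun z _ => hG z)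
  rw [Finset.sum_sub_distrib, iidPMF_sum hp n] at hsum
  have hV : ∑ z, iidPMF p n z * ∑ i, infoD p (z i) = n * natH p := by
    simp_rw [Finset.mul_sum]
    rw [Finset.sum_comm]
    simp_rw [iidPMF_marg hp _ (infoD p)]
    simp [natH]
  simp_rw [mul_add] at hsum
  rw [Finset.sum_add_distrib, hV] at hsum
  have hlow := Finset.sum_le_sum (s := Finset.univ)
    (fun z _ => mul_le_mul_of_nonneg_left (hQlow z) (iidPMF_nonneg hp z))
  simp_rw [mul_sub] at hlow
  rw [Finset.sum_sub_distrib, ← Finset.sum_mul, iidPMF_sum hp n, one_mul] at hlow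
  rw [Finset.mul_sum]
  have e2 : ∀ z : Fin n → X × Y, Real.log (Fintype.card X / η) * (iidPMF p n z *
        ∑ i, (if (z i).1 = dec (enc (fun i => (z i).1)) (fun i => (z i).2) i then (0 : ℝ) else 1))
      = iidPMF p n z * (Real.log (Fintype.card X / η) *
        ∑ i, (if (z i).1 = dec (enc (fun i => (z i).1)) (fun i => (z i).2) i then (0 : ℝ) else 1)) := by
    intro z; ring
  simp_rw [e2]
  linarith

lemma exists_delta_lower {X : Type*} [Fintype X] (d : X → X → ℝ)
    (hpos : ∀ x xh, xh ≠ x → 0 < d x xh) :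
    ∃ c : ℝ, 0 < c ∧ ∀ x xh, xh ≠ x → c ≤ d x xh := by
  by_cases hne : Nonempty {w : X × X // w.2 ≠ w.1}
  · obtain ⟨w, hw⟩ := Finite.exists_min (fun w : {w : X × X // w.2 ≠ w.1} => d w.1.1 w.1.2)
    exact ⟨_, hpos _ _ w.2, fun x xh h => hw ⟨(x, xh), h⟩⟩
  · refine ⟨1, one_pos, fun x xh h => ?_⟩
    exact absurd ⟨⟨(x, xh), h⟩⟩ hne

lemma converse_main
    {t : ℕ} (ht : 0 < t)
    {X : Type*} [Fintype X] {Y : Fin t → Type*} [∀ l, Fintype (Y l)]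
    (q : X × (∀ l, Y l) → ℝ) (hq : IsPMF q)
    (δ : Fin t → X → X → ℝ)
    (hδ0 : ∀ l x, δ l x x = 0)
    (hδpos : ∀ l (x xh : X), xh ≠ x → 0 < δ l x xh) (r : ℝ)
    (hr : Admissible (Xh := fun _ => X) q δ (fun _ => 0)
      (fun l => if l = (⟨0, ht⟩ : Fin t) then r else 0)) (l : Fin t) :
    natH (pOf q (fun s => (s.1, s.2 l))) ≤ Real.log 2 * r := by
  set p := pOf q (fun s => (s.1, s.2 l)) with hpdef
  have hp : IsPMF p := pOf_isPMF hq _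
  obtain ⟨c, hc, hcle⟩ := exists_delta_lower (δ l) (hδpos l)
  have hX : (1 : ℝ) ≤ Fintype.card X := by
    have : Nonempty X := by
      by_contra h
      rw [not_nonempty_iff] at h
      have := hq.2
      simp at this
    have : 0 < Fintype.card X := Fintype.card_pos_iff.2 this
    exact_mod_cast this
  have hlog2 : 0 < Real.log 2 := Real.log_pos (by norm_num)
  have key : ∀ η : ℝ, 0 < η → η < 1 → ∀ ε : ℝ, 0 < ε →
      natH p ≤ Real.log 2 * (r + t * ε) - Real.log (1 - η)
        + Real.log (Fintype.card X / η) * (ε / c) := by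
    intro η h0 h1 ε hε
    obtain ⟨n, hn, M, hM, f, g, hrate, hdist⟩ := hr.2 ε hε
    have hn' : (0 : ℝ) < n := by exact_mod_cast hn
    have hcv := converse_n (K := ∀ k, Fin (M k)) hp f (fun m y => g l (fun k _ => m k) y) h0 h1
    have hcard : Real.log (Fintype.card (∀ k, Fin (M k))) ≤ n * (Real.log 2 * (r + t * ε)) := by
      have : (Fintype.card (∀ k, Fin (M k)) : ℝ) = ∏ k, (M k : ℝ) := by simp
      rw [this, Real.log_prod (fun k _ => by have := hM k; positivity)]
      have h2 : ∀ k, Real.log (M k) ≤ n * (Real.log 2 * ((if k = (⟨0, ht⟩ : Fin t) then r else 0) + ε)) := by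
        intro k
        have := hrate k
        rw [div_le_iff₀ hn', Real.logb, div_le_iff₀ hlog2] at this
        linarith
      refine (Finset.sum_le_sum fun k _ => h2 k).trans ?_
      rw [← Finset.mul_sum, ← Finset.mul_sum, Finset.sum_add_distrib]
      simp
    have hd := hdist l
    rw [zero_add] at hd
    have hpush := iidPMF_push q (fun s => (s.1, s.2 l)) (n := n) (fun z => (n : ℝ)⁻¹ * ∑ i, δ l (z i).1
      (g l (fun k _ => f (fun i => (z i).1) k) (fun i => (z i).2) i))
    simp only [] at hpush
    rw [hpush] at hd
    have herr : ∑ z, iidPMF p n z *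
        ∑ i, (if (z i).1 = g l (fun k _ => f (fun i => (z i).1) k) (fun i => (z i).2) i then (0 : ℝ) else 1)
        ≤ n * (ε / c) := by
      calc _ ≤ ∑ z, (n / c) * (iidPMF p n z * ((n : ℝ)⁻¹ * ∑ i, δ l (z i).1
          (g l (fun k _ => f (fun i => (z i).1) k) (fun i => (z i).2) i))) := by
            refine Finset.sum_le_sum fun z _ => ?_
            have : (n / c) * (iidPMF p n z * ((n : ℝ)⁻¹ * ∑ i, δ l (z i).1
              (g l (fun k _ => f (fun i => (z i).1) k) (fun i => (z i).2) i)))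
              = iidPMF p n z * ∑ i, c⁻¹ * δ l (z i).1
                (g l (fun k _ => f (fun i => (z i).1) k) (fun i => (z i).2) i) := by
              rw [← Finset.mul_sum]
              field_simp
            rw [this]
            refine mul_le_mul_of_nonneg_left (Finset.sum_le_sum fun i _ => ?_) (iidPMF_nonneg hp z)
            split_ifs with h
            · rw [← h, hδ0, mul_zero]
            · rw [inv_mul_eq_div, one_le_div hc]
              exact hcle _ _ (Ne.symm h)
        _ ≤ (n / c) * ε := by
            rw [← Finset.mul_sum]
            gcongr
        _ = n * (ε / c) := by ring
    have hlX : 0 ≤ Real.log (Fintype.card X / η) := by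
      apply Real.log_nonneg
      rw [le_div_iff₀ h0]
      linarith
    have h3 := mul_le_mul_of_nonneg_left herr hlX
    have h4 : n * natH p ≤ n * (Real.log 2 * (r + t * ε) - Real.log (1 - η)
        + Real.log (Fintype.card X / η) * (ε / c)) := by
      refine hcv.trans ?_
      linarith
    exact le_of_mul_le_mul_left h4 hn'
  have key2 : ∀ η : ℝ, 0 < η → η < 1 → natH p ≤ Real.log 2 * r - Real.log (1 - η) := by
    intro η h0 h1
    have hcont : Filter.Tendsto (fun ε : ℝ => Real.log 2 * (r + t * ε) - Real.log (1 - η)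
        + Real.log (Fintype.card X / η) * (ε / c)) (nhdsWithin 0 (Set.Ioi 0))
        (nhds (Real.log 2 * (r + t * 0) - Real.log (1 - η)
        + Real.log (Fintype.card X / η) * (0 / c))) := by
      apply Filter.Tendsto.mono_left _ nhdsWithin_le_nhds
      apply Continuous.tendsto
      fun_prop
    have := ge_of_tendsto hcont (by
      filter_upwards [self_mem_nhdsWithin] with ε hε using key η h0 h1 ε hε)
    simpa using this
  have hcont : Filter.Tendsto (fun η : ℝ => Real.log 2 * r - Real.log (1 - η))
      (nhdsWithin 0 (Set.Ioi 0)) (nhds (Real.log 2 * r - Real.log (1 - 0))) := by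
    apply Filter.Tendsto.mono_left _ nhdsWithin_le_nhds
    apply ContinuousAt.tendsto
    refine continuousAt_const.sub (ContinuousAt.log ?_ (by norm_num))
    fun_prop
  have := ge_of_tendsto hcont (by
    filter_upwards [Ioo_mem_nhdsGT (show (0 : ℝ) < 1 by norm_num)] with η hη
      using key2 η hη.1 hη.2)
  simpa using this

/-- typical (good) pair sequences -/
def goodSeq {X Y : Type*} [Fintype X] (p : X × Y → ℝ) (n : ℕ) (θ : ℝ)
    (x : Fin n → X) (y : Fin n → Y) : Prop :=
  θ * iidPMF (margY p) n y ≤ iidPMF p n (fun i => (x i, y i))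

/-- binning decoder -/
def binDec {X Y : Type*} [Fintype X] [Nonempty X] (p : X × Y → ℝ) (n : ℕ) (θ : ℝ) {M : ℕ}
    (f : (Fin n → X) → Fin M) (b : Fin M) (y : Fin n → Y) : Fin n → X :=
  if h : ∃ x, f x = b ∧ goodSeq p n θ x y then h.choose else fun _ => Classical.arbitrary X

/-- probability of block error of the binning decoder -/
def binErr {X Y : Type*} [Fintype X] [Fintype Y] [Nonempty X] (p : X × Y → ℝ) (n : ℕ) (θ : ℝ)
    {M : ℕ} (f : (Fin n → X) → Fin M) : ℝ :=
  ∑ z : Fin n → X × Y, iidPMF p n z *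
    (if binDec p n θ f (f fun i => (z i).1) (fun i => (z i).2) = (fun i => (z i).1) then 0 else 1)

lemma collision_count {A : Type*} [Fintype A] [DecidableEq A] {M : ℕ} {a b : A} (hab : a ≠ b) :
    (M : ℝ) * ∑ f : A → Fin M, (if f a = f b then (1 : ℝ) else 0)
      ≤ Fintype.card (A → Fin M) := by
  have h : Fintype.card ({f : A → Fin M // f a = f b} × Fin M) ≤ Fintype.card (A → Fin M) := by
    refine Fintype.card_le_of_injective (fun w => Function.update w.1.1 a w.2) ?_
    rintro ⟨⟨f, hf⟩, c⟩ ⟨⟨f', hf'⟩, c'⟩ h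
    simp only at h
    have hc : c = c' := by simpa using congrFun h a
    have hne : ∀ k, k ≠ a → f k = f' k := by
      intro k hk
      simpa [Function.update_of_ne hk] using congrFun h k
    have hff : f = f' := by
      funext k
      by_cases hk : k = a
      · rw [hk, hf, hf', hne b hab.symm]
      · exact hne k hk
    subst hc
    subst hff
    rfl
  rw [Fintype.card_prod, Fintype.card_fin, Fintype.card_subtype] at h
  rw [Finset.sum_boole, mul_comm]
  exact_mod_cast h

lemma good_count {X Y : Type*} [Fintype X] [Fintype Y] {p : X × Y → ℝ} (hp : IsPMF p) {n : ℕ}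
    {θ : ℝ} (hθ : 0 < θ) (y : Fin n → Y) (hy : 0 < iidPMF (margY p) n y) :
    ∑ x : Fin n → X, (if goodSeq p n θ x y then (1 : ℝ) else 0) ≤ θ⁻¹ := by
  have h : ∑ x : Fin n → X, (if goodSeq p n θ x y then (1 : ℝ) else 0)
      * (θ * iidPMF (margY p) n y) ≤ iidPMF (margY p) n y := by
    rw [← sum_x_seq]
    refine Finset.sum_le_sum fun x _ => ?_
    split_ifs with hg
    · rw [sum_x_seq, one_mul]
      exact hg
    · rw [zero_mul]
      exact iidPMF_nonneg hp _
  rw [← Finset.sum_mul, ← mul_assoc] at h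
  have := le_of_mul_le_mul_right (h.trans (one_mul _).ge) hy
  rwa [← one_div, le_div_iff₀ hθ]

lemma binErr_avg {X Y : Type*} [Fintype X] [Fintype Y] [Nonempty X] {p : X × Y → ℝ}
    (hp : IsPMF p) {n : ℕ} {θ : ℝ} (hθ : 0 < θ) {M : ℕ} (hM : 0 < M) :
    ∑ f : (Fin n → X) → Fin M, binErr p n θ f
      ≤ Fintype.card ((Fin n → X) → Fin M) *
        ((∑ z : Fin n → X × Y, iidPMF p n z *
          (if goodSeq p n θ (fun i => (z i).1) (fun i => (z i).2) then 0 else 1)) + (θ * M)⁻¹) := by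
  have hM' : (0 : ℝ) < M := by exact_mod_cast hM
  obtain ⟨N, hN⟩ : ∃ N : ℝ, N = ((Fintype.card ((Fin n → X) → Fin M) : ℕ) : ℝ) := ⟨_, rfl⟩
  rw [← hN]
  have hN0 : 0 ≤ N := hN ▸ Nat.cast_nonneg _
  have hpt : ∀ (f : (Fin n → X) → Fin M) (x : Fin n → X) (y : Fin n → Y),
      (if binDec p n θ f (f x) y = x then (0 : ℝ) else 1)
        ≤ (if goodSeq p n θ x y then 0 else 1)
          + ∑ x' : Fin n → X, (if x' = x then 0 else
            (if f x' = f x then (1 : ℝ) else 0) * (if goodSeq p n θ x' y then 1 else 0)) := by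
    intro f x y
    have hnn : ∀ x' : Fin n → X, 0 ≤ (if x' = x then 0 else
            (if f x' = f x then (1 : ℝ) else 0) * (if goodSeq p n θ x' y then 1 else 0)) := by
      intro x'
      split_ifs <;> norm_num
    have hnn' := Finset.sum_nonneg (s := Finset.univ) (fun x' _ => hnn x')
    by_cases hg : goodSeq p n θ x y
    · rw [if_pos hg, zero_add]
      split_ifs with hd
      · exact hnn'
      · have hex : ∃ x', f x' = f x ∧ goodSeq p n θ x' y := ⟨x, rfl, hg⟩
        have hdec : binDec p n θ f (f x) y = hex.choose := by
          unfold binDec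
          rw [dif_pos hex]
        obtain ⟨h1, h2⟩ := hex.choose_spec
        rw [← hdec] at h1 h2
        refine le_trans ?_ (Finset.single_le_sum (fun x' _ => hnn x')
          (Finset.mem_univ (binDec p n θ f (f x) y)))
        rw [if_neg hd, if_pos h1, if_pos h2]
        norm_num
    · rw [if_neg hg]
      split_ifs <;> linarith
  have hz : ∀ z : Fin n → X × Y, ∑ f : (Fin n → X) → Fin M, iidPMF p n z *
      (if binDec p n θ f (f fun i => (z i).1) (fun i => (z i).2) = (fun i => (z i).1)
        then (0 : ℝ) else 1)
      ≤ N * (iidPMF p n z *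
          (if goodSeq p n θ (fun i => (z i).1) (fun i => (z i).2) then 0 else 1))
        + N * (iidPMF p n z * (θ * M)⁻¹) := by
    intro z
    rw [← Finset.mul_sum]
    rcases (iidPMF_nonneg hp z).eq_or_lt with h | h
    · rw [← h]; simp
    obtain ⟨hy, -⟩ := log_ratio hp h
    set x : Fin n → X := fun i => (z i).1
    set y : Fin n → Y := fun i => (z i).2
    have hs : ∑ f : (Fin n → X) → Fin M, (if binDec p n θ f (f x) y = x then (0 : ℝ) else 1)
        ≤ N * (if goodSeq p n θ x y then 0 else 1) + N * (θ * M)⁻¹ := by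
      refine (Finset.sum_le_sum fun f _ => hpt f x y).trans ?_
      rw [Finset.sum_add_distrib, Finset.sum_const, Finset.card_univ, nsmul_eq_mul, ← hN,
        Finset.sum_comm]
      refine add_le_add le_rfl ?_
      have : ∀ x' : Fin n → X, ∑ f : (Fin n → X) → Fin M, (if x' = x then 0 else
            (if f x' = f x then (1 : ℝ) else 0) * (if goodSeq p n θ x' y then 1 else 0))
          ≤ (N / M) * (if goodSeq p n θ x' y then 1 else 0) := by
        intro x'
        by_cases hx : x' = x
        · simp only [hx, if_true, Finset.sum_const_zero]
          split_ifs
          · positivity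
          · simp
        · simp only [hx, if_false]
          rw [← Finset.sum_mul]
          refine mul_le_mul_of_nonneg_right ?_ (by split_ifs <;> norm_num)
          rw [le_div_iff₀ hM', mul_comm, hN]
          exact collision_count hx
      refine (Finset.sum_le_sum fun x' _ => this x').trans ?_
      rw [← Finset.mul_sum]
      calc _ ≤ N / M * θ⁻¹ := by
            gcongr
            exact good_count hp hθ y hy
        _ = _ := by
            rw [mul_inv]; ring
    calc _ ≤ iidPMF p n z * (N * (if goodSeq p n θ x y then 0 else 1) + N * (θ * M)⁻¹) := by
          gcongr
      _ = _ := by ring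
  unfold binErr
  rw [Finset.sum_comm]
  refine (Finset.sum_le_sum fun z _ => hz z).trans ?_
  rw [Finset.sum_add_distrib, ← Finset.mul_sum, ← Finset.mul_sum, ← Finset.sum_mul,
    iidPMF_sum hp n, one_mul, ← mul_add]

/-- Chernoff bound: sequences are typical up to exponentially small probability. -/
lemma chernoff_s5 {X Y : Type*} [Fintype X] [Fintype Y] {p : X × Y → ℝ} (hp : IsPMF p)
    {γ : ℝ} (hγ : 0 < γ) :
    ∃ ρ : ℝ, 0 ≤ ρ ∧ ρ < 1 ∧ ∀ n : ℕ, ∑ z : Fin n → X × Y, iidPMF p n z *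
      (if goodSeq p n (Real.exp (-(n * (natH p + γ)))) (fun i => (z i).1) (fun i => (z i).2)
        then 0 else 1) ≤ ρ ^ n := by
  set U : X × Y → ℝ := fun z => infoD p z - (natH p + γ) with hU
  obtain ⟨B, hB1, hB⟩ : ∃ B : ℝ, 1 ≤ B ∧ ∀ z, |U z| ≤ B := by
    refine ⟨1 + ∑ z, |U z|, ?_, fun z => ?_⟩
    · have : 0 ≤ ∑ z, |U z| := Finset.sum_nonneg fun z _ => abs_nonneg _
      linarith
    · have : |U z| ≤ ∑ z, |U z| := Finset.single_le_sum (f := fun z => |U z|) (fun z _ => abs_nonneg _)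
        (Finset.mem_univ z)
      linarith
  have hB0 : 0 < B := by linarith
  set s : ℝ := min (1 / B) (γ / (2 * B ^ 2)) with hs
  have hs0 : 0 < s := lt_min (by positivity) (by positivity)
  have hs1 : s * B ≤ 1 := by
    have : s ≤ 1 / B := min_le_left _ _
    rwa [le_div_iff₀ hB0] at this
  have hs2 : s * (2 * B ^ 2) ≤ γ := by
    have : s ≤ γ / (2 * B ^ 2) := min_le_right _ _
    rwa [le_div_iff₀ (by positivity)] at this
  refine ⟨∑ z, p z * Real.exp (s * U z), ?_, ?_, ?_⟩
  · exact Finset.sum_nonneg fun z _ => mul_nonneg (hp.1 z) (Real.exp_pos _).le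
  · have hb : ∀ z, p z * Real.exp (s * U z) ≤ p z * (1 + s * U z + s ^ 2 * B ^ 2) := by
      intro z
      refine mul_le_mul_of_nonneg_left ?_ (hp.1 z)
      have ha : |s * U z| ≤ s * B := by
        rw [abs_mul, abs_of_pos hs0]
        exact mul_le_mul_of_nonneg_left (hB z) hs0.le
      have h1 := Real.abs_exp_sub_one_sub_id_le (ha.trans hs1)
      have h2 := (abs_le.1 h1).2
      have h3 : (s * U z) ^ 2 ≤ (s * B) ^ 2 := sq_le_sq' (by linarith [(abs_le.1 ha).1]) (abs_le.1 ha).2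
      nlinarith
    have hsumU : ∑ z, p z * U z = -γ := by
      simp only [hU, mul_sub, Finset.sum_sub_distrib]
      rw [← Finset.sum_mul, hp.2]
      simp [natH]
    have : ∑ z, p z * (1 + s * U z + s ^ 2 * B ^ 2) = 1 - s * γ + s ^ 2 * B ^ 2 := by
      have e : ∀ z, p z * (1 + s * U z + s ^ 2 * B ^ 2)
          = p z * (1 + s ^ 2 * B ^ 2) + s * (p z * U z) := by intro z; ring
      simp_rw [e]
      rw [Finset.sum_add_distrib, ← Finset.sum_mul, ← Finset.mul_sum, hp.2, hsumU]
      ring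
    refine (Finset.sum_le_sum fun z _ => hb z).trans_lt ?_
    rw [this]
    have : 0 < s * γ := by positivity
    nlinarith
  · intro n
    have e : (∑ z, p z * Real.exp (s * U z)) ^ n
        = ∑ z : Fin n → X × Y, iidPMF p n z * Real.exp (s * ∑ i, U (z i)) := by
      have h := sum_prod_seq (n := n) (fun _ (z : X × Y) => p z * Real.exp (s * U z))
      simp only [Finset.prod_const, Finset.card_univ, Fintype.card_fin] at h
      rw [← h]
      refine Finset.sum_congr rfl fun z _ => ?_
      rw [Finset.prod_mul_distrib, ← Real.exp_sum, ← Finset.mul_sum]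
      rfl
    rw [e]
    refine Finset.sum_le_sum fun z _ => ?_
    rcases (iidPMF_nonneg hp z).eq_or_lt with h | h
    · rw [← h]; simp
    refine mul_le_mul_of_nonneg_left ?_ h.le
    split_ifs with hg
    · exact (Real.exp_pos _).le
    · obtain ⟨hy, hl⟩ := log_ratio hp h
      unfold goodSeq at hg
      push Not at hg
      have h1 : Real.log (iidPMF p n z) < -(n * (natH p + γ))
          + Real.log (iidPMF (margY p) n fun i => (z i).2) := by
        rw [← Real.log_exp (-(n * (natH p + γ))), ← Real.log_mul (Real.exp_pos _).ne' hy.ne']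
        exact Real.log_lt_log h hg
      apply Real.one_le_exp
      refine mul_nonneg hs0.le ?_
      simp only [hU, Finset.sum_sub_distrib, Finset.sum_const, Finset.card_univ,
        Fintype.card_fin, nsmul_eq_mul]
      linarith

lemma achiev_main
    {t : ℕ} (ht : 0 < t)
    {X : Type*} [Fintype X] {Y : Fin t → Type*} [∀ l, Fintype (Y l)]
    (q : X × (∀ l, Y l) → ℝ) (hq : IsPMF q)
    (δ : Fin t → X → X → ℝ)
    (hδ0 : ∀ l x, δ l x x = 0) (m : ℝ) (hm : 0 ≤ m)
    (hH : ∀ l, natH (pOf q (fun s => (s.1, s.2 l))) ≤ Real.log 2 * m) :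
    Admissible (Xh := fun _ => X) q δ (fun _ => 0)
      (fun l => if l = (⟨0, ht⟩ : Fin t) then m else 0) := by
  refine ⟨fun l => by dsimp only; split_ifs <;> simp [hm], fun ε hε => ?_⟩
  have hlog2 : 0 < Real.log 2 := Real.log_pos (by norm_num)
  have hX : Nonempty X := by
    by_contra h
    rw [not_nonempty_iff] at h
    have := hq.2
    simp at this
  set p : ∀ l, X × Y l → ℝ := fun l => pOf q (fun s => (s.1, s.2 l)) with hpdef
  have hp : ∀ l, IsPMF (p l) := fun l => pOf_isPMF hq _
  -- maximal distortion
  obtain ⟨D, hD, hDle⟩ : ∃ D : ℝ, 0 < D ∧ ∀ l x xh, δ l x xh ≤ D := by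
    refine ⟨1 + ∑ w : Fin t × X × X, |δ w.1 w.2.1 w.2.2|, ?_, fun l x xh => ?_⟩
    · have : 0 ≤ ∑ w : Fin t × X × X, |δ w.1 w.2.1 w.2.2| :=
        Finset.sum_nonneg fun z _ => abs_nonneg _
      linarith
    · have : |δ l x xh| ≤ ∑ w : Fin t × X × X, |δ w.1 w.2.1 w.2.2| :=
        Finset.single_le_sum (f := fun w : Fin t × X × X => |δ w.1 w.2.1 w.2.2|)
          (fun z _ => abs_nonneg _) (Finset.mem_univ (l, x, xh))
      linarith [le_abs_self (δ l x xh)]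
  set γ : ℝ := Real.log 2 * ε / 4 with hγdef
  have hγ : 0 < γ := by positivity
  choose ρ hρ0 hρ1 hρ using fun l => chernoff_s5 (hp l) hγ
  have htend : Filter.Tendsto (fun n : ℕ => ∑ l, (ρ l ^ n + Real.exp (-γ) ^ n)) Filter.atTop
      (nhds (∑ l : Fin t, ((0 : ℝ) + 0))) := by
    refine tendsto_finsetSum _ fun l _ => ?_
    exact (tendsto_pow_atTop_nhds_zero_of_lt_one (hρ0 l) (hρ1 l)).add
      (tendsto_pow_atTop_nhds_zero_of_lt_one (Real.exp_pos _).le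
        (by rw [Real.exp_lt_one_iff]; linarith))
  simp only [add_zero, Finset.sum_const_zero] at htend
  have hev := htend.eventually (gt_mem_nhds (show (0 : ℝ) < ε / D by positivity))
  obtain ⟨n, hn1, hn2⟩ := (hev.and (Filter.eventually_ge_atTop (⌈2 / ε⌉₊ + 1))).exists
  have hnpos : 0 < n := by omega
  have hn' : (0 : ℝ) < n := by exact_mod_cast hnpos
  have hnε : 2 / ε ≤ n := by
    have h1 := Nat.le_ceil (2 / ε)
    have h2 : ((⌈2 / ε⌉₊ : ℕ) : ℝ) ≤ n := by exact_mod_cast (by omega : ⌈2 / ε⌉₊ ≤ n)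
    linarith
  set E : ℝ := Real.exp (n * (Real.log 2 * m + 2 * γ)) with hE
  have hE1 : 1 ≤ E := Real.one_le_exp (by positivity)
  set M : ℕ := ⌈E⌉₊ with hMdef
  have hME : E ≤ M := Nat.le_ceil E
  have hM2 : (M : ℝ) ≤ 2 * E := by
    have := Nat.ceil_lt_add_one (show 0 ≤ E by linarith)
    linarith
  have hMpos' : (0 : ℝ) < M := by linarith
  have hMpos : 0 < M := by exact_mod_cast hMpos'
  set θ : Fin t → ℝ := fun l => Real.exp (-(n * (natH (p l) + γ))) with hθ
  -- averaged error
  have havg : ∀ l, ∑ f : (Fin n → X) → Fin M, binErr (p l) n (θ l) f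
      ≤ ∑ _f : (Fin n → X) → Fin M, (ρ l ^ n + Real.exp (-γ) ^ n) := by
    intro l
    refine (binErr_avg (hp l) (Real.exp_pos _) hMpos).trans ?_
    rw [Finset.sum_const, Finset.card_univ, nsmul_eq_mul]
    refine mul_le_mul_of_nonneg_left (add_le_add (hρ l n) ?_) (Nat.cast_nonneg _)
    rw [← Real.exp_nat_mul]
    have h1 : Real.exp (n * γ) ≤ θ l * M := by
      calc Real.exp (n * γ) ≤ θ l * E := by
            rw [hθ, hE, ← Real.exp_add]
            apply Real.exp_le_exp.2
            have := mul_le_mul_of_nonneg_left (hH l) hn'.le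
            simp only [hpdef]
            linarith
        _ ≤ θ l * M := mul_le_mul_of_nonneg_left hME (Real.exp_pos _).le
    calc (θ l * M)⁻¹ ≤ (Real.exp (n * γ))⁻¹ := by
          gcongr
      _ = Real.exp (n * -γ) := by rw [← Real.exp_neg]; ring_nf
  obtain ⟨f, hf⟩ : ∃ f : (Fin n → X) → Fin M, ∑ l, binErr (p l) n (θ l) f
      ≤ ∑ l, (ρ l ^ n + Real.exp (-γ) ^ n) := by
    have : Nonempty (Fin M) := ⟨⟨0, hMpos⟩⟩
    have h := Finset.sum_le_sum (s := Finset.univ) (fun l _ => havg l)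
    rw [Finset.sum_comm, Finset.sum_comm (s := (Finset.univ : Finset (Fin t)))] at h
    obtain ⟨f, -, hf⟩ := Finset.exists_le_of_sum_le Finset.univ_nonempty h
    exact ⟨f, hf⟩
  have hbnn : ∀ l, 0 ≤ binErr (p l) n (θ l) f := fun l =>
    Finset.sum_nonneg fun z _ => mul_nonneg (iidPMF_nonneg (hp l) z) (by split_ifs <;> norm_num)
  have hfl : ∀ l, binErr (p l) n (θ l) f ≤ ε / D := fun l =>
    ((Finset.single_le_sum (fun l _ => hbnn l) (Finset.mem_univ l)).trans hf).trans hn1.le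
  refine ⟨n, hnpos, fun l => if l = (⟨0, ht⟩ : Fin t) then M else 1, ?_,
    fun x l => ⟨if l = (⟨0, ht⟩ : Fin t) then (f x).1 else 0, ?_⟩,
    fun l msg y => binDec (p l) n (θ l) f
      ⟨(msg ⟨0, ht⟩ (Nat.zero_le _)).1, by
        have := (msg ⟨0, ht⟩ (Nat.zero_le _)).2
        exact lt_of_lt_of_eq this (if_pos rfl)⟩ y, ?_, ?_⟩
  · intro l
    dsimp only
    split_ifs
    · exact hMpos
    · exact le_rfl
  · dsimp only
    split_ifs
    · exact (f x).2
    · exact one_pos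
  · intro l
    by_cases hl : l = (⟨0, ht⟩ : Fin t)
    · simp only [hl, if_true]
      rw [div_le_iff₀ hn', Real.logb, div_le_iff₀ hlog2]
      have h1 : Real.log M ≤ Real.log 2 + n * (Real.log 2 * m + 2 * γ) := by
        refine (Real.log_le_log hMpos' hM2).trans ?_
        rw [Real.log_mul (by norm_num) (by positivity), hE, Real.log_exp]
      refine h1.trans ?_
      have h2 : 2 ≤ n * ε := by rwa [div_le_iff₀ hε] at hnε
      have h3 := mul_le_mul_of_nonneg_left h2 hlog2.le
      rw [hγdef]
      linarith
    · simp only [hl, if_false]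
      simp [hε.le]
  · intro l
    simp only [if_true, Fin.eta]
    have hpush := iidPMF_push q (fun s => (s.1, s.2 l)) (n := n) (fun z => (n : ℝ)⁻¹ *
      ∑ i, δ l (z i).1 (binDec (p l) n (θ l) f (f fun i => (z i).1) (fun i => (z i).2) i))
    simp only [] at hpush
    rw [hpush, zero_add]
    calc _ ≤ ∑ z, D * (iidPMF (p l) n z *
          (if binDec (p l) n (θ l) f (f fun i => (z i).1) (fun i => (z i).2)
            = (fun i => (z i).1) then 0 else 1)) := by
          refine Finset.sum_le_sum fun z _ => ?_
          rw [mul_left_comm D]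
          refine mul_le_mul_of_nonneg_left ?_ (iidPMF_nonneg (hp l) z)
          split_ifs with h
          · rw [h]
            simp [hδ0]
          · rw [inv_mul_le_iff₀ hn', mul_one]
            refine (Finset.sum_le_sum fun i _ => hDle l _ _).trans ?_
            simp
      _ = D * binErr (p l) n (θ l) f := by
          rw [← Finset.mul_sum]; rfl
      _ ≤ D * (ε / D) := mul_le_mul_of_nonneg_left (hfl l) hD.le
      _ = ε := by field_simp

/-- **Lossless reconstruction at every decoder (Proposition 6).**  If every decoder
uses the reconstruction alphabet `𝒳` and its distortion measure vanishes exactly on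
the diagonal, then `R(0,0,…,0) = max_{l ∈ [t]} H(X | Y_l)`. -/
theorem lossless_rate_distortion
    {t : ℕ} (ht : 0 < t)
    {X : Type*} [Fintype X] {Y : Fin t → Type*} [∀ l, Fintype (Y l)]
    (q : X × (∀ l, Y l) → ℝ) (hq : IsPMF q)
    (δ : Fin t → X → X → ℝ)
    (hδ0 : ∀ l x, δ l x x = 0)
    (hδpos : ∀ l (x xh : X), xh ≠ x → 0 < δ l x xh) :
    RdFun (Xh := fun _ => X) q δ ht (fun _ => 0)
      = Finset.univ.sup' ⟨(⟨0, ht⟩ : Fin t), Finset.mem_univ _⟩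
          (fun l => condH q Prod.fst (fun ω => ω.2 l)) := by
  have hlog2 : 0 < Real.log 2 := Real.log_pos (by norm_num)
  set m := Finset.univ.sup' ⟨(⟨0, ht⟩ : Fin t), Finset.mem_univ _⟩
          (fun l => condH q Prod.fst (fun ω => ω.2 l)) with hm
  have hle : ∀ l, condH q Prod.fst (fun ω => ω.2 l) ≤ m := fun l =>
    Finset.le_sup' (fun l => condH q Prod.fst (fun ω => ω.2 l)) (Finset.mem_univ l)
  have hnat : ∀ l, natH (pOf q (fun s => (s.1, s.2 l))) ≤ Real.log 2 * m := by
    intro l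
    have := hle l
    rw [condH_eq_s5, div_le_iff₀ hlog2] at this
    linarith
  have hm0 : 0 ≤ m := by
    have h1 := hnat ⟨0, ht⟩
    have h2 := natH_nonneg (pOf_isPMF hq (fun s => (s.1, s.2 (⟨0, ht⟩ : Fin t))))
    exact nonneg_of_mul_nonneg_right (h2.trans h1) hlog2
  unfold RdFun
  apply le_antisymm
  · refine csInf_le ⟨0, fun r hr => hr.1⟩ ⟨hm0, ?_⟩
    exact achiev_main ht q hq δ hδ0 m hm0 hnat
  · refine le_csInf ⟨m, hm0, achiev_main ht q hq δ hδ0 m hm0 hnat⟩ ?_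
    rintro r ⟨-, hr⟩
    refine Finset.sup'_le _ _ fun l _ => ?_
    rw [condH_eq_s5, div_le_iff₀ hlog2, mul_comm]
    exact converse_main ht q hq δ hδ0 hδpos r hr l

end
end

section
/- Conditional typicality probability bounds (Appendix Lemma 2): Let p_XY be a pmf on a finite set 𝒳 × 𝒴 with marginals p_X, p_Y, and let Y^n be a sequence of n iid random variables with law p_Y. If 0 < ε₁ < ε₂ ≤ μ(p_XY) and x^n ∈ T_{ε₁}^{(n)}(p_X), then (1 − δ₂(n, ε₁, ε₂, μ(p_XY))) · 2^{−n(I(X;Y) + 2ε₂H(Y))} ≤ Pr[ Y^n ∈ T_{ε₂}^{(n)}(p_XY | x^n) ] ≤ 2^{−n(I(X;Y) − 2ε₂H(Y))}, where (X, Y) ∼ p_XY, and H and I are base-2 entropy and mutual information. -/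
open scoped BigOperators Classical

noncomputable section

/-- Number of occurrences of the letter `a` in the sequence `x`. -/
def Ncount {n : ℕ} {α : Type*} (x : Fin n → α) (a : α) : ℕ :=
  (Finset.univ.filter fun i => x i = a).card

/-- `x` is `ε`-letter typical with respect to the pmf `p`. -/
def LetterTypical {n : ℕ} {α : Type*} [Fintype α] (ε : ℝ) (p : α → ℝ)
    (x : Fin n → α) : Prop :=
  ∀ a, |(Ncount x a : ℝ) / n - p a| ≤ ε * p a

/-- `μ(p)`: the minimum positive mass of the pmf `p`. -/
def muMin {α : Type*} (p : α → ℝ) : ℝ :=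
  sInf {x : ℝ | (∃ a, p a = x) ∧ 0 < x}

/-- `δ₂(n, ε₁, ε₂, μ)` with alphabet-size factor `c`:
`2 c · exp(−n μ (ε₂ − ε₁)² / (1 + ε₁))`. -/
def delta2 (c n : ℕ) (ε₁ ε₂ μ : ℝ) : ℝ :=
  2 * c * Real.exp (-((n : ℝ) * μ * (ε₂ - ε₁) ^ 2 / (1 + ε₁)))


lemma log_factorial_upper (m : ℕ) :
    Real.log (m.factorial : ℝ) ≤ m * Real.log m - m + 1 + Real.log m / 2 := by
  rcases Nat.eq_zero_or_pos m with rfl | hm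
  · simp
  obtain ⟨j, rfl⟩ : ∃ j, m = j + 1 := ⟨m - 1, by omega⟩
  have h := Stirling.log_stirlingSeq'_antitone (Nat.zero_le j)
  simp only [Function.comp, Nat.succ_eq_add_one, zero_add] at h
  rw [Stirling.log_stirlingSeq_formula, Stirling.stirlingSeq_one,
    Real.log_div (Real.exp_pos 1).ne' (by positivity), Real.log_exp, Real.log_sqrt (by norm_num),
    Real.log_mul (by norm_num) (by positivity), Real.log_div (by positivity) (Real.exp_pos 1).ne',
    Real.log_exp] at h
  linarith

lemma log_factorial_upper' (m : ℕ) (z : ℝ) (hz : 0 < z) :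
    Real.log (m.factorial : ℝ) ≤ m * Real.log z - z + (z - m) ^ 2 / z + 1 + Real.log m / 2 := by
  have h := log_factorial_upper m
  have h2 : m * Real.log m - m ≤ m * Real.log z - z + (z - m) ^ 2 / z := by
    rcases Nat.eq_zero_or_pos m with rfl | hm
    · simp; field_simp; simp
    have hm' : (0:ℝ) < m := by exact_mod_cast hm
    have h3 := Real.log_le_sub_one_of_pos (div_pos hm' hz)
    rw [Real.log_div hm'.ne' hz.ne'] at h3
    have h4 : m * (Real.log m - Real.log z) ≤ m * (m / z - 1) :=
      mul_le_mul_of_nonneg_left h3 hm'.le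
    have h5 : (z - m) ^ 2 / z = z - 2 * m + m * (m / z) := by field_simp; ring
    rw [h5]; linarith
  linarith

lemma log_factorial_lower (N : ℕ) (hN : 1 ≤ N) :
    N * Real.log N - N + Real.log N / 2 + Real.log 2 ≤ Real.log (N.factorial : ℝ) := by
  have h := Stirling.le_log_factorial_stirling (n := N) (by omega)
  have h2 : 2 * Real.log 2 ≤ Real.log (2 * Real.pi) := by
    rw [← Real.log_rpow (by norm_num)]
    apply Real.log_le_log (by norm_num)
    have := Real.pi_gt_three
    norm_num; linarith
  linarith

lemma per_letter {B : Type*} [Fintype B] (N : ℕ) (hN : 1 ≤ N) (r : B → ℝ) (hr : ∀ b, 0 ≤ r b)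
    (hs : ∑ b, r b = 1) (w : B → ℝ) (ζ : ℝ) (hζ : 0 < ζ)
    (hz : ∀ b, 0 < r b → ζ ≤ N * r b) (k : ℕ) (hk : k = (Finset.univ.filter fun b => 0 < r b).card) :
    ∃ m : B → ℕ, ∑ b, m b = N ∧ (∀ b, r b = 0 → m b = 0) ∧
      (∀ b, |(m b : ℝ) - N * r b| ≤ k) ∧
      ∑ b, (m b : ℝ) * w b ≤ ∑ b, N * r b * w b ∧
      ∑ b, (m b : ℝ) * (-Real.log (r b)) -
        (k + (k - 1) / 2 * Real.log N - Real.log 2 + k * (k - 1) / ζ)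
        ≤ Real.log (N.factorial : ℝ) - ∑ b, Real.log ((m b).factorial : ℝ) := by
  set S := Finset.univ.filter fun b => 0 < r b with hS
  have hmem : ∀ b, b ∈ S ↔ 0 < r b := by simp [hS]
  have hnot : ∀ b, b ∉ S → r b = 0 := fun b hb =>
    le_antisymm (not_lt.mp (fun h => hb ((hmem b).2 h))) (hr b)
  have hsS : ∑ b ∈ S, r b = 1 := by
    rw [← hs]; exact Finset.sum_subset (Finset.subset_univ _) (fun b _ hb => hnot b hb)
  have hne : S.Nonempty := by
    rw [Finset.nonempty_iff_ne_empty]; intro h; rw [h] at hsS; simp at hsS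
  obtain ⟨bs, hbs, hmin⟩ := S.exists_min_image w hne
  have hNr : (0:ℝ) < N := by exact_mod_cast hN
  set T := S.erase bs with hT
  have hkT : (T.card : ℝ) = k - 1 := by
    rw [hT, Finset.card_erase_of_mem hbs, ← hk, Nat.cast_sub]; · simp
    rw [hk]; exact hne.card_pos
  set f : B → ℕ := fun b => ⌊(N:ℝ) * r b⌋₊ with hf
  have hf1 : ∀ b, (f b : ℝ) ≤ N * r b := fun b => Nat.floor_le (mul_nonneg hNr.le (hr b))
  have hf2 : ∀ b, N * r b - f b ≤ 1 := fun b => by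
    have := Nat.lt_floor_add_one ((N:ℝ) * r b); simp only [hf]; linarith
  have hsumT : r bs + ∑ b ∈ T, r b = 1 := by rw [hT, Finset.add_sum_erase _ _ hbs, hsS]
  have hle : ∑ b ∈ T, f b ≤ N := by
    have : (∑ b ∈ T, (f b:ℝ)) ≤ N := by
      calc (∑ b ∈ T, (f b:ℝ)) ≤ ∑ b ∈ T, N * r b := Finset.sum_le_sum fun b _ => hf1 b
        _ = N * (1 - r bs) := by rw [← Finset.mul_sum]; congr 1; linarith
        _ ≤ N := by nlinarith [hr bs]
    exact_mod_cast this
  set m : B → ℕ := fun b => if b = bs then N - ∑ b ∈ T, f b else f b with hm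
  have hmbs : (m bs : ℝ) = N - ∑ b ∈ T, (f b : ℝ) := by
    simp only [hm, if_true]; rw [Nat.cast_sub hle]; push_cast; rfl
  have hmT : ∀ b ∈ T, m b = f b := fun b hb => by
    have : b ≠ bs := (Finset.mem_erase.1 hb).1
    simp [hm, this]
  have hm0 : ∀ b, r b = 0 → m b = 0 := fun b hb => by
    have : b ≠ bs := by rintro rfl; exact absurd hb ((hmem _).1 hbs).ne'
    simp [hm, this, hf, hb]
  set d : B → ℝ := fun b => N * r b - m b with hd
  have hdT : ∀ b ∈ T, 0 ≤ d b ∧ d b ≤ 1 := fun b hb => by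
    simp only [hd, hmT b hb]; exact ⟨by linarith [hf1 b], hf2 b⟩
  have hdbs : d bs = - ∑ b ∈ T, d b := by
    have : ∑ b ∈ T, d b = N * ∑ b ∈ T, r b - ∑ b ∈ T, (f b:ℝ) := by
      rw [Finset.mul_sum, ← Finset.sum_sub_distrib]
      exact Finset.sum_congr rfl fun b hb => by simp only [hd, hmT b hb]
    rw [this]; simp only [hd]; rw [hmbs]
    have : ∑ b ∈ T, r b = 1 - r bs := by linarith
    rw [this]; ring
  have hD0 : 0 ≤ ∑ b ∈ T, d b := Finset.sum_nonneg fun b hb => (hdT b hb).1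
  have hD1 : ∑ b ∈ T, d b ≤ k - 1 := by
    rw [← hkT]
    calc _ ≤ ∑ b ∈ T, (1:ℝ) := Finset.sum_le_sum fun b hb => (hdT b hb).2
      _ = _ := by simp
  have hk1 : (1:ℝ) ≤ k := by
    have : 1 ≤ k := by rw [hk]; exact hne.card_pos
    exact_mod_cast this
  have hout : ∀ g : B → ℝ, (∀ b, b ∉ S → g b = 0) → ∑ b, g b = g bs + ∑ b ∈ T, g b := by
    intro g hg
    rw [hT, Finset.add_sum_erase _ _ hbs]
    exact (Finset.sum_subset (Finset.subset_univ _) (fun b _ hb => hg b hb)).symm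
  have hd0 : ∀ b, b ∉ S → d b = 0 := fun b hb => by
    simp [hd, hnot b hb, hm0 b (hnot b hb)]
  have hmsum : ∑ b, (m b : ℝ) = N := by
    rw [hout _ (fun b hb => by simp [hm0 b (hnot b hb)]), hmbs]
    have : ∑ b ∈ T, (m b : ℝ) = ∑ b ∈ T, (f b : ℝ) :=
      Finset.sum_congr rfl fun b hb => by rw [hmT b hb]
    rw [this]; ring
  refine ⟨m, by exact_mod_cast hmsum, hm0, ?_, ?_, ?_⟩
  · intro b
    by_cases hb : b ∈ S
    · by_cases hb2 : b = bs
      · subst hb2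
        have : (m b : ℝ) - N * r b = - d b := by simp [hd]
        rw [this, hdbs, neg_neg, abs_of_nonneg hD0]; linarith
      · have := hdT b (Finset.mem_erase.2 ⟨hb2, hb⟩)
        simp only [hd] at this
        rw [abs_le]; constructor <;> linarith
    · have := hd0 b hb
      simp only [hd] at this
      rw [abs_le]; constructor <;> linarith
  · have : 0 ≤ ∑ b, d b * w b := by
      rw [hout _ (fun b hb => by simp [hd0 b hb]), hdbs, neg_mul, Finset.sum_mul,
        neg_add_eq_sub, ← Finset.sum_sub_distrib]
      apply Finset.sum_nonneg
      intro b hb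
      have h1 := hmin b (Finset.mem_erase.1 hb).2
      have h2 := (hdT b hb).1
      nlinarith
    have h2 : ∑ b, d b * w b = ∑ b, N * r b * w b - ∑ b, (m b:ℝ) * w b := by
      rw [← Finset.sum_sub_distrib]; exact Finset.sum_congr rfl fun b _ => by simp only [hd]; ring
    linarith
  · have hlow := log_factorial_lower N hN
    have hlogN : 0 ≤ Real.log N := Real.log_nonneg (by exact_mod_cast hN)
    have hmle : ∀ b, m b ≤ N := fun b => by
      have : ∑ b, m b = N := by exact_mod_cast hmsum
      rw [← this]; exact Finset.single_le_sum (f := m) (fun _ _ => Nat.zero_le _) (Finset.mem_univ b)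
    have hterm : ∀ b ∈ S, Real.log ((m b).factorial : ℝ) ≤
        (m b * Real.log N + m b * Real.log (r b)) - N * r b + d b ^ 2 / ζ + (1 + Real.log N / 2) := by
      intro b hb
      have hrb := (hmem b).1 hb
      have hzp : 0 < N * r b := mul_pos hNr hrb
      have h1 := log_factorial_upper' (m b) (N * r b) hzp
      rw [Real.log_mul hNr.ne' hrb.ne'] at h1
      have h2 : (N * r b - m b) ^ 2 / (N * r b) ≤ d b ^ 2 / ζ := by
        simp only [hd]
        exact div_le_div_of_nonneg_left (sq_nonneg _) hζ (hz b hrb)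
      have h3 : Real.log (m b) ≤ Real.log N := by
        rcases Nat.eq_zero_or_pos (m b) with h | h
        · rw [h]; simpa using hlogN
        · exact Real.log_le_log (by exact_mod_cast h) (by exact_mod_cast hmle b)
      nlinarith
    have hsum : ∑ b, Real.log ((m b).factorial : ℝ) ≤
        ∑ b ∈ S, ((m b * Real.log N + m b * Real.log (r b)) - N * r b + d b ^ 2 / ζ
          + (1 + Real.log N / 2)) := by
      rw [← Finset.sum_subset (Finset.subset_univ S)
        (fun b _ hb => by simp [hm0 b (hnot b hb)])]
      exact Finset.sum_le_sum hterm
    have hmS : ∑ b ∈ S, (m b : ℝ) = N := by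
      rw [← hmsum]
      exact Finset.sum_subset (Finset.subset_univ S)
        (fun b _ hb => by simp [hm0 b (hnot b hb)])
    have hlS : ∑ b ∈ S, (m b : ℝ) * Real.log (r b) = ∑ b, (m b : ℝ) * Real.log (r b) :=
      Finset.sum_subset (Finset.subset_univ S)
        (fun b _ hb => by simp [hm0 b (hnot b hb)])
    have hdS : ∑ b ∈ S, d b ^ 2 ≤ k * (k - 1) := by
      rw [← Finset.add_sum_erase _ _ hbs, hdbs]
      have : ∑ b ∈ T, d b ^ 2 ≤ ∑ b ∈ T, d b := Finset.sum_le_sum fun b hb => by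
        have := hdT b hb; nlinarith
      nlinarith
    simp only [Finset.sum_add_distrib, Finset.sum_sub_distrib, ← Finset.sum_mul,
      ← Finset.mul_sum, ← Finset.sum_div, hmS, hsS, hlS, Finset.sum_const, ← hk,
      nsmul_eq_mul] at hsum
    have hdS' : (∑ b ∈ S, d b ^ 2) / ζ ≤ k * (k - 1) / ζ := by gcongr
    simp only [mul_neg, Finset.sum_neg_distrib]
    nlinarith

set_option maxHeartbeats 1000000 in
lemma numeric (n e μ t h : ℝ) (s : ℕ) (hs : 2 ≤ s) (he : 0 < e) (heμ : e ≤ μ)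
    (hsμ : s * μ ≤ 1) (ht : Real.log (2 * s) ≤ t) (hn : t ≤ n * μ * e ^ 2)
    (hh : μ * (-Real.log μ + 1 - μ) ≤ h) :
    s + (s - 1) / 2 * Real.log n - Real.log 2 + s * (s - 1) / (t / μ ^ 2) ≤ n * e * h := by
  have hμ : 0 < μ := he.trans_le heμ
  have hs' : (2:ℝ) ≤ s := by exact_mod_cast hs
  have l2 := Real.log_two_gt_d9
  have l2' := Real.log_two_lt_d9
  have ht1 : 1.386 ≤ t := by
    refine le_trans ?_ ht
    rw [Real.log_mul (by norm_num) (by positivity)]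
    have := Real.log_le_log (by norm_num) hs'
    linarith
  have htp : 0 < t := by linarith
  have hnp : 0 < n := by
    by_contra hc
    have : n * (μ * e ^ 2) ≤ 0 := mul_nonpos_of_nonpos_of_nonneg (not_lt.mp hc) (by positivity)
    linarith
  set L := -Real.log μ with hL
  have hLs : Real.log 2 ≤ L := by
    have h1 : μ ≤ 1 / 2 := by nlinarith
    have := Real.log_le_log hμ h1
    rw [one_div, Real.log_inv] at this
    linarith
  set r := n * e * μ ^ 2 / t with hr
  have hr1 : 1 ≤ r := by
    rw [hr, le_div_iff₀ htp, one_mul]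
    refine hn.trans ?_
    have : n * μ * e ^ 2 = n * e * μ * e := by ring
    rw [this]
    calc n * e * μ * e ≤ n * e * μ * μ := by gcongr
      _ = _ := by ring
  have hv : n * e = t / μ ^ 2 * r := by rw [hr]; field_simp
  have hlogn : Real.log n ≤ Real.log t + 3 * L + 2 * (r - 1) := by
    have h1 : n ≤ (n * e) ^ 2 * μ / t := by
      rw [le_div_iff₀ htp]; nlinarith
    have h2 : (n * e) ^ 2 * μ / t = t * r ^ 2 / μ ^ 3 := by rw [hv]; field_simp
    rw [h2] at h1
    have h3 := Real.log_le_log hnp h1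
    rw [Real.log_div (by positivity) (by positivity), Real.log_mul (by positivity) (by positivity),
      Real.log_pow, Real.log_pow] at h3
    have h4 := Real.log_le_sub_one_of_pos (lt_of_lt_of_le one_pos hr1)
    push_cast at h3
    linarith
  have hlogt := Real.log_le_sub_one_of_pos htp
  have hchi : s * (s - 1) / (t / μ ^ 2) ≤ (s - 1) / (s * t) := by
    have : s * (s - 1) / (t / μ ^ 2) = (s * μ) ^ 2 * ((s - 1) / (s * t)) := by field_simp
    rw [this]
    have h1 : (s * μ) ^ 2 ≤ 1 := pow_le_one₀ (by positivity) hsμ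
    have h2 : 0 ≤ ((s:ℝ) - 1) / (s * t) := div_nonneg (by linarith) (by positivity)
    nlinarith
  have hsm : (s:ℝ) ≤ 1 / μ := by rw [le_div_iff₀ hμ]; exact hsμ
  have hA : t * s * L + t * (s - 1) ≤ t / μ ^ 2 * h := by
    have h1 : t / μ ^ 2 * (μ * (L + 1 - μ)) ≤ t / μ ^ 2 * h := by gcongr
    have h2 : t / μ ^ 2 * (μ * (L + 1 - μ)) = t * ((1 / μ) * L + (1 / μ - 1)) := by
      field_simp; ring
    rw [h2] at h1
    refine le_trans ?_ h1
    have : s * L + (s - 1) ≤ 1 / μ * L + (1 / μ - 1) := by nlinarith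
    nlinarith
  have hA1 : (s:ℝ) - 1 ≤ t / μ ^ 2 * h := by
    refine le_trans ?_ hA
    have : 0 ≤ t * s * L := by have : 0 ≤ L := by linarith
                               positivity
    nlinarith
  have hB : (t / μ ^ 2 * h) + (s - 1) * (r - 1) ≤ n * e * h := by
    have : n * e * h = r * (t / μ ^ 2 * h) := by rw [hv]; ring
    rw [this]; nlinarith
  have hC : (s - 1) / 2 * Real.log n ≤ (s - 1) / 2 * (t - 1 + 3 * L + 2 * (r - 1)) :=
    mul_le_mul_of_nonneg_left (by linarith) (by linarith)
  suffices hfin : s + (s - 1) / 2 * (t - 1 + 3 * L) - Real.log 2 + (s - 1) / (s * t)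
      ≤ t * s * L + t * (s - 1) by
    nlinarith
  rcases hs.eq_or_lt with h2 | h3
  · subst h2
    have : ((2:ℕ) - 1 : ℝ) / ((2:ℕ) * t) ≤ 0.4 := by
      rw [div_le_iff₀ (by positivity)]; push_cast; linarith
    have h5 : Real.log 2 * (1.386 * 2 - 1.5) ≤ L * (t * 2 - 1.5) :=
      mul_le_mul hLs (by linarith) (by norm_num) (by linarith)
    push_cast at this ⊢
    linarith
  · have h3' : (3:ℝ) ≤ s := by exact_mod_cast h3
    have ht2 : 1.7 ≤ t := by
      refine le_trans ?_ ht
      have h4 : Real.log (2 * 2 * (3 / 2)) ≤ Real.log (2 * s) :=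
        Real.log_le_log (by norm_num) (by linarith)
      rw [Real.log_mul (by norm_num) (by norm_num), Real.log_mul (by norm_num) (by norm_num)] at h4
      have := Real.one_sub_inv_le_log_of_pos (x := 3 / 2) (by norm_num)
      norm_num at this h4
      norm_num
      linarith
    have hst : (s:ℝ) * 1.7 ≤ s * t := by gcongr
    have hst1 : ((s:ℝ) - 1) * 1.7 ≤ (s - 1) * t := mul_le_mul_of_nonneg_left ht2 (by linarith)
    have : ((s:ℝ) - 1) / (s * t) ≤ 0.6 := by
      rw [div_le_iff₀ (by positivity)]; linarith
    have h5 : Real.log 2 * (1.7 * s - 1.5 * (s - 1)) ≤ L * (t * s - 1.5 * (s - 1)) := by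
      apply mul_le_mul hLs _ _ (by linarith)
      · linarith
      · linarith
    have h6 : 0.69 * (1.7 * s - 1.5 * (s - 1)) ≤ Real.log 2 * (1.7 * s - 1.5 * ((s:ℝ) - 1)) :=
      mul_le_mul_of_nonneg_right (by linarith) (by linarith)
    linarith
lemma sum_count {n : ℕ} {α : Type*} [Fintype α] (z : Fin n → α) (g : α → ℝ) :
    ∑ i, g (z i) = ∑ c, (Ncount z c : ℝ) * g c := by
  rw [← Finset.sum_fiberwise' Finset.univ z g]
  refine Finset.sum_congr rfl fun c _ => ?_
  rw [Finset.sum_const, nsmul_eq_mul]; rfl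

lemma exists_seq {𝒳 𝒴 : Type*} [Fintype 𝒳] [Fintype 𝒴] {n : ℕ} (x : Fin n → 𝒳)
    (m : 𝒳 → 𝒴 → ℕ) (hm : ∀ a, ∑ b, m a b = Ncount x a) :
    ∃ y : Fin n → 𝒴, ∀ a b, Ncount (fun i => (x i, y i)) (a, b) = m a b := by
  have he : ∀ a, Nonempty ({i // x i = a} ≃ (Σ b, Fin (m a b))) := fun a => by
    rw [← Fintype.card_eq]
    simp only [Fintype.card_sigma, Fintype.card_fin, hm, Ncount]
    rw [Fintype.card_subtype]
  let e' : ∀ a, {i // x i = a} ≃ (Σ b, Fin (m a b)) := fun a => (he a).some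
  refine ⟨fun i => (e' (x i) ⟨i, rfl⟩).1, fun a b => ?_⟩
  have h1 : Ncount (fun i => (x i, (e' (x i) ⟨i, rfl⟩).1)) (a, b)
      = Fintype.card {j : {i // x i = a} // (e' a j).1 = b} := by
    unfold Ncount
    rw [← Fintype.card_subtype]
    refine Fintype.card_congr ⟨fun i => ⟨⟨i.1, (Prod.ext_iff.1 i.2).1⟩, ?_⟩,
      fun j => ⟨j.1.1, ?_⟩, fun i => rfl, fun j => rfl⟩
    · obtain ⟨i, hi⟩ := i
      obtain ⟨h1, h2⟩ := Prod.ext_iff.1 hi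
      simp only at h1 h2
      subst h1
      exact h2
    · obtain ⟨⟨i, hi⟩, hj⟩ := j
      subst hi
      simp only [Prod.mk.injEq, true_and]
      exact hj
  rw [h1]
  have h2 : Fintype.card {j : {i // x i = a} // (e' a j).1 = b}
      = Fintype.card {σ : (Σ b, Fin (m a b)) // σ.1 = b} :=
    Fintype.card_congr ((e' a).subtypeEquiv fun _ => Iff.rfl)
  rw [h2, Fintype.card_congr (Equiv.sigmaSubtype b), Fintype.card_fin]

lemma class_bound {𝒳 𝒴 : Type*} [Fintype 𝒳] [Fintype 𝒴] {n : ℕ} (x : Fin n → 𝒳)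
    (m : 𝒳 → 𝒴 → ℕ) (hm : ∀ a, ∑ b, m a b = Ncount x a) :
    ∃ C : Finset (Fin n → 𝒴), (∀ y ∈ C, ∀ a b, Ncount (fun i => (x i, y i)) (a, b) = m a b) ∧
      ∏ a, (Ncount x a).factorial ≤ (∏ a, ∏ b, (m a b).factorial) * C.card := by
  obtain ⟨y, hy⟩ := exists_seq x m hm
  let G : Finset (Equiv.Perm (Fin n)) := Finset.univ.filter fun g => x ∘ g = x
  have hG : G.card = ∏ a, (Ncount x a).factorial := by
    have := DomMulAct.stabilizer_card x
    rw [Fintype.card_subtype] at this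
    rw [this]
    refine Finset.prod_congr rfl fun a _ => ?_
    rw [Fintype.card_subtype]; rfl
  let z : Fin n → 𝒳 × 𝒴 := fun i => (x i, y i)
  let K : Finset (Equiv.Perm (Fin n)) := Finset.univ.filter fun g => z ∘ g = z
  have hK : K.card = ∏ a, ∏ b, (m a b).factorial := by
    have := DomMulAct.stabilizer_card z
    rw [Fintype.card_subtype] at this
    rw [this, Fintype.prod_prod_type]
    refine Finset.prod_congr rfl fun a _ => Finset.prod_congr rfl fun b _ => ?_
    rw [Fintype.card_subtype, ← hy a b]; unfold Ncount; congr
  refine ⟨G.image fun g : Equiv.Perm (Fin n) => y ∘ g, ?_, ?_⟩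
  · intro y' hy' a b
    obtain ⟨g, hg, rfl⟩ := Finset.mem_image.1 hy'
    have hg' : x ∘ g = x := (Finset.mem_filter.1 hg).2
    rw [← hy a b]
    unfold Ncount
    refine Finset.card_bij (fun i _ => g i) ?_ (fun _ _ _ _ h => g.injective h) ?_
    · intro i hi
      simp only [Finset.mem_filter, Finset.mem_univ, true_and] at hi
      have h := hi
      have h3 : x (g i) = x i := congrFun hg' i
      simp only [Finset.mem_filter, Finset.mem_univ, true_and]
      rw [h3]; exact h
    · intro j hj
      simp only [Finset.mem_filter, Finset.mem_univ, true_and] at hj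
      have h := hj
      refine ⟨g.symm j, ?_, by simp⟩
      have h3 : x (g (g.symm j)) = x (g.symm j) := congrFun hg' _
      simp only [Finset.mem_filter, Finset.mem_univ, true_and, Function.comp]
      rw [← h3]; simpa using h
  · rw [← hG, ← hK]
    refine Finset.card_le_mul_card_image G _ ?_
    intro y' hy'
    obtain ⟨g0, hg0, rfl⟩ := Finset.mem_image.1 hy'
    have hg0' : x ∘ g0 = x := (Finset.mem_filter.1 hg0).2
    refine Finset.card_le_card_of_injOn (fun g => g * g0⁻¹) ?_ (fun _ _ _ _ h => mul_right_cancel h)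
    intro g hg
    obtain ⟨h1, h2⟩ := Finset.mem_filter.1 hg
    have h1' : x ∘ g = x := (Finset.mem_filter.1 h1).2
    simp only [K, Finset.coe_filter, Finset.mem_univ, true_and, Set.mem_ofPred_eq]
    funext i
    have e1 : x (g (g0⁻¹ i)) = x (g0⁻¹ i) := congrFun h1' _
    have e2 : x (g0 (g0⁻¹ i)) = x (g0⁻¹ i) := congrFun hg0' _
    have e3 : y (g (g0⁻¹ i)) = y (g0 (g0⁻¹ i)) := congrFun h2 _
    have e4 : g0 (g0⁻¹ i) = i := by simp
    simp only [z, Function.comp, Equiv.Perm.mul_apply]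
    rw [e3, e1, ← e2, e4]

/-- log of joint over product of marginals -/
def Wfun {𝒳 𝒴 : Type*} [Fintype 𝒳] [Fintype 𝒴] (p : 𝒳 × 𝒴 → ℝ) (a : 𝒳) (b : 𝒴) : ℝ :=
  Real.log (p (a, b)) - Real.log (∑ b, p (a, b)) - Real.log (∑ a, p (a, b))

def Inat {𝒳 𝒴 : Type*} [Fintype 𝒳] [Fintype 𝒴] (p : 𝒳 × 𝒴 → ℝ) : ℝ :=
  ∑ a, ∑ b, p (a, b) * Wfun p a b

def Hnat {𝒳 𝒴 : Type*} [Fintype 𝒳] [Fintype 𝒴] (p : 𝒳 × 𝒴 → ℝ) : ℝ :=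
  -∑ b, (∑ a, p (a, b)) * Real.log (∑ a, p (a, b))

section
variable {𝒳 𝒴 : Type*} [Fintype 𝒳] [Fintype 𝒴] (p : 𝒳 × 𝒴 → ℝ)

lemma pOf_fst (a : 𝒳) : pOf p Prod.fst a = ∑ b, p (a, b) := by
  unfold pOf
  rw [Fintype.sum_prod_type, Finset.sum_eq_single a]
  · simp
  · intro b _ hb; simp [hb]
  · simp

lemma pOf_snd (b : 𝒴) : pOf p Prod.snd b = ∑ a, p (a, b) := by
  unfold pOf
  rw [Fintype.sum_prod_type]
  refine Finset.sum_congr rfl fun a _ => ?_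
  simp

lemma pOf_pair (c : 𝒳 × 𝒴) : pOf p (fun ω => (ω.1, ω.2)) c = p c := by
  unfold pOf
  simp

lemma H2_snd : H2 p Prod.snd * Real.log 2 = Hnat p := by
  unfold H2 Hnat
  rw [neg_mul, Finset.sum_mul]
  congr 1
  refine Finset.sum_congr rfl fun b _ => ?_
  rw [pOf_snd, Real.logb, mul_assoc, div_mul_cancel₀ _ (Real.log_pos (by norm_num)).ne']

lemma MI_eq : MI p Prod.fst Prod.snd * Real.log 2 = Inat p := by
  have h1 : H2 p Prod.fst * Real.log 2 = -∑ a, ∑ b, p (a, b) * Real.log (∑ b, p (a, b)) := by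
    unfold H2
    rw [neg_mul, Finset.sum_mul]
    congr 1
    refine Finset.sum_congr rfl fun b _ => ?_
    rw [pOf_fst, Real.logb, mul_assoc, div_mul_cancel₀ _ (Real.log_pos (by norm_num)).ne',
      Finset.sum_mul]
  have h2 : H2 p Prod.snd * Real.log 2 = -∑ a, ∑ b, p (a, b) * Real.log (∑ a, p (a, b)) := by
    rw [H2_snd, Hnat, Finset.sum_comm]
    congr 1
    refine Finset.sum_congr rfl fun b _ => ?_
    rw [Finset.sum_mul]
  have h3 : H2 p (fun ω => (ω.1, ω.2)) * Real.log 2 = -∑ a, ∑ b, p (a, b) * Real.log (p (a, b)) := by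
    unfold H2
    rw [neg_mul, Finset.sum_mul, Fintype.sum_prod_type]
    congr 1
    refine Finset.sum_congr rfl fun a _ => Finset.sum_congr rfl fun b _ => ?_
    rw [pOf_pair, Real.logb, mul_assoc, div_mul_cancel₀ _ (Real.log_pos (by norm_num)).ne']
  unfold MI Inat Wfun
  rw [sub_mul, add_mul, h1, h2, h3]
  simp only [mul_sub, Finset.sum_sub_distrib]
  ring

variable {p}

lemma le_P (hp : IsPMF p) (a : 𝒳) (b : 𝒴) : p (a, b) ≤ ∑ b, p (a, b) :=
  Finset.single_le_sum (f := fun b => p (a, b)) (fun b _ => hp.1 (a, b)) (Finset.mem_univ b)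

lemma le_Q (hp : IsPMF p) (a : 𝒳) (b : 𝒴) : p (a, b) ≤ ∑ a, p (a, b) :=
  Finset.single_le_sum (f := fun a => p (a, b)) (fun a _ => hp.1 (a, b)) (Finset.mem_univ a)

lemma sum_P (hp : IsPMF p) : ∑ a, ∑ b, p (a, b) = 1 := by rw [← Fintype.sum_prod_type]; exact hp.2

lemma sum_Q (hp : IsPMF p) : ∑ b, ∑ a, p (a, b) = 1 := by rw [Finset.sum_comm]; exact sum_P hp

lemma Q_nonneg (hp : IsPMF p) (b : 𝒴) : 0 ≤ ∑ a, p (a, b) := Finset.sum_nonneg fun _ _ => hp.1 _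

lemma P_nonneg (hp : IsPMF p) (a : 𝒳) : 0 ≤ ∑ b, p (a, b) := Finset.sum_nonneg fun _ _ => hp.1 _

lemma Q_le_one (hp : IsPMF p) (b : 𝒴) : ∑ a, p (a, b) ≤ 1 := by
  rw [← sum_Q hp]
  exact Finset.single_le_sum (f := fun b => ∑ a, p (a, b)) (fun b _ => Q_nonneg hp b)
    (Finset.mem_univ b)

lemma D_nonneg (hp : IsPMF p) (a : 𝒳) : 0 ≤ ∑ b, p (a, b) * Wfun p a b := by
  have h : ∀ b, p (a, b) - (∑ b, p (a, b)) * (∑ a, p (a, b)) ≤ p (a, b) * Wfun p a b := by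
    intro b
    have hP := P_nonneg hp a
    have hQ := Q_nonneg hp b
    rcases (hp.1 (a, b)).eq_or_lt with h0 | h0
    · rw [← h0]; simp only [zero_mul, zero_sub, Left.neg_nonpos_iff]; positivity
    · have hP' := h0.trans_le (le_P hp a b)
      have hQ' := h0.trans_le (le_Q hp a b)
      have h1 := Real.one_sub_inv_le_log_of_pos (div_pos (div_pos h0 hP') hQ')
      rw [Real.log_div (by positivity) hQ'.ne', Real.log_div h0.ne' hP'.ne'] at h1
      have h2 := mul_le_mul_of_nonneg_left h1 h0.le
      unfold Wfun
      refine le_trans (le_of_eq ?_) h2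
      field_simp
  refine le_trans (le_of_eq ?_) (Finset.sum_le_sum fun b _ => h b)
  rw [Finset.sum_sub_distrib, ← Finset.mul_sum, sum_Q hp]; simp

lemma I_nonneg (hp : IsPMF p) : 0 ≤ Inat p := Finset.sum_nonneg fun a _ => D_nonneg hp a

lemma Hnat_eq (hp : IsPMF p) : Hnat p = ∑ a, ∑ b, p (a, b) * (-Real.log (∑ a, p (a, b))) := by
  rw [Hnat, Finset.sum_comm, ← Finset.sum_neg_distrib]
  refine Finset.sum_congr rfl fun b _ => ?_
  rw [← Finset.sum_mul]; ring

lemma H_nonneg (hp : IsPMF p) : 0 ≤ Hnat p := by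
  rw [Hnat, ← Finset.sum_neg_distrib]
  refine Finset.sum_nonneg fun b _ => ?_
  have := Real.log_nonpos (Q_nonneg hp b) (Q_le_one hp b)
  nlinarith [Q_nonneg hp b]

lemma cond_eq (hp : IsPMF p) : Hnat p - Inat p =
    ∑ a, ∑ b, p (a, b) * (Real.log (∑ b, p (a, b)) - Real.log (p (a, b))) := by
  rw [Hnat_eq hp, Inat, ← Finset.sum_sub_distrib]
  refine Finset.sum_congr rfl fun a _ => ?_
  rw [← Finset.sum_sub_distrib]
  refine Finset.sum_congr rfl fun b _ => ?_
  unfold Wfun; ring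

lemma I_le_H (hp : IsPMF p) : Inat p ≤ Hnat p := by
  have : 0 ≤ Hnat p - Inat p := by
    rw [cond_eq hp]
    refine Finset.sum_nonneg fun a _ => Finset.sum_nonneg fun b _ => ?_
    rcases (hp.1 (a, b)).eq_or_lt with h0 | h0
    · simp [← h0]
    · have := Real.log_le_log h0 (le_P hp a b)
      exact mul_nonneg h0.le (by linarith)
  linarith

lemma abs_W (hp : IsPMF p) : ∑ a, ∑ b, p (a, b) * |Wfun p a b| ≤ 2 * Hnat p := by
  have h1 : ∑ a, ∑ b, p (a, b) * |Wfun p a b| ≤ Hnat p + (Hnat p - Inat p) := by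
    rw [cond_eq hp, Hnat_eq hp, ← Finset.sum_add_distrib]
    refine Finset.sum_le_sum fun a _ => ?_
    rw [← Finset.sum_add_distrib]
    refine Finset.sum_le_sum fun b _ => ?_
    rw [← mul_add]
    rcases (hp.1 (a, b)).eq_or_lt with h0 | h0
    · simp [← h0]
    · refine mul_le_mul_of_nonneg_left ?_ h0.le
      have h2 := Real.log_le_log h0 (le_P hp a b)
      have h3 := Real.log_nonpos (Q_nonneg hp b) (Q_le_one hp b)
      unfold Wfun
      rw [abs_le]; constructor <;> linarith
  linarith [I_nonneg hp]

lemma typical_pos (hp : IsPMF p) {n : ℕ} {α : Type*} [Fintype α] {ε : ℝ} {q : α → ℝ} (hq : ∀ a, 0 ≤ q a)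
    {z : Fin n → α} (hz : LetterTypical ε q z) (i : Fin n) : 0 < q (z i) := by
  by_contra hc
  have h0 : q (z i) = 0 := le_antisymm (not_lt.mp hc) (hq _)
  have h := hz (z i)
  rw [h0] at h
  simp only [sub_zero, mul_zero] at h
  have hn : (0:ℝ) < n := by exact_mod_cast i.pos
  have hN : 0 < Ncount z (z i) := Finset.card_pos.2 ⟨i, by simp⟩
  have : 0 < (Ncount z (z i) : ℝ) / n := div_pos (by exact_mod_cast hN) hn
  rw [abs_of_pos this] at h
  linarith

lemma upper_bound (hp : IsPMF p) (n : ℕ) (ε : ℝ) (hε : 0 ≤ ε) (x : Fin n → 𝒳) :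
    (∑ y : Fin n → 𝒴, (∏ i, ∑ a, p (a, y i))
          * (if LetterTypical ε p (fun i => (x i, y i)) then 1 else 0))
      ≤ Real.exp (-(n * (Inat p - 2 * ε * Hnat p))) := by
  have key : ∀ y : Fin n → 𝒴, (∏ i, ∑ a, p (a, y i))
          * (if LetterTypical ε p (fun i => (x i, y i)) then 1 else 0) ≤
      Real.exp (-(n * (Inat p - 2 * ε * Hnat p))) * ∏ i, (p (x i, y i) / ∑ b, p (x i, b)) := by
    intro y
    have hnn : 0 ≤ ∏ i, (p (x i, y i) / ∑ b, p (x i, b)) :=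
      Finset.prod_nonneg fun i _ => div_nonneg (hp.1 _) (P_nonneg hp _)
    split_ifs with hT
    · rw [mul_one]
      have hpos := fun i => typical_pos hp hp.1 hT i
      have h1 : ∏ i, ∑ a, p (a, y i) = Real.exp (-∑ i, Wfun p (x i) (y i)) *
          ∏ i, (p (x i, y i) / ∑ b, p (x i, b)) := by
        rw [← Finset.sum_neg_distrib, Real.exp_sum, ← Finset.prod_mul_distrib]
        refine Finset.prod_congr rfl fun i _ => ?_
        have h0 := hpos i
        have hP' := h0.trans_le (le_P hp (x i) (y i))
        have hQ' := h0.trans_le (le_Q hp (x i) (y i))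
        unfold Wfun
        rw [neg_sub, sub_sub_eq_add_sub, Real.exp_sub, Real.exp_add, Real.exp_log h0,
          Real.exp_log hP', Real.exp_log hQ']
        field_simp
      rw [h1]
      refine mul_le_mul_of_nonneg_right (Real.exp_le_exp.2 (neg_le_neg ?_)) hnn
      rcases Nat.eq_zero_or_pos n with rfl | hn
      · simp
      have hn' : (0:ℝ) < n := by exact_mod_cast hn
      have h2 := sum_count (fun i => (x i, y i)) (fun c => Wfun p c.1 c.2)
      simp only at h2
      rw [h2, Fintype.sum_prod_type]
      have h3 : ∀ a b, n * (p (a, b) * Wfun p a b) - n * ε * (p (a, b) * |Wfun p a b|) ≤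
          (Ncount (fun i => (x i, y i)) (a, b) : ℝ) * Wfun p a b := by
        intro a b
        have h4 := hT (a, b)
        set N := (Ncount (fun i => (x i, y i)) (a, b) : ℝ)
        have h5 : |N - n * p (a, b)| ≤ n * (ε * p (a, b)) := by
          have : N - n * p (a, b) = n * (N / n - p (a, b)) := by field_simp
          rw [this, abs_mul, abs_of_pos hn']
          exact mul_le_mul_of_nonneg_left h4 hn'.le
        have h6 : |(N - n * p (a, b)) * Wfun p a b| ≤ n * (ε * p (a, b)) * |Wfun p a b| := by
          rw [abs_mul]; exact mul_le_mul_of_nonneg_right h5 (abs_nonneg _)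
        have := (abs_le.1 h6).1
        linarith
      refine le_trans ?_ (Finset.sum_le_sum fun a _ => Finset.sum_le_sum fun b _ => h3 a b)
      simp only [Finset.sum_sub_distrib, ← Finset.mul_sum]
      have h7 := abs_W hp
      have h8 := mul_le_mul_of_nonneg_left h7 (mul_nonneg hn'.le hε)
      unfold Inat
      linarith
    · rw [mul_zero]; positivity
  refine (Finset.sum_le_sum fun y _ => key y).trans ?_
  rw [← Finset.mul_sum]
  have h1 : ∑ y : Fin n → 𝒴, ∏ i, (p (x i, y i) / ∑ b, p (x i, b)) ≤ 1 := by
    have h2 := Finset.prod_univ_sum (fun _ : Fin n => (Finset.univ : Finset 𝒴))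
      (fun i b => p (x i, b) / ∑ b, p (x i, b))
    rw [Fintype.piFinset_univ] at h2
    rw [← h2]
    refine Finset.prod_le_one (fun i _ => Finset.sum_nonneg fun b _ =>
      div_nonneg (hp.1 _) (P_nonneg hp _)) fun i _ => ?_
    rw [← Finset.sum_div]
    exact div_self_le_one _
  have := mul_le_mul_of_nonneg_left h1 (Real.exp_pos (-(n * (Inat p - 2 * ε * Hnat p)))).le
  simpa using this

lemma mu_le (c : 𝒳 × 𝒴) (hc : 0 < p c) : muMin p ≤ p c :=
  csInf_le ⟨0, fun _ h => h.2.le⟩ ⟨⟨c, rfl⟩, hc⟩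

lemma entropy_lower (hp : IsPMF p) (hμ : 0 < muMin p) (hQ : ∀ b, ∑ a, p (a, b) ≠ 1) :
    muMin p * (-Real.log (muMin p) + 1 - muMin p) ≤ Hnat p ∧
    2 ≤ (Finset.univ.filter fun c => 0 < p c).card := by
  have hQmu : ∀ b, 0 < ∑ a, p (a, b) → muMin p ≤ ∑ a, p (a, b) := by
    intro b hb
    obtain ⟨a, _, ha⟩ := Finset.exists_lt_of_sum_lt (s := Finset.univ) (f := fun _ : 𝒳 => (0:ℝ))
      (g := fun a => p (a, b)) (by simpa using hb)
    exact (mu_le _ ha).trans (le_Q hp a b)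
  obtain ⟨b0, _, hb0⟩ := Finset.exists_lt_of_sum_lt (s := Finset.univ) (f := fun _ : 𝒴 => (0:ℝ))
      (g := fun b => ∑ a, p (a, b)) (by simp [sum_Q hp])
  have hsplit : ∑ a, p (a, b0) + ∑ b ∈ Finset.univ.erase b0, ∑ a, p (a, b) = 1 := by
    rw [Finset.add_sum_erase _ (fun b => ∑ a, p (a, b)) (Finset.mem_univ b0)]; exact sum_Q hp
  have hlt : ∑ a, p (a, b0) < 1 := lt_of_le_of_ne (Q_le_one hp b0) (hQ b0)
  obtain ⟨b1, hb1m, hb1⟩ := Finset.exists_lt_of_sum_lt (s := Finset.univ.erase b0)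
      (f := fun _ : 𝒴 => (0:ℝ)) (g := fun b => ∑ a, p (a, b)) (by rw [Finset.sum_const_zero]; linarith)
  have hb1n : b1 ≠ b0 := (Finset.mem_erase.1 hb1m).1
  set q := ∑ a, p (a, b0) with hq
  have hq1 : muMin p ≤ q := hQmu b0 hb0
  have hrest : ∀ b ∈ Finset.univ.erase b0, ∑ a, p (a, b) ≤ 1 - q := by
    intro b hb
    have := Finset.single_le_sum (f := fun b => ∑ a, p (a, b)) (fun b _ => Q_nonneg hp b) hb
    linarith
  have hq2 : muMin p ≤ 1 - q := (hQmu b1 hb1).trans (hrest b1 hb1m)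
  constructor
  · have h1 : Real.binEntropy q ≤ Hnat p := by
      rw [Real.binEntropy_eq_negMulLog_add_negMulLog_one_sub, Hnat,
        ← Finset.add_sum_erase _ _ (Finset.mem_univ b0), neg_add]
      refine add_le_add (by rw [Real.negMulLog, ← hq]; linarith) ?_
      rw [← Finset.sum_neg_distrib]
      have : Real.negMulLog (1 - q) = ∑ b ∈ Finset.univ.erase b0,
          -((∑ a, p (a, b)) * Real.log (1 - q)) := by
        rw [Finset.sum_neg_distrib, ← Finset.sum_mul, Real.negMulLog]
        have : ∑ b ∈ Finset.univ.erase b0, ∑ a, p (a, b) = 1 - q := by linarith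
        rw [this]; ring
      rw [this]
      refine Finset.sum_le_sum fun b hb => neg_le_neg ?_
      rcases (Q_nonneg hp b).eq_or_lt with h0 | h0
      · rw [← h0]; simp
      · exact mul_le_mul_of_nonneg_left (Real.log_le_log h0 (hrest b hb)) h0.le
    have h2 : Real.binEntropy (muMin p) ≤ Real.binEntropy q := by
      rcases le_total q 2⁻¹ with h | h
      · exact Real.binEntropy_strictMonoOn.monotoneOn ⟨hμ.le, by linarith⟩ ⟨by linarith, h⟩ hq1
      · rw [← Real.binEntropy_one_sub q]
        have h3 : 1 - q ≤ 2⁻¹ := by norm_num at h ⊢; linarith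
        exact Real.binEntropy_strictMonoOn.monotoneOn ⟨hμ.le, by linarith⟩ ⟨by linarith, h3⟩ hq2
    refine le_trans ?_ (h2.trans h1)
    rw [Real.binEntropy_eq_negMulLog_add_negMulLog_one_sub, Real.negMulLog, Real.negMulLog]
    have h4 : 0 < 1 - muMin p := by linarith
    have h5 := Real.log_le_sub_one_of_pos h4
    nlinarith
  · obtain ⟨a0, _, ha0⟩ := Finset.exists_lt_of_sum_lt (s := Finset.univ) (f := fun _ : 𝒳 => (0:ℝ))
      (g := fun a => p (a, b0)) (by simpa using hb0)
    obtain ⟨a1, _, ha1⟩ := Finset.exists_lt_of_sum_lt (s := Finset.univ) (f := fun _ : 𝒳 => (0:ℝ))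
      (g := fun a => p (a, b1)) (by simpa using hb1)
    have : 1 < (Finset.univ.filter fun c => 0 < p c).card := by
      rw [Finset.one_lt_card]
      refine ⟨(a0, b0), by simpa using ha0, (a1, b1), by simpa using ha1, ?_⟩
      intro h; exact hb1n (Prod.ext_iff.1 h).2.symm
    exact this
end

lemma lower_finish {𝒳 𝒴 : Type*} [Fintype 𝒳] [Fintype 𝒴] {p : 𝒳 × 𝒴 → ℝ} (hp : IsPMF p)
    (n : ℕ) (hn : 0 < n) (ε : ℝ) (x : Fin n → 𝒳) (m : 𝒳 → 𝒴 → ℕ)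
    (hm : ∀ a, ∑ b, m a b = Ncount x a)
    (ht : ∀ a b, |(m a b : ℝ) - n * p (a, b)| ≤ n * (ε * p (a, b))) (L : ℝ)
    (hL : L ≤ ∑ a, Real.log (Ncount x a).factorial - ∑ a, ∑ b, Real.log (m a b).factorial
      + ∑ a, ∑ b, (m a b : ℝ) * Real.log (∑ a, p (a, b))) :
    Real.exp L ≤ ∑ y : Fin n → 𝒴, (∏ i, ∑ a, p (a, y i))
          * (if LetterTypical ε p (fun i => (x i, y i)) then 1 else 0) := by
  obtain ⟨C, hC, hcard⟩ := class_bound x m hm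
  have hn' : (0:ℝ) < n := by exact_mod_cast hn
  have hT : ∀ y ∈ C, LetterTypical ε p (fun i => (x i, y i)) := by
    rintro y hy ⟨a, b⟩
    rw [hC y hy a b]
    have : (m a b : ℝ) / n - p (a, b) = (m a b - n * p (a, b)) / n := by field_simp
    rw [this, abs_div, abs_of_pos hn', div_le_iff₀ hn']
    linarith [ht a b]
  have h1 : ∀ y ∈ C, (∏ i, ∑ a, p (a, y i))
          * (if LetterTypical ε p (fun i => (x i, y i)) then (1:ℝ) else 0)
        = Real.exp (∑ a, ∑ b, (m a b : ℝ) * Real.log (∑ a, p (a, b))) := by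
    intro y hy
    rw [if_pos (hT y hy), mul_one]
    have hpos := fun i => typical_pos hp hp.1 (hT y hy) i
    have h2 := sum_count (fun i => (x i, y i)) (fun c => Real.log (∑ a, p (a, c.2)))
    rw [Fintype.sum_prod_type] at h2
    simp only [hC y hy] at h2
    rw [← h2, Real.exp_sum]
    refine Finset.prod_congr rfl fun i _ => ?_
    rw [Real.exp_log ((hpos i).trans_le (le_Q hp (x i) (y i)))]
  have h2 : (C.card : ℝ) * Real.exp (∑ a, ∑ b, (m a b : ℝ) * Real.log (∑ a, p (a, b))) ≤
      ∑ y : Fin n → 𝒴, (∏ i, ∑ a, p (a, y i))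
          * (if LetterTypical ε p (fun i => (x i, y i)) then 1 else 0) := by
    rw [← nsmul_eq_mul, ← Finset.sum_const, ← Finset.sum_congr rfl h1]
    refine Finset.sum_le_sum_of_subset_of_nonneg (Finset.subset_univ _) fun y _ _ => ?_
    refine mul_nonneg (Finset.prod_nonneg fun i _ => Q_nonneg hp _) ?_
    split_ifs <;> norm_num
  refine le_trans ?_ h2
  refine (Real.exp_le_exp.2 hL).trans ?_
  rw [Real.exp_add]
  refine mul_le_mul_of_nonneg_right ?_ (Real.exp_pos _).le
  have e1 : Real.exp (∑ a, Real.log (Ncount x a).factorial) = ∏ a, ((Ncount x a).factorial : ℝ) := by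
    rw [Real.exp_sum]
    refine Finset.prod_congr rfl fun a _ => Real.exp_log (by exact_mod_cast Nat.factorial_pos _)
  have e2 : Real.exp (∑ a, ∑ b, Real.log (m a b).factorial) = ∏ a, ∏ b, ((m a b).factorial : ℝ) := by
    rw [Real.exp_sum]
    refine Finset.prod_congr rfl fun a _ => ?_
    rw [Real.exp_sum]
    refine Finset.prod_congr rfl fun b _ => Real.exp_log (by exact_mod_cast Nat.factorial_pos _)
  rw [Real.exp_sub, e1, e2, div_le_iff₀ (by
    refine Finset.prod_pos fun a _ => Finset.prod_pos fun b _ => ?_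
    exact_mod_cast Nat.factorial_pos _), mul_comm]
  exact_mod_cast hcard

lemma const_case {𝒳 𝒴 : Type*} [Fintype 𝒳] [Fintype 𝒴] {p : 𝒳 × 𝒴 → ℝ} (hp : IsPMF p)
    (n : ℕ) (ε₁ ε₂ : ℝ) (h12 : ε₁ < ε₂) (x : Fin n → 𝒳)
    (hx : LetterTypical ε₁ (fun a => ∑ b, p (a, b)) x) (b0 : 𝒴) (hb0 : ∑ a, p (a, b0) = 1) :
    1 ≤ ∑ y : Fin n → 𝒴, (∏ i, ∑ a, p (a, y i))
          * (if LetterTypical ε₂ p (fun i => (x i, y i)) then 1 else 0) := by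
  have hz : ∀ a b, b ≠ b0 → p (a, b) = 0 := by
    intro a b hb
    have h1 : ∑ a, p (a, b0) + ∑ b ∈ Finset.univ.erase b0, ∑ a, p (a, b) = 1 := by
      rw [Finset.add_sum_erase _ (fun b => ∑ a, p (a, b)) (Finset.mem_univ b0)]; exact sum_Q hp
    have h2 := Finset.single_le_sum (f := fun b => ∑ a, p (a, b)) (fun b _ => Q_nonneg hp b)
      (Finset.mem_erase.2 ⟨hb, Finset.mem_univ b⟩)
    have h3 := le_Q hp a b
    have h4 := hp.1 (a, b)
    linarith
  have hP : ∀ a, ∑ b, p (a, b) = p (a, b0) := fun a =>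
    Finset.sum_eq_single b0 (fun b _ hb => hz a b hb) (by simp)
  have hT : LetterTypical ε₂ p (fun i => (x i, b0)) := by
    rintro ⟨a, b⟩
    by_cases hb : b = b0
    · subst hb
      have h1 := hx a
      simp only [hP] at h1
      have h2 : Ncount (fun i => (x i, b)) (a, b) = Ncount x a := by
        unfold Ncount; simp
      rw [h2]
      exact h1.trans (mul_le_mul_of_nonneg_right h12.le (hp.1 _))
    · rw [hz a b hb]
      have h2 : Ncount (fun i => (x i, b0)) (a, b) = 0 := by
        unfold Ncount; simp [Ne.symm hb]
      simp [h2]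
  have h1 := Finset.single_le_sum (f := fun y : Fin n → 𝒴 => (∏ i, ∑ a, p (a, y i))
          * (if LetterTypical ε₂ p (fun i => (x i, y i)) then (1:ℝ) else 0)) (fun y _ => by
    refine mul_nonneg (Finset.prod_nonneg fun i _ => Q_nonneg hp _) ?_
    split_ifs <;> norm_num) (Finset.mem_univ (fun _ => b0))
  simpa [hT, hb0] using h1

lemma cost_sum {α : Type*} (A : Finset α) (hA : A.Nonempty) (k N : α → ℕ)
    (hk : ∀ a ∈ A, 1 ≤ k a) (s n : ℕ) (hs : ∑ a ∈ A, k a = s) (hN : ∀ a ∈ A, 1 ≤ N a ∧ N a ≤ n)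
    (ζ : ℝ) (hζ : 0 < ζ) :
    ∑ a ∈ A, ((k a : ℝ) + ((k a : ℝ) - 1) / 2 * Real.log (N a) - Real.log 2
      + (k a : ℝ) * ((k a : ℝ) - 1) / ζ) ≤
    (s : ℝ) + ((s : ℝ) - 1) / 2 * Real.log n - Real.log 2 + (s : ℝ) * ((s : ℝ) - 1) / ζ := by
  have hs' : ∑ a ∈ A, (k a : ℝ) = s := by exact_mod_cast hs
  have hc : (1:ℝ) ≤ A.card := by exact_mod_cast hA.card_pos
  obtain ⟨a0, ha0⟩ := hA
  have hn : (1:ℝ) ≤ n := by exact_mod_cast (hN a0 ha0).1.trans (hN a0 ha0).2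
  have hl := Real.log_nonneg hn
  have hl2 : 0 < Real.log 2 := Real.log_pos (by norm_num)
  have h1 : ∀ a ∈ A, ((k a : ℝ) + ((k a : ℝ) - 1) / 2 * Real.log (N a) - Real.log 2
      + (k a : ℝ) * ((k a : ℝ) - 1) / ζ) ≤
      (k a : ℝ) + ((k a : ℝ) - 1) / 2 * Real.log n - Real.log 2 + (k a : ℝ) * (((s : ℝ) - 1) / ζ) := by
    intro a ha
    have hka : (1:ℝ) ≤ k a := by exact_mod_cast hk a ha
    have hks : (k a : ℝ) ≤ s := by
      rw [← hs']
      exact Finset.single_le_sum (f := fun a => (k a : ℝ)) (fun a _ => Nat.cast_nonneg _) ha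
    have hNa : (1:ℝ) ≤ N a := by exact_mod_cast (hN a ha).1
    have hNn : (N a : ℝ) ≤ n := by exact_mod_cast (hN a ha).2
    have h2 := Real.log_le_log (by linarith) hNn
    have h3 : ((k a : ℝ) - 1) / 2 * Real.log (N a) ≤ ((k a : ℝ) - 1) / 2 * Real.log n :=
      mul_le_mul_of_nonneg_left h2 (by linarith)
    have h4 : (k a : ℝ) * ((k a : ℝ) - 1) / ζ ≤ (k a : ℝ) * (((s : ℝ) - 1) / ζ) := by
      rw [mul_div_assoc]
      gcongr
    linarith
  refine (Finset.sum_le_sum h1).trans ?_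
  rw [Finset.sum_add_distrib, Finset.sum_sub_distrib, Finset.sum_add_distrib, ← Finset.sum_mul,
    ← Finset.sum_mul, ← Finset.sum_div, Finset.sum_sub_distrib, hs', Finset.sum_const,
    Finset.sum_const, nsmul_eq_mul, nsmul_eq_mul, mul_one, mul_div_assoc]
  have h5 : ((s:ℝ) - A.card) / 2 * Real.log n ≤ ((s : ℝ) - 1) / 2 * Real.log n :=
    mul_le_mul_of_nonneg_right (by linarith) hl
  nlinarith

lemma letter_choice {𝒳 𝒴 : Type*} [Fintype 𝒳] [Fintype 𝒴] {p : 𝒳 × 𝒴 → ℝ} (hp : IsPMF p)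
    (n : ℕ) (hn : 0 < n) (ε₁ ε₂ ζ : ℝ) (h1 : ε₁ < 1) (hζ : 0 < ζ) (x : Fin n → 𝒳)
    (hx : LetterTypical ε₁ (fun a => ∑ b, p (a, b)) x)
    (hzz : ∀ c, 0 < p c → ζ ≤ n * ((1 - ε₁) * p c))
    (hkk : ∀ c, 0 < p c →
      ((Finset.univ.filter fun c => 0 < p c).card : ℝ) ≤ n * ((ε₂ - ε₁) * p c)) (a : 𝒳) :
    ∃ m : 𝒴 → ℕ, ∑ b, m b = Ncount x a ∧
      (∀ b, |(m b : ℝ) - n * p (a, b)| ≤ n * (ε₂ * p (a, b))) ∧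
      ∑ b, (m b : ℝ) * Wfun p a b ≤ n * ((1 + ε₁) * ∑ b, p (a, b) * Wfun p a b) ∧
      -∑ b, (m b : ℝ) * Wfun p a b - (if 0 < ∑ b, p (a, b) then
        (((Finset.univ.filter fun b => 0 < p (a, b)).card : ℝ) +
        (((Finset.univ.filter fun b => 0 < p (a, b)).card : ℝ) - 1) / 2 * Real.log (Ncount x a)
        - Real.log 2 + ((Finset.univ.filter fun b => 0 < p (a, b)).card : ℝ) *
        (((Finset.univ.filter fun b => 0 < p (a, b)).card : ℝ) - 1) / ζ) else 0)
      ≤ Real.log (Ncount x a).factorial - ∑ b, Real.log (m b).factorial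
        + ∑ b, (m b : ℝ) * Real.log (∑ a, p (a, b)) := by
  have hn' : (0:ℝ) < n := by exact_mod_cast hn
  have hxa : |(Ncount x a : ℝ) - n * ∑ b, p (a, b)| ≤ n * (ε₁ * ∑ b, p (a, b)) := by
    have h := hx a
    have : (Ncount x a : ℝ) - n * ∑ b, p (a, b) = n * ((Ncount x a : ℝ) / n - ∑ b, p (a, b)) := by
      field_simp
    rw [this, abs_mul, abs_of_pos hn']
    exact mul_le_mul_of_nonneg_left h hn'.le
  rcases (P_nonneg hp a).eq_or_lt with h0 | h0
  · have hN : Ncount x a = 0 := by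
      rw [← h0] at hxa
      simpa using hxa
    have hpz : ∀ b, p (a, b) = 0 := fun b => le_antisymm (by rw [h0]; exact le_P hp a b) (hp.1 _)
    refine ⟨fun _ => 0, by simp [hN], by simp [hpz], by simp [hpz], ?_⟩
    rw [if_neg (by rw [← h0]; exact lt_irrefl _)]
    simp [hN]
  · set P := ∑ b, p (a, b) with hP
    have hr : ∀ b, 0 < p (a, b) / P ↔ 0 < p (a, b) := fun b => by
      constructor
      · intro h; by_contra hc
        have : p (a, b) = 0 := le_antisymm (not_lt.1 hc) (hp.1 _)
        rw [this] at h; simp at h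
      · intro h; positivity
    obtain ⟨hx1, hx2⟩ := abs_le.1 hxa
    have hNpos : (0:ℝ) < Ncount x a := by
      have : 0 < n * P * (1 - ε₁) := by have := sub_pos.2 h1; positivity
      linarith
    obtain ⟨m, hm1, hm2, hm3, hm4, hm5⟩ := per_letter (Ncount x a) (by exact_mod_cast hNpos)
      (fun b => p (a, b) / P) (fun b => div_nonneg (hp.1 _) h0.le)
      (by rw [← Finset.sum_div]; exact div_self h0.ne') (Wfun p a) ζ hζ
      (by
        intro b hb
        have hb' := (hr b).1 hb
        refine (hzz (a, b) hb').trans ?_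
        have : n * ((1 - ε₁) * p (a, b)) = (n * ((1 - ε₁) * P)) * (p (a, b) / P) := by field_simp
        rw [this]
        refine mul_le_mul_of_nonneg_right ?_ hb.le
        linarith) (Finset.univ.filter fun b => 0 < p (a, b)).card (by simp only [hr])
    have hm2' : ∀ b, p (a, b) = 0 → m b = 0 := fun b hb => hm2 b (by simp [hb])
    refine ⟨m, hm1, ?_, ?_, ?_⟩
    · intro b
      rcases (hp.1 (a, b)).eq_or_lt with hb | hb
      · rw [← hb, hm2' b hb.symm]; simp
      · have hk : ((Finset.univ.filter fun b => 0 < p (a, b)).card : ℝ) ≤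
            ((Finset.univ.filter fun c => 0 < p c).card : ℝ) := by
          have : (Finset.univ.filter fun b => 0 < p (a, b)).card ≤
              (Finset.univ.filter fun c => 0 < p c).card :=
            Finset.card_le_card_of_injOn (fun b => (a, b)) (by intro b hb; simpa using hb)
              (fun b _ b' _ h => (Prod.ext_iff.1 h).2)
          exact_mod_cast this
        have h2 := hkk (a, b) hb
        have h3 := hm3 b
        have h4 : |(Ncount x a : ℝ) * (p (a, b) / P) - n * p (a, b)| ≤ n * (ε₁ * p (a, b)) := by
          have e : (Ncount x a : ℝ) * (p (a, b) / P) - n * p (a, b)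
            = (Ncount x a - n * P) * (p (a, b) / P) := by field_simp
          have e' : n * (ε₁ * p (a, b)) = n * (ε₁ * P) * (p (a, b) / P) := by field_simp
          rw [e, e', abs_mul, abs_of_pos ((hr b).2 hb)]
          exact mul_le_mul_of_nonneg_right hxa ((hr b).2 hb).le
        have h5 := abs_add_le ((m b : ℝ) - Ncount x a * (p (a, b) / P))
          ((Ncount x a : ℝ) * (p (a, b) / P) - n * p (a, b))
        rw [sub_add_sub_cancel] at h5
        linarith
    · refine hm4.trans ?_
      have e : ∑ b, (Ncount x a : ℝ) * (p (a, b) / P) * Wfun p a b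
          = (Ncount x a / P) * ∑ b, p (a, b) * Wfun p a b := by
        rw [Finset.mul_sum]
        refine Finset.sum_congr rfl fun b _ => ?_
        field_simp
      rw [e, ← mul_assoc]
      refine mul_le_mul_of_nonneg_right ?_ (D_nonneg hp a)
      rw [div_le_iff₀ h0]
      linarith
    · rw [if_pos h0]
      have e : ∑ b, (m b : ℝ) * (-Real.log (p (a, b) / P))
          = -∑ b, (m b : ℝ) * Wfun p a b - ∑ b, (m b : ℝ) * Real.log (∑ a, p (a, b)) := by
        rw [← Finset.sum_neg_distrib, ← Finset.sum_sub_distrib]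
        refine Finset.sum_congr rfl fun b _ => ?_
        rcases (hp.1 (a, b)).eq_or_lt with hb | hb
        · rw [hm2' b hb.symm]; simp
        · rw [Real.log_div hb.ne' h0.ne', Wfun]; ring
      rw [e] at hm5
      linarith

lemma lower_main {𝒳 𝒴 : Type*} [Fintype 𝒳] [Fintype 𝒴] {p : 𝒳 × 𝒴 → ℝ} (hp : IsPMF p)
    (n : ℕ) (ε₁ ε₂ : ℝ) (hε₁ : 0 < ε₁) (h12 : ε₁ < ε₂) (hε₂ : ε₂ ≤ muMin p) (x : Fin n → 𝒳)
    (hx : LetterTypical ε₁ (fun a => ∑ b, p (a, b)) x) (hQ : ∀ b, ∑ a, p (a, b) ≠ 1)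
    (hδ : delta2 (Fintype.card 𝒳 * Fintype.card 𝒴) n ε₁ ε₂ (muMin p) < 1) :
    Real.exp (-(n * (Inat p + 2 * ε₂ * Hnat p))) ≤
      ∑ y : Fin n → 𝒴, (∏ i, ∑ a, p (a, y i))
          * (if LetterTypical ε₂ p (fun i => (x i, y i)) then 1 else 0) := by
  have hμ : 0 < muMin p := by linarith
  obtain ⟨hent, hs2⟩ := entropy_lower hp hμ hQ
  set μ := muMin p with hμdef
  set s := (Finset.univ.filter fun c => 0 < p c).card with hsdef
  have hs2' : (2:ℝ) ≤ s := by exact_mod_cast hs2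
  have hsμ : s * μ ≤ 1 := by
    rw [← hp.2, ← nsmul_eq_mul, ← Finset.sum_const]
    refine (Finset.sum_le_sum fun c hc => mu_le c (by simpa using hc)).trans ?_
    exact Finset.sum_le_sum_of_subset_of_nonneg (Finset.subset_univ _) fun c _ _ => hp.1 c
  have hμ2 : μ ≤ 1 / 2 := by nlinarith
  set t := (n:ℝ) * μ * (ε₂ - ε₁) ^ 2 / (1 + ε₁) with ht
  have hlog : Real.log (2 * s) ≤ t := by
    have hsc : (s:ℝ) ≤ ((Fintype.card 𝒳 * Fintype.card 𝒴 : ℕ) : ℝ) := by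
      have : s ≤ Fintype.card (𝒳 × 𝒴) := Finset.card_le_univ _
      rw [Fintype.card_prod] at this
      exact_mod_cast this
    have h1 : 2 * (s:ℝ) * Real.exp (-t) < 1 := by
      refine lt_of_le_of_lt ?_ hδ
      unfold delta2
      gcongr
    rw [Real.exp_neg, ← div_eq_mul_inv, div_lt_one (Real.exp_pos _)] at h1
    rw [Real.log_le_iff_le_exp (by linarith)]
    exact h1.le
  have ht1 : 1 ≤ t := by
    refine le_trans ?_ hlog
    rw [Real.le_log_iff_exp_le (by linarith)]
    linarith [Real.exp_one_lt_three]
  have hn : 0 < n := by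
    rcases Nat.eq_zero_or_pos n with h | h
    · rw [ht, h] at ht1; norm_num at ht1
    · exact h
  have hn' : (0:ℝ) < n := by exact_mod_cast hn
  have htmul : t * (1 + ε₁) = n * μ * (ε₂ - ε₁) ^ 2 := by rw [ht]; field_simp
  have hΔ : 0 < ε₂ - ε₁ := sub_pos.2 h12
  have hζ : 0 < t / μ ^ 2 := by positivity
  have htn : t ≤ n * μ * ε₂ ^ 2 := by
    have h1 : t ≤ t * (1 + ε₁) := by nlinarith
    rw [htmul] at h1
    refine h1.trans (mul_le_mul_of_nonneg_left ?_ (by positivity))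
    nlinarith
  have hnum := numeric n ε₂ μ t (Hnat p) s hs2 (by linarith) hε₂ hsμ hlog htn hent
  have hz1 : t / μ ^ 2 ≤ n * ((1 - ε₁) * μ) := by
    rw [ht, div_div, div_le_iff₀ (by positivity)]
    have h3 : (ε₂ - ε₁) ^ 2 ≤ (μ - ε₁) ^ 2 := by gcongr
    have h4 : (μ - ε₁) ^ 2 ≤ (1 - ε₁) * (1 + ε₁) * μ ^ 2 := by
      have : μ ^ 2 ≤ 1 := by nlinarith
      have h5 : ε₁ ≤ μ := by linarith
      nlinarith [mul_nonneg hε₁.le (sub_nonneg.2 h5), sq_nonneg ε₁,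
        mul_nonneg (sq_nonneg ε₁) (sub_nonneg.2 this)]
    have := mul_le_mul_of_nonneg_left (h3.trans h4) (mul_pos hn' hμ).le
    linarith
  have hk1 : (s:ℝ) ≤ n * ((ε₂ - ε₁) * μ) := by
    have h1 : (s:ℝ) * (ε₂ - ε₁) ≤ 1 := by
      refine le_trans ?_ hsμ
      exact mul_le_mul_of_nonneg_left (by linarith) (by linarith)
    have h2 : 1 ≤ n * μ * (ε₂ - ε₁) ^ 2 := by rw [← htmul]; nlinarith
    refine le_of_mul_le_mul_right ?_ hΔ
    linarith
  have hch := letter_choice hp n hn ε₁ ε₂ (t / μ ^ 2) (by linarith) hζ x hx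
    (fun c hc => hz1.trans (by
      have := mu_le c hc
      have h1 : 0 ≤ 1 - ε₁ := by linarith
      gcongr))
    (fun c hc => hk1.trans (by
      have := mu_le c hc
      gcongr))
  choose m hm1 hm2 hm3 hm4 using hch
  refine lower_finish hp n hn ε₂ x m hm1 hm2 _ ?_
  have hsum := Finset.sum_le_sum fun (a : 𝒳) (_ : a ∈ Finset.univ) => hm4 a
  rw [Finset.sum_add_distrib, Finset.sum_sub_distrib, Finset.sum_sub_distrib] at hsum
  refine le_trans ?_ hsum
  rw [Finset.sum_neg_distrib, ← Finset.sum_filter]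
  have hW : ∑ a, ∑ b, (m a b : ℝ) * Wfun p a b ≤ n * ((1 + ε₁) * Inat p) := by
    refine (Finset.sum_le_sum fun a _ => hm3 a).trans ?_
    rw [← Finset.mul_sum, ← Finset.mul_sum, Inat]
  have hcost := cost_sum (Finset.univ.filter fun a => 0 < ∑ b, p (a, b)) (by
      obtain ⟨a, _, ha⟩ := Finset.exists_lt_of_sum_lt (s := Finset.univ) (f := fun _ : 𝒳 => (0:ℝ))
        (g := fun a => ∑ b, p (a, b)) (by simp [sum_P hp])
      exact ⟨a, by simpa using ha⟩)
    (fun a => (Finset.univ.filter fun b => 0 < p (a, b)).card) (Ncount x) (by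
      intro a ha
      have ha' : 0 < ∑ b, p (a, b) := by simpa using ha
      obtain ⟨b, _, hb⟩ := Finset.exists_lt_of_sum_lt (s := Finset.univ) (f := fun _ : 𝒴 => (0:ℝ))
        (g := fun b => p (a, b)) (by simpa using ha')
      exact Finset.card_pos.2 ⟨b, by simpa using hb⟩) s n (by
      have h1 : ∀ a ∉ Finset.univ.filter fun a => 0 < ∑ b, p (a, b),
          (Finset.univ.filter fun b => 0 < p (a, b)).card = 0 := by
        intro a ha
        rw [Finset.card_eq_zero, Finset.filter_eq_empty_iff]
        intro b _ hb
        exact ha (by simpa using hb.trans_le (le_P hp a b))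
      rw [Finset.sum_subset (Finset.subset_univ _) (fun a _ ha => h1 a ha), hsdef]
      simp only [Finset.card_filter]
      rw [Fintype.sum_prod_type]) (by
      intro a ha
      have ha' : 0 < ∑ b, p (a, b) := by simpa using ha
      constructor
      · by_contra hc
        have hN : Ncount x a = 0 := by omega
        have := hx a
        simp only [hN, Nat.cast_zero, zero_div, zero_sub, abs_neg, abs_of_pos ha'] at this
        nlinarith
      · refine (Finset.card_le_univ _).trans ?_
        simp) (t / μ ^ 2) hζ
  have hI := I_nonneg hp
  have hIH := I_le_H hp
  have h5 : ε₁ * Inat p ≤ ε₂ * Hnat p := mul_le_mul h12.le hIH hI (by linarith)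
  have h6 := mul_le_mul_of_nonneg_left h5 hn'.le
  linarith [hcost, hnum, hW]
/-- **Conditional typicality probability bounds (Appendix Lemma 2).**  Let `pXY` be a
pmf on `𝒳 × 𝒴`, and let `Y^n` be iid with law the `𝒴`-marginal of `pXY`.  If
`0 < ε₁ < ε₂ ≤ μ(pXY)` and `x ∈ T_{ε₁}^{(n)}(p_X)`, then
`(1 − δ₂)·2^{−n(I(X;Y)+2ε₂H(Y))} ≤ Pr[Y^n ∈ T_{ε₂}^{(n)}(pXY | x)] ≤ 2^{−n(I(X;Y)−2ε₂H(Y))}`. -/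
theorem conditional_typicality_bounds
    {𝒳 𝒴 : Type*} [Fintype 𝒳] [Fintype 𝒴]
    (pXY : 𝒳 × 𝒴 → ℝ) (hpXY : IsPMF pXY)
    (n : ℕ) (ε₁ ε₂ : ℝ)
    (hε₁ : 0 < ε₁) (hε₁₂ : ε₁ < ε₂) (hε₂ : ε₂ ≤ muMin pXY)
    (x : Fin n → 𝒳)
    (hx : LetterTypical ε₁ (fun a => ∑ b, pXY (a, b)) x) :
    (1 - delta2 (Fintype.card 𝒳 * Fintype.card 𝒴) n ε₁ ε₂ (muMin pXY))
        * (2 : ℝ) ^ (-((n : ℝ) * (MI pXY Prod.fst Prod.snd + 2 * ε₂ * H2 pXY Prod.snd)))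
      ≤ (∑ y : Fin n → 𝒴, (∏ i, ∑ a, pXY (a, y i))
          * (if LetterTypical ε₂ pXY (fun i => (x i, y i)) then 1 else 0)) ∧
    (∑ y : Fin n → 𝒴, (∏ i, ∑ a, pXY (a, y i))
          * (if LetterTypical ε₂ pXY (fun i => (x i, y i)) then 1 else 0))
      ≤ (2 : ℝ) ^ (-((n : ℝ) * (MI pXY Prod.fst Prod.snd - 2 * ε₂ * H2 pXY Prod.snd))) := by
  have hlog2 : (0:ℝ) < Real.log 2 := Real.log_pos (by norm_num)
  have hI := MI_eq pXY
  have hH := H2_snd pXY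
  have e1 : (2 : ℝ) ^ (-((n : ℝ) * (MI pXY Prod.fst Prod.snd + 2 * ε₂ * H2 pXY Prod.snd)))
      = Real.exp (-(n * (Inat pXY + 2 * ε₂ * Hnat pXY))) := by
    rw [Real.rpow_def_of_pos (by norm_num), ← hI, ← hH]
    congr 1; ring
  have e2 : (2 : ℝ) ^ (-((n : ℝ) * (MI pXY Prod.fst Prod.snd - 2 * ε₂ * H2 pXY Prod.snd)))
      = Real.exp (-(n * (Inat pXY - 2 * ε₂ * Hnat pXY))) := by
    rw [Real.rpow_def_of_pos (by norm_num), ← hI, ← hH]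
    congr 1; ring
  rw [e1, e2]
  refine ⟨?_, upper_bound hpXY n ε₂ (by linarith) x⟩
  have hpos := Real.exp_pos (-(n * (Inat pXY + 2 * ε₂ * Hnat pXY)))
  have hnn : 0 ≤ ∑ y : Fin n → 𝒴, (∏ i, ∑ a, pXY (a, y i))
          * (if LetterTypical ε₂ pXY (fun i => (x i, y i)) then (1:ℝ) else 0) := by
    refine Finset.sum_nonneg fun y _ =>
      mul_nonneg (Finset.prod_nonneg fun i _ => Q_nonneg hpXY _) ?_
    split_ifs <;> norm_num
  have hd0 : 0 ≤ delta2 (Fintype.card 𝒳 * Fintype.card 𝒴) n ε₁ ε₂ (muMin pXY) := by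
    unfold delta2; positivity
  rcases le_or_gt 1 (delta2 (Fintype.card 𝒳 * Fintype.card 𝒴) n ε₁ ε₂ (muMin pXY)) with hd | hd
  · refine le_trans ?_ hnn
    exact mul_nonpos_of_nonpos_of_nonneg (by linarith) hpos.le
  · refine le_trans (mul_le_of_le_one_left hpos.le (by linarith)) ?_
    by_cases hQ : ∃ b0, ∑ a, pXY (a, b0) = 1
    · obtain ⟨b0, hb0⟩ := hQ
      refine le_trans ?_ (const_case hpXY n ε₁ ε₂ hε₁₂ x hx b0 hb0)
      rw [Real.exp_le_one_iff]
      have h1 := I_nonneg hpXY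
      have h2 := H_nonneg hpXY
      have h3 : 0 < ε₂ := by linarith
      have : 0 ≤ (n:ℝ) * (Inat pXY + 2 * ε₂ * Hnat pXY) := by positivity
      linarith
    · push Not at hQ
      exact lower_main hpXY n ε₁ ε₂ hε₁ hε₁₂ hε₂ x hx hQ hd

end
end
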